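/- Let p > 3 be a prime. If p ≡ 1 (mod 3), write 4p = x^2 + 27y^2 with integers x, y; then Σ_{k=0}^{p−1} k^2·C(2k,k)^2·C(3k,k)/(−192)^k ≡ (2/125)x^2 − (27/250)p + 11p^2/(250x^2) (mod p^3) and Σ_{k=0}^{p−1} k^3·C(2k,k)^2·C(3k,k)/(−192)^k ≡ (21/6250)x^2 − (221/12500)p − 447p^2/(12500x^2) (mod p^3). If p ≡ 2 (mod 3) and p ≠ 5, then Σ_{k=0}^{p−1} k^2·C(2k,k)^2·C(3k,k)/(−192)^k ≡ (2/25)(2p+1)·C(⌊2p/3⌋, ⌊p/3⌋)^2 + (19/250)p (mod p^2) and Σ_{k=0}^{p−1} k^3·C(2k,k)^2·C(3k,k)/(−192)^k ≡ −(27/625)(2p+1)·C(⌊2p/3⌋, ⌊p/3⌋)^2 + (137/12500)p (mod p^2). -/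

import Mathlib

/-- `a ≡ b (mod p^r)` for rationals: the numerator of `a - b` in lowest terms
is divisible by `p^r`. -/
def ratCongr (p r : ℕ) (a b : ℚ) : Prop := (p : ℤ)^r ∣ (a - b).num

set_option linter.unusedSimpArgs false

namespace S8
section alg
variable {R A : Type*} [CommRing R] [CommRing A] [Algebra R A] (D : Derivation R A A)

def LL (X y : A) : A := D (D y) - 2 * (X * (1 - X)) * y
def MM (X y : A) : A := D (D (D y)) - 4 * (D (X * (1 - X) * y) + X * (1 - X) * D y)

lemma MM_add (X y z : A) : MM D X (y + z) = MM D X y + MM D X z := by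
  simp only [MM, mul_add, map_add]; ring

lemma MM_sub (X y z : A) : MM D X (y - z) = MM D X y - MM D X z := by
  simp only [MM, mul_sub, map_sub]; ring

lemma MM_zero (X : A) : MM D X 0 = 0 := by simp [MM]

lemma MM_const (X y c : A) (hc : D c = 0) : MM D X (c * y) = c * MM D X y := by
  simp only [MM, Derivation.leibniz, hc, smul_eq_mul, map_sub, map_add, map_zero]; ring

lemma MM_sum {ι : Type*} (s : Finset ι) (X : A) (f : ι → A) :
    MM D X (∑ i ∈ s, f i) = ∑ i ∈ s, MM D X (f i) := by
  classical
  induction s using Finset.induction_on with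
  | empty => simp [MM_zero]
  | insert a s ha ih => rw [Finset.sum_insert ha, Finset.sum_insert ha, MM_add, ih]

lemma MM_prod (X y1 y2 : A) : MM D X (y1 * y2) =
    D (LL D X y1) * y2 + 3 * LL D X y1 * D y2 + D (LL D X y2) * y1 + 3 * LL D X y2 * D y1 := by
  have h2 : D (2 : A) = 0 := by exact_mod_cast D.map_natCast 2
  simp only [MM, LL, Derivation.leibniz, smul_eq_mul, map_sub, map_add, h2, map_zero,
    Derivation.map_one_eq_zero]; ring

lemma D_pow (a : A) (n : ℕ) : D (a ^ n) = n * a ^ (n - 1) * D a := by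
  rw [Derivation.leibniz_pow]; simp [mul_assoc]

lemma D_pow_log (a b : A) (h : D a = a * b) (n : ℕ) : D (a ^ n) = n * a ^ n * b := by
  induction n with
  | zero => simp
  | succ n ih => rw [pow_succ, Derivation.leibniz, ih, h]; simp only [smul_eq_mul]; push_cast; ring

/-- monomial identity for the derivative of z. -/
lemma MM_mono' (X z : A) (hX : D X = 3 * X * (1 - X)) (hz : z = 4 * X * (1 - X)) (k : ℕ) :
    2 * MM D X (z ^ k) = 3 * (1 - 2 * X) * (18 * (k:A) ^ 3 * z ^ k
      - (2 * k + 1) * (3 * k + 1) * (3 * k + 2) * z ^ (k + 1)) := by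
  have h2 : D (2 : A) = 0 := by exact_mod_cast D.map_natCast 2
  have h3 : D (3 : A) = 0 := by exact_mod_cast D.map_natCast 3
  have h4 : D (4 : A) = 0 := by exact_mod_cast D.map_natCast 4
  have hk : D (k : A) = 0 := by exact_mod_cast D.map_natCast k
  have hDz : D z = z * (3 * (1 - 2 * X)) := by
    rw [hz]
    simp only [Derivation.leibniz, smul_eq_mul, map_sub, map_add, h4, hX,
      Derivation.map_one_eq_zero]; ring
  have hzk := D_pow_log D z _ hDz k
  simp only [MM, Derivation.leibniz, smul_eq_mul, map_sub, map_add, h2, h3, hk, hX, hzk,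
      Derivation.map_one_eq_zero, map_zero]
  rw [pow_succ, hz]
  ring

/-- monomial identity for `Q^2 z^k`. -/
lemma MM_monoQ (t Q z : A) (ht : D t = t * (1 - t ^ 3)) (hQ : (1 + 2 * t) * Q = 1)
    (hz : z = 36 * (t * (1 - t) ^ 2 * (1 - t ^ 3)) * Q ^ 6) (k : ℕ) :
    18 * MM D (t ^ 3) (Q ^ 2 * z ^ k) =
     (2 * (1 - t) ^ 3 - (1 + 2 * t) ^ 3) * (1 + 2 * t) ^ 3 * Q ^ 2 * (18 * (k:A) ^ 3 * z ^ k
      - (2 * k + 1) * (3 * k + 1) * (3 * k + 2) * z ^ (k + 1)) := by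
  have h2 : D (2 : A) = 0 := by exact_mod_cast D.map_natCast 2
  have h3 : D (3 : A) = 0 := by exact_mod_cast D.map_natCast 3
  have h4 : D (4 : A) = 0 := by exact_mod_cast D.map_natCast 4
  have h36 : D (36 : A) = 0 := by exact_mod_cast D.map_natCast 36
  have hk : D (k : A) = 0 := by exact_mod_cast D.map_natCast k
  have hDQ : D Q = Q * (-2 * t * (1 - t ^ 3) * Q) := by
    have := congrArg D hQ
    simp only [Derivation.leibniz, smul_eq_mul, map_add, h2, ht, Derivation.map_one_eq_zero] at this
    linear_combination Q * this - (D Q) * hQ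
  have hQ6 := D_pow_log D Q _ hDQ 6
  set E := 2 * (1 - t) ^ 3 - (1 + 2 * t) ^ 3 with hE
  have hDz : D z = z * (E * Q) := by
    rw [hz]
    simp only [Derivation.leibniz, smul_eq_mul, map_sub, map_add, h36, ht, hQ6, D_pow,
      Derivation.map_one_eq_zero]
    rw [hE]
    push_cast
    linear_combination (-36 * (t * (1 - t) ^ 2 * (1 - t ^ 3)) * Q ^ 6 *
      (1 - 2 * t - 2 * t ^ 2 - 6 * t ^ 3)) * hQ
  have step : ∀ (n : ℕ) (α : A), D (Q ^ n * z ^ k * α) = Q ^ (n + 1) * z ^ k *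
      ((k * E - 2 * n * (t * (1 - t ^ 3))) * α + (1 + 2 * t) * D α) := by
    intro n α
    simp only [Derivation.leibniz, smul_eq_mul, D_pow_log D z _ hDz k, D_pow_log D Q _ hDQ n]
    linear_combination (-Q ^ n * z ^ k * D α) * hQ
  have ht3 : D (t ^ 3) = 3 * t ^ 3 * (1 - t ^ 3) := D_pow_log D t _ ht 3
  have hDE : D E = (-6 * (1 - t) ^ 2 - 6 * (1 + 2 * t) ^ 2) * (t * (1 - t ^ 3)) := by
    rw [hE]
    simp only [Derivation.leibniz, smul_eq_mul, map_sub, map_add, h2, ht, D_pow,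
      Derivation.map_one_eq_zero]
    push_cast; ring
  have s1 := step 2 1
  have s2 := step 3 ((k * E - 4 * (t * (1 - t ^ 3))))
  have hα1 : D (k * E - 4 * (t * (1 - t ^ 3))) =
     k * ((-6 * (1 - t) ^ 2 - 6 * (1 + 2 * t) ^ 2) * (t * (1 - t ^ 3)))
       - 4 * (t * (1 - t ^ 3) * (1 - t ^ 3) - 3 * t ^ 3 * (1 - t ^ 3) * t) := by
    simp only [Derivation.leibniz, smul_eq_mul, map_sub, map_add, hDE, hk, h4, ht, ht3,
      Derivation.map_one_eq_zero]
    ring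
  rw [hα1] at s2
  have s3 := step 4 ((k * E - 6 * (t * (1 - t ^ 3))) * (k * E - 4 * (t * (1 - t ^ 3)))
     + (1 + 2 * t) * (k * ((-6 * (1 - t) ^ 2 - 6 * (1 + 2 * t) ^ 2) * (t * (1 - t ^ 3)))
       - 4 * (t * (1 - t ^ 3) * (1 - t ^ 3) - 3 * t ^ 3 * (1 - t ^ 3) * t)))
  have e1 : D (Q ^ 2 * z ^ k) = Q ^ 3 * z ^ k * ((k * E - 4 * (t * (1 - t ^ 3)))) := by
    rw [← mul_one (Q ^ 2 * z ^ k), s1]; simp; ring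
  have e2 : D (D (Q ^ 2 * z ^ k)) = Q ^ 4 * z ^ k *
    ((k * E - 6 * (t * (1 - t ^ 3))) * (k * E - 4 * (t * (1 - t ^ 3)))
     + (1 + 2 * t) * (k * ((-6 * (1 - t) ^ 2 - 6 * (1 + 2 * t) ^ 2) * (t * (1 - t ^ 3)))
       - 4 * (t * (1 - t ^ 3) * (1 - t ^ 3) - 3 * t ^ 3 * (1 - t ^ 3) * t))) := by
    rw [e1, s2]; push_cast; ring
  have h6 : D (6 : A) = 0 := by exact_mod_cast D.map_natCast 6
  have hn6 : D (-6 : A) = 0 := by rw [map_neg, h6, neg_zero]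
  have hZ : D (t ^ 3 * (1 - t ^ 3) * (Q ^ 2 * z ^ k)) =
     3 * (t ^ 3 * (1 - t ^ 3)) * (1 - 2 * t ^ 3) * (Q ^ 2 * z ^ k)
       + t ^ 3 * (1 - t ^ 3) * D (Q ^ 2 * z ^ k) := by
    rw [Derivation.leibniz, D.leibniz (t ^ 3), map_sub, ht3]
    simp only [Derivation.map_one_eq_zero, smul_eq_mul]; ring
  have hQ2 : Q ^ 2 = Q ^ 5 * (1 + 2 * t) ^ 3 := by
    have : ((1 + 2 * t) * Q) ^ 3 = 1 := by rw [hQ, one_pow]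
    linear_combination (-Q ^ 2) * this
  have hQ3 : Q ^ 3 = Q ^ 5 * (1 + 2 * t) ^ 2 := by
    have : ((1 + 2 * t) * Q) ^ 2 = 1 := by rw [hQ, one_pow]
    linear_combination (-Q ^ 3) * this
  have hR : (1 + 2 * t) ^ 3 * Q ^ 2 * (18 * (k:A) ^ 3 * z ^ k
      - (2 * k + 1) * (3 * k + 1) * (3 * k + 2) * z ^ (k + 1)) =
      Q ^ 5 * z ^ k * (18 * k ^ 3 * (1 + 2 * t) ^ 6 - (2 * k + 1) * (3 * k + 1) * (3 * k + 2) *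
       (36 * (t * (1 - t) ^ 2 * (1 - t ^ 3)))) := by
    have h3 : ((1 + 2 * t) * Q) ^ 3 = 1 := by rw [hQ, one_pow]
    have h5 : (1 + 2 * t) ^ 3 * Q ^ 2 * z = Q ^ 5 * (36 * (t * (1 - t) ^ 2 * (1 - t ^ 3))) := by
      rw [hz]
      linear_combination (Q ^ 5 * (36 * (t * (1 - t) ^ 2 * (1 - t ^ 3)))) * h3
    linear_combination ((1 + 2 * t) ^ 3 * (18 * (k:A) ^ 3 * z ^ k)) * hQ2 -
      (2 * k + 1) * (3 * k + 1) * (3 * k + 2) * z ^ k * h5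
  have hα2 : D ((k * E - 6 * (t * (1 - t ^ 3))) * (k * E - 4 * (t * (1 - t ^ 3)))
     + (1 + 2 * t) * (k * ((-6 * (1 - t) ^ 2 - 6 * (1 + 2 * t) ^ 2) * (t * (1 - t ^ 3)))
       - 4 * (t * (1 - t ^ 3) * (1 - t ^ 3) - 3 * t ^ 3 * (1 - t ^ 3) * t))) = 
      (k * ((-6 * (1 - t) ^ 2 - 6 * (1 + 2 * t) ^ 2) * (t * (1 - t ^ 3)))
        - 6 * (t * (1 - t ^ 3) * (1 - 4 * t ^ 3))) * (k * E - 4 * (t * (1 - t ^ 3)))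
      + (k * E - 6 * (t * (1 - t ^ 3))) * 
      (k * ((-6 * (1 - t) ^ 2 - 6 * (1 + 2 * t) ^ 2) * (t * (1 - t ^ 3)))
        - 4 * (t * (1 - t ^ 3) * (1 - 4 * t ^ 3)))
      + 2 * (t * (1 - t ^ 3)) * 
        (k * ((-6 * (1 - t) ^ 2 - 6 * (1 + 2 * t) ^ 2) * (t * (1 - t ^ 3)))
       - 4 * (t * (1 - t ^ 3) * (1 - t ^ 3) - 3 * t ^ 3 * (1 - t ^ 3) * t))
      + (1 + 2 * t) * (k * ((12 * (1 - t) - 24 * (1 + 2 * t)) * (t * (1 - t ^ 3)) ^ 2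
         + (-6 * (1 - t) ^ 2 - 6 * (1 + 2 * t) ^ 2) * (t * (1 - t ^ 3) * (1 - 4 * t ^ 3)))
         - 4 * (t * (1 - t ^ 3) * (1 - 4 * t ^ 3) * (1 - 4 * t ^ 3)
            - t * (1 - t ^ 3) * (12 * t ^ 3 * (1 - t ^ 3)))) := by
    simp only [Derivation.leibniz, smul_eq_mul, map_sub, map_add, hDE, hk, h2, h3, h4, h6, hn6,
      ht, ht3, D_pow, Derivation.map_one_eq_zero]
    push_cast
    ring
  rw [hα2] at s3
  unfold MM
  rw [e2, s3, hZ, e1, mul_assoc E, mul_assoc E, hR, hQ3, hQ2, hE]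
  push_cast
  ring
end alg
end S8

namespace S8
section alg2
variable {R A : Type*} [CommRing R] [CommRing A] [Algebra R A] (D : Derivation R A A)

lemma tele (a : ℕ → A) (z : A)
    (hrec : ∀ k : ℕ, 18 * ((k:A) + 1) ^ 3 * a (k + 1) = (2 * k + 1) * (3 * k + 1) * (3 * k + 2) * a k)
    (N : ℕ) :
    ∑ k ∈ Finset.range N, a k * (18 * (k:A) ^ 3 * z ^ k
      - (2 * k + 1) * (3 * k + 1) * (3 * k + 2) * z ^ (k + 1)) = - (18 * (N:A) ^ 3 * a N * z ^ N) := by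
  induction N with
  | zero => simp
  | succ n ih =>
    rw [Finset.sum_range_succ, ih]; push_cast
    linear_combination (z ^ (n + 1)) * hrec n

lemma MM_V0 (X z : A) (hX : D X = 3 * X * (1 - X)) (hz : z = 4 * X * (1 - X)) (a : ℕ → A)
    (hDa : ∀ k, D (a k) = 0)
    (hrec : ∀ k : ℕ, 18 * ((k:A) + 1) ^ 3 * a (k + 1) = (2 * k + 1) * (3 * k + 1) * (3 * k + 2) * a k)
    (N : ℕ) : 2 * MM D X (∑ k ∈ Finset.range N, a k * z ^ k) =
      -(54 * (1 - 2 * X) * (N:A) ^ 3 * a N * z ^ N) := by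
  rw [MM_sum, Finset.mul_sum]
  have : ∀ k ∈ Finset.range N, 2 * MM D X (a k * z ^ k) = 3 * (1 - 2 * X) *
     (a k * (18 * (k:A) ^ 3 * z ^ k
      - (2 * k + 1) * (3 * k + 1) * (3 * k + 2) * z ^ (k + 1))) := by
    intro k _
    rw [MM_const _ _ _ _ (hDa k)]
    linear_combination (a k) * MM_mono' D X z hX hz k
  rw [Finset.sum_congr rfl this, ← Finset.mul_sum, tele a z hrec]
  ring

lemma MM_W (t Q z : A) (ht : D t = t * (1 - t ^ 3)) (hQ : (1 + 2 * t) * Q = 1)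
    (hz : z = 36 * (t * (1 - t) ^ 2 * (1 - t ^ 3)) * Q ^ 6) (a : ℕ → A)
    (hDa : ∀ k, D (a k) = 0)
    (hrec : ∀ k : ℕ, 18 * ((k:A) + 1) ^ 3 * a (k + 1) = (2 * k + 1) * (3 * k + 1) * (3 * k + 2) * a k)
    (N : ℕ) : 18 * MM D (t ^ 3) (∑ k ∈ Finset.range N, a k * (Q ^ 2 * z ^ k)) =
      -(18 * ((2 * (1 - t) ^ 3 - (1 + 2 * t) ^ 3) * (1 + 2 * t) ^ 3 * Q ^ 2) *
         (N:A) ^ 3 * a N * z ^ N) := by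
  rw [MM_sum, Finset.mul_sum]
  have : ∀ k ∈ Finset.range N, 18 * MM D (t ^ 3) (a k * (Q ^ 2 * z ^ k)) =
     ((2 * (1 - t) ^ 3 - (1 + 2 * t) ^ 3) * (1 + 2 * t) ^ 3 * Q ^ 2) *
     (a k * (18 * (k:A) ^ 3 * z ^ k
      - (2 * k + 1) * (3 * k + 1) * (3 * k + 2) * z ^ (k + 1))) := by
    intro k _
    rw [MM_const _ _ _ _ (hDa k)]
    linear_combination (a k) * MM_monoQ D t Q z ht hQ hz k
  rw [Finset.sum_congr rfl this, ← Finset.mul_sum, tele a z hrec]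
  ring

lemma LL_add (X y z : A) : LL D X (y + z) = LL D X y + LL D X z := by
  simp only [LL, mul_add, map_add]; ring

/-- ODE of the truncated rank two series. -/
lemma ODE_phi (X w : A) (hX : D X = 3 * X * (1 - X)) (hw : D w = 0) (c : ℕ → A)
    (hDc : ∀ k, D (c k) = 0) (M : ℕ)
    (hrec : ∀ k : ℕ, k < M → (3 * (k:A) + 3 - w) ^ 2 * c (k + 1) =
       (3 * k + 1 - w) * (3 * k + 2 - w) * c k) (φ : A)
    (hφ : φ = ∑ k ∈ Finset.range (M + 1), c k * X ^ k) :
    LL D X φ - 2 * w * (1 - X) * D φ + 3 * w * (X * (1 - X)) * φ + w ^ 2 * (1 - X) ^ 2 * φ =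
      (1 - X) * (w ^ 2 * c 0 - (3 * M + 1 - w) * (3 * M + 2 - w) * c M * X ^ (M + 1)) := by
  have h3 : D (3 : A) = 0 := by exact_mod_cast D.map_natCast 3
  have mono : ∀ k : ℕ, LL D X (c k * X ^ k) - 2 * w * (1 - X) * D (c k * X ^ k)
     + 3 * w * (X * (1 - X)) * (c k * X ^ k) + w ^ 2 * (1 - X) ^ 2 * (c k * X ^ k) =
     (1 - X) * ((3 * k - w) ^ 2 * c k * X ^ k - (3 * k + 1 - w) * (3 * k + 2 - w) * c k * X ^ (k + 1)) := by
    intro k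
    have hk : D (k : A) = 0 := by exact_mod_cast D.map_natCast k
    have hXk := D_pow_log D X (3 * (1 - X)) (by rw [hX]; ring) k
    simp only [LL, Derivation.leibniz, smul_eq_mul, map_sub, map_add, h3, hk, hX, hXk, hDc k,
      Derivation.map_one_eq_zero, map_zero]
    ring
  induction M generalizing φ with
  | zero =>
    have h := mono 0
    have : φ = c 0 * X ^ 0 := by rw [hφ]; simp
    rw [this, h]; push_cast; ring
  | succ n ih =>
    have h := ih (fun k hk => hrec k (by omega)) _ rfl
    rw [hφ, Finset.sum_range_succ, LL_add, map_add]
    have h1 := mono (n + 1)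
    have h2 := hrec n (by omega)
    push_cast at *
    linear_combination h + h1 + (1 - X) * X ^ (n + 1) * h2

variable (P : A)

def alphaF (X φ : A) : A := -(1 - X) ^ 2 * φ + (1 - X)
def betaF (X φ χ : A) : A := 4 * (1 - X) * D χ - 6 * (X * (1 - X)) * χ + 3 * (1 - X) ^ 2 * φ
  - 3 * (1 - X) - 4 * P * (1 - X) ^ 2 * χ
def rhoF (X φ χ Q : A) : A := alphaF X φ * Q + (1 - X) ^ 2 * (2 * Q - 1) * (Q ^ 2 - Q) * φ
  + betaF D P X φ χ * Q ^ 2 + 4 * (1 - X) * Q * (Q ^ 2 - Q) * D χ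
  + χ * (-6 * (X * (1 - X)) * Q * (Q ^ 2 - Q)
     + 2 * P * (1 - X) ^ 2 * ((Q ^ 2 - Q) + Q * (2 * Q - 1)) * (Q ^ 2 - Q))
def TF (X φ χ e Q y : A) : A :=
  18 * (D (rhoF D P X φ χ Q) * y + 3 * rhoF D P X φ χ Q * D y)
   + 18 * MM D X (Q ^ 4 * (χ * χ)) + MM D X ((3 * Q - 1) * Q ^ 2 * e)

lemma LL_y (X φ χ Q : A) (hX : D X = 3 * X * (1 - X)) (hP : D P = 0)
    (hQ : D Q = P * (1 - X) * (Q ^ 2 - Q))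
    (h1 : LL D X φ = P * (2 * (1 - X) * D φ - 3 * (X * (1 - X)) * φ) + P ^ 2 * alphaF X φ)
    (h2 : LL D X χ = -2 * (1 - X) * D φ + 3 * (X * (1 - X)) * φ + P * betaF D P X φ χ) :
    LL D X (φ * Q + P * χ * Q ^ 2) = P ^ 2 * rhoF D P X φ χ Q := by
  have n2 : D (2 : A) = 0 := by exact_mod_cast D.map_natCast 2
  have e1 : D (D φ) = 2 * (X * (1 - X)) * φ + (P * (2 * (1 - X) * D φ - 3 * (X * (1 - X)) * φ) + P ^ 2 * alphaF X φ) := by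
    rw [← h1, LL]; ring
  have e2 : D (D χ) = 2 * (X * (1 - X)) * χ + (-2 * (1 - X) * D φ + 3 * (X * (1 - X)) * φ + P * betaF D P X φ χ) := by
    rw [← h2, LL]; ring
  have hQ2 : D (Q ^ 2) = 2 * Q * (P * (1 - X) * (Q ^ 2 - Q)) := by
    rw [D_pow, hQ]; push_cast; ring
  simp only [LL, Derivation.leibniz, smul_eq_mul, map_sub, map_add, hX, hQ, hQ2, n2, hP, e1, e2,
      Derivation.map_one_eq_zero, map_zero]
  unfold rhoF alphaF
  ring

lemma MM_What (X φ χ e Q y : A) (hX : D X = 3 * X * (1 - X)) (hP : D P = 0)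
    (hQ : D Q = P * (1 - X) * (Q ^ 2 - Q))
    (h1 : LL D X φ = P * (2 * (1 - X) * D φ - 3 * (X * (1 - X)) * φ) + P ^ 2 * alphaF X φ)
    (h2 : LL D X χ = -2 * (1 - X) * D φ + 3 * (X * (1 - X)) * φ + P * betaF D P X φ χ)
    (hy : y = φ * Q + P * χ * Q ^ 2) :
    MM D X (9 * (y * y) + (18 * P ^ 2) * (Q ^ 4 * (χ * χ)) + P ^ 2 * ((3 * Q - 1) * Q ^ 2 * e))
      = P ^ 2 * TF D P X φ χ e Q y := by
  have n9 : D (9 : A) = 0 := by exact_mod_cast D.map_natCast 9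
  have n18 : D (18 : A) = 0 := by exact_mod_cast D.map_natCast 18
  have hP2 : D (P ^ 2) = 0 := by rw [D_pow, hP]; simp
  have hy' := LL_y D P X φ χ Q hX hP hQ h1 h2
  rw [← hy] at hy'
  rw [MM_add, MM_add, MM_const D X _ 9 n9, MM_const D X _ (18 * P ^ 2), MM_const D X _ (P ^ 2) hP2,
    MM_prod, hy', D.leibniz, hP2, TF]
  · simp only [smul_eq_mul]; ring
  · rw [D.leibniz, n18, hP2]; simp

lemma TF_zero (X φ χ e Q : A) (hX : D X = 3 * X * (1 - X)) (hQ : D Q = 0)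
    (h1 : LL D X φ = 0)
    (h2 : LL D X χ = -2 * (1 - X) * D φ + 3 * (X * (1 - X)) * φ)
    (he : MM D X e = 54 * (-(X * (1 - X)) * φ + (1 - X) * D φ)) :
    TF D 0 X φ χ e Q (φ * Q) = 0 := by
  have n2 : D (2 : A) = 0 := by exact_mod_cast D.map_natCast 2
  have n3 : D (3 : A) = 0 := by exact_mod_cast D.map_natCast 3
  have n4 : D (4 : A) = 0 := by exact_mod_cast D.map_natCast 4
  have n6 : D (6 : A) = 0 := by exact_mod_cast D.map_natCast 6
  have nn2 : D (-2 : A) = 0 := by rw [map_neg, n2, neg_zero]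
  have nn6 : D (-6 : A) = 0 := by rw [map_neg, n6, neg_zero]
  have hQn : ∀ n, D (Q ^ n) = 0 := by intro n; rw [D_pow, hQ]; simp
  have e1 : D (D φ) = 2 * (X * (1 - X)) * φ := by
    rw [LL] at h1; linear_combination h1
  have e2 : D (D χ) = 2 * (X * (1 - X)) * χ + (-2 * (1 - X) * D φ + 3 * (X * (1 - X)) * φ) := by
    rw [← h2, LL]; ring
  have h1X : D ((1 - X) ^ 2) = 2 * (1 - X) * (-(3 * X * (1 - X))) := by
    rw [D_pow, map_sub, hX]; simp
  have hcoef : D ((3 * Q - 1) * Q ^ 2) = 0 := by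
    simp [Derivation.leibniz, hQ, hQn, n3]
  rw [TF, MM_const D X _ _ (hQn 4), MM_const D X _ _ hcoef, he, MM_prod, h2]
  unfold rhoF betaF alphaF
  simp only [LL, Derivation.leibniz, smul_eq_mul, map_sub, map_add, map_neg, hX, hQ, hQn, h1X, n2, n3, n4, n6, nn2, nn6, e1, e2,
      Derivation.map_one_eq_zero, map_zero]
  ring
end alg2
end S8

namespace S8
open PowerSeries
section ps
variable (K : Type*) [CommRing K]

noncomputable def D1 : Derivation K K⟦X⟧ K⟦X⟧ := ((X : K⟦X⟧) * (1 - X ^ 3)) • (d⁄dX K)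

variable {K}
lemma D1_apply (f : K⟦X⟧) : D1 K f = X * (1 - X ^ 3) * d⁄dX K f := rfl

lemma D1_X : D1 K (X : K⟦X⟧) = X * (1 - X ^ 3) := by
  rw [D1_apply]; simp [derivative_X]

lemma D1_X3 : D1 K ((X : K⟦X⟧) ^ 3) = 3 * X ^ 3 * (1 - X ^ 3) := by
  have := D_pow_log (D1 K) X _ D1_X 3
  exact_mod_cast this

lemma coeff_theta (f : K⟦X⟧) (n : ℕ) : coeff n (X * d⁄dX K f) = n * coeff n f := by
  cases n with
  | zero => simp
  | succ n => rw [coeff_succ_X_mul, coeff_derivative]; push_cast; ring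

lemma coeff_D1 (f : K⟦X⟧) (n : ℕ) : coeff n (D1 K f) =
    n * coeff n f - if 3 ≤ n then ((n - 3 : ℕ) : K) * coeff (n - 3) f else 0 := by
  rw [D1_apply, show (X : K⟦X⟧) * (1 - X ^ 3) * d⁄dX K f = X * d⁄dX K f - X ^ 3 * (X * d⁄dX K f) by ring,
    map_sub, coeff_theta, coeff_X_pow_mul']
  simp only [coeff_theta]

def Hn (n : ℕ) (f : K⟦X⟧) : Prop := ∀ m, m < n → m % 3 = n % 3 → coeff m f = 0

lemma Hn_D1 {n : ℕ} {f : K⟦X⟧} (h : Hn n f) : Hn n (D1 K f) := by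
  intro m hm hm3
  rw [coeff_D1, h m hm hm3]
  split_ifs with h3
  · rw [h (m - 3) (by omega) (by omega)]; simp
  · simp

lemma coeff_D1_Hn {n : ℕ} {f : K⟦X⟧} (h : Hn n f) : coeff n (D1 K f) = n * coeff n f := by
  rw [coeff_D1]
  split_ifs with h3
  · rw [h (n - 3) (by omega) (by omega)]; simp
  · simp

lemma Hn_Z {n : ℕ} {f : K⟦X⟧} (h : Hn n f) : Hn n ((X ^ 3) * (1 - X ^ 3) * f) ∧
    coeff n ((X ^ 3) * (1 - X ^ 3) * f) = 0 := by
  have e : ((X : K⟦X⟧) ^ 3) * (1 - X ^ 3) * f = X ^ 3 * f - X ^ 6 * f := by ring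
  have key : ∀ m, m ≤ n → m % 3 = n % 3 → coeff m (((X : K⟦X⟧) ^ 3) * (1 - X ^ 3) * f) = 0 := by
    intro m hm hm3
    rw [e, map_sub, coeff_X_pow_mul', coeff_X_pow_mul']
    have a1 : (if 3 ≤ m then coeff (m - 3) f else 0) = 0 := by
      split_ifs
      · exact h _ (by omega) (by omega)
      · rfl
    have a2 : (if 6 ≤ m then coeff (m - 6) f else 0) = 0 := by
      split_ifs
      · exact h _ (by omega) (by omega)
      · rfl
    rw [a1, a2, sub_zero]
  exact ⟨fun m hm hm3 => key m hm.le hm3, key n le_rfl rfl⟩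

lemma coeff_MM {n : ℕ} {f : K⟦X⟧} (h : Hn n f) :
    coeff n (MM (D1 K) (X ^ 3) f) = n ^ 3 * coeff n f := by
  have h4 : ∀ g : K⟦X⟧, coeff n (4 * g) = 4 * coeff n g := by
    intro g
    have : (4 : K⟦X⟧) = C (4 : K) := (map_ofNat (C (R := K)) 4).symm
    rw [this, coeff_C_mul]
  rw [MM, map_sub, coeff_D1_Hn (Hn_D1 (Hn_D1 h)), coeff_D1_Hn (Hn_D1 h), coeff_D1_Hn h, h4, map_add,
    coeff_D1_Hn (Hn_Z h).1, (Hn_Z h).2, (Hn_Z (Hn_D1 h)).2]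
  ring

lemma D1_map {L : Type*} [CommRing L] (g : K →+* L) (f : K⟦X⟧) :
    PowerSeries.map g (D1 K f) = D1 L (PowerSeries.map g f) := by
  ext n
  rw [coeff_map, coeff_D1, coeff_D1, coeff_map, map_sub, map_mul, map_natCast]
  split_ifs
  · rw [map_mul, map_natCast, coeff_map]
  · simp

lemma MM_map {L : Type*} [CommRing L] (g : K →+* L) (f : K⟦X⟧) :
    PowerSeries.map g (MM (D1 K) (X ^ 3) f) = MM (D1 L) (X ^ 3) (PowerSeries.map g f) := by
  have h4 : PowerSeries.map g 4 = 4 := map_ofNat _ 4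
  simp only [MM, D1_map, map_sub, map_add, map_mul, map_pow, map_X, map_one, h4]

lemma D1_C (c : K) : D1 K (C c) = 0 := by rw [D1_apply]; simp

lemma D1_pow_char (q : ℕ) [CharP K q] (f : K⟦X⟧) (n : ℕ) (hn : q ∣ n) : D1 K (f ^ n) = 0 := by
  rw [D_pow]
  have : ((n : ℕ) : K⟦X⟧) = 0 := by
    rw [← map_natCast (C (R := K)), (CharP.cast_eq_zero_iff K q n).2 hn, map_zero]
  rw [this]; simp
end ps

section padic
variable (p : ℕ) [Fact p.Prime]

noncomputable def red : ℤ_[p]⟦X⟧ →+* (ZMod p)⟦X⟧ := PowerSeries.map (PadicInt.toZMod)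

variable {p}
lemma toZMod_eq_zero (x : ℤ_[p]) : PadicInt.toZMod x = 0 ↔ (p : ℤ_[p]) ∣ x := by
  rw [← RingHom.mem_ker, PadicInt.ker_toZMod, PadicInt.maximalIdeal_eq_span_p, Ideal.mem_span_singleton]

lemma coeff_p_mul (g : ℤ_[p]⟦X⟧) (n : ℕ) : coeff n ((p : ℤ_[p]⟦X⟧) * g) = p * coeff n g := by
  rw [← map_natCast (C (R := ℤ_[p])), coeff_C_mul]

lemma dvd_coeff_iff (f : ℤ_[p]⟦X⟧) (r : ℕ) : (p : ℤ_[p]⟦X⟧) ^ r ∣ f ↔ ∀ n, (p : ℤ_[p]) ^ r ∣ coeff n f := by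
  have e : (p : ℤ_[p]⟦X⟧) ^ r = C ((p : ℤ_[p]) ^ r) := by simp
  rw [e]
  constructor
  · rintro ⟨g, rfl⟩ n
    rw [coeff_C_mul]; exact dvd_mul_right _ _
  · intro h
    choose g hg using h
    refine ⟨PowerSeries.mk g, ?_⟩
    ext n
    rw [coeff_C_mul, coeff_mk, hg]

lemma red_eq_zero (f : ℤ_[p]⟦X⟧) : red p f = 0 ↔ (p : ℤ_[p]⟦X⟧) ∣ f := by
  rw [← pow_one (p : ℤ_[p]⟦X⟧), dvd_coeff_iff]
  constructor
  · intro h n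
    have : coeff n (red p f) = 0 := by rw [h]; simp
    rw [red, coeff_map, toZMod_eq_zero] at this
    simpa using this
  · intro h
    ext n
    rw [red, coeff_map, map_zero, toZMod_eq_zero]
    simpa using h n

lemma red_p : red p (p : ℤ_[p]⟦X⟧) = 0 := by
  rw [red_eq_zero]

lemma p_ne_zero_ps : (p : ℤ_[p]⟦X⟧) ≠ 0 := by
  have : (p : ℤ_[p]) ≠ 0 := by exact_mod_cast (Fact.out : p.Prime).ne_zero
  intro h
  apply this
  have h2 := congrArg (constantCoeff (R := ℤ_[p])) h
  simpa using h2

lemma red_X : red p (X : ℤ_[p]⟦X⟧) = X := by simp [red]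

lemma red_D1 (f : ℤ_[p]⟦X⟧) : red p (D1 _ f) = D1 _ (red p f) := D1_map _ f
lemma red_MM (f : ℤ_[p]⟦X⟧) : red p (MM (D1 _) (X ^ 3) f) = MM (D1 _) (X ^ 3) (red p f) := MM_map _ f

lemma D1_p (r : ℕ) : D1 ℤ_[p] ((p : ℤ_[p]⟦X⟧) ^ r) = 0 := by
  have e : (p : ℤ_[p]⟦X⟧) ^ r = C ((p : ℤ_[p]) ^ r) := by simp
  rw [e, D1_C]
end padic
end S8

namespace S8
open PowerSeries
section data

lemma choose3_rec (k : ℕ) : (2 * k + 1) * (2 * (k + 1)) * (3 * (k + 1)).choose (k + 1) =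
    3 * (3 * k + 1) * (3 * k + 2) * (3 * k).choose k := by
  have h1 := Nat.add_choose_mul_factorial_mul_factorial (2 * k + 2) (k + 1)
  have h2 := Nat.add_choose_mul_factorial_mul_factorial (2 * k) k
  rw [show 2 * k + 2 + (k + 1) = 3 * k + 2 + 1 by ring] at h1
  rw [show 2 * k + k = 3 * k by ring] at h2
  simp only [Nat.factorial_succ] at h1
  rw [← h2] at h1
  rw [show 3 * (k + 1) = 3 * k + 2 + 1 by ring]
  have hpos : 0 < (k + 1) * k.factorial * (2 * k).factorial := by positivity
  apply Nat.eq_of_mul_eq_mul_right hpos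
  nlinarith [h1]

variable {p : ℕ} [Fact p.Prime]

lemma isUnit_iff_toZMod (x : ℤ_[p]) : IsUnit x ↔ PadicInt.toZMod x ≠ 0 := by
  rw [Ne, toZMod_eq_zero, ← not_iff_not, not_not]
  rw [← Ideal.mem_span_singleton, ← PadicInt.maximalIdeal_eq_span_p, IsLocalRing.mem_maximalIdeal]
  rfl

lemma isUnit_nat {n : ℕ} (h : ¬ p ∣ n) : IsUnit (n : ℤ_[p]) := by
  rw [isUnit_iff_toZMod, map_natCast, Ne, ZMod.natCast_eq_zero_iff]; exact h

lemma isUnit_nat_lt {n : ℕ} (h0 : 0 < n) (h : n < p) : IsUnit (n : ℤ_[p]) :=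
  isUnit_nat (Nat.not_dvd_of_pos_of_lt h0 h)

lemma isUnit_two (hp : 3 < p) : IsUnit (2 : ℤ_[p]) := by
  exact_mod_cast isUnit_nat_lt (p := p) (n := 2) (by norm_num) (by omega)
lemma isUnit_three (hp : 3 < p) : IsUnit (3 : ℤ_[p]) := by
  exact_mod_cast isUnit_nat_lt (p := p) (n := 3) (by norm_num) (by omega)
lemma isUnit_108 (hp : 3 < p) : IsUnit (108 : ℤ_[p]) := by
  have := ((isUnit_two hp).pow 2).mul ((isUnit_three hp).pow 3)
  norm_num at this; exact this
lemma isUnit_27 (hp : 3 < p) : IsUnit (27 : ℤ_[p]) := by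
  have := (isUnit_three hp).pow 3
  norm_num at this; exact this

variable (p) in
noncomputable def AA (k : ℕ) : ℤ_[p] :=
  ((2 * k).choose k : ℤ_[p]) ^ 2 * ((3 * k).choose k : ℤ_[p]) * (Ring.inverse 108) ^ k
variable (p) in
noncomputable def aa (k : ℕ) : ℤ_[p] :=
  ((2 * k).choose k : ℤ_[p]) * ((3 * k).choose k : ℤ_[p]) * (Ring.inverse 27) ^ k

lemma choose2_rec (k : ℕ) : (k + 1) * (2 * (k + 1)).choose (k + 1) = 2 * (2 * k + 1) * (2 * k).choose k :=
  Nat.succ_mul_centralBinom_succ k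

lemma AA_rec (hp : 3 < p) (k : ℕ) : 18 * ((k : ℤ_[p]) + 1) ^ 3 * AA p (k + 1) =
    (2 * k + 1) * (3 * k + 1) * (3 * k + 2) * AA p k := by
  have h := Ring.mul_inverse_cancel _ (isUnit_108 hp)
  have h1 : ((k : ℤ_[p]) + 1) * ((2 * (k + 1)).choose (k + 1) : ℤ_[p]) = 2 * (2 * k + 1) * ((2 * k).choose k : ℤ_[p]) := by
    exact_mod_cast choose2_rec k
  have h2 : (2 * (k : ℤ_[p]) + 1) * (2 * (k + 1)) * ((3 * (k + 1)).choose (k + 1) : ℤ_[p]) =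
    3 * (3 * k + 1) * (3 * k + 2) * ((3 * k).choose k : ℤ_[p]) := by
    exact_mod_cast choose3_rec k
  unfold AA
  rw [pow_succ]
  set i := Ring.inverse (108 : ℤ_[p])
  set B' := ((2 * (k + 1)).choose (k + 1) : ℤ_[p])
  set B := ((2 * k).choose k : ℤ_[p])
  set C' := ((3 * (k + 1)).choose (k + 1) : ℤ_[p])
  set C0 := ((3 * k).choose k : ℤ_[p])
  have h3 : ((k : ℤ_[p]) + 1) ^ 3 * (B' ^ 2 * C') = 6 * (2 * k + 1) * (3 * k + 1) * (3 * k + 2) * (B ^ 2 * C0) := by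
    have : (((k : ℤ_[p]) + 1) * B') ^ 2 = (2 * (2 * k + 1) * B) ^ 2 := by rw [h1]
    linear_combination (k + 1) * C' * this + 2 * (2 * k + 1) * B ^ 2 * h2
  linear_combination 18 * i ^ k * i * h3 + (2 * (k:ℤ_[p]) + 1) * (3 * k + 1) * (3 * k + 2) * (B ^ 2 * C0) * i ^ k * h

lemma aa_rec (hp : 3 < p) (k : ℕ) : (3 * (k : ℤ_[p]) + 3) ^ 2 * aa p (k + 1) =
    (3 * k + 1) * (3 * k + 2) * aa p k := by
  have h := Ring.mul_inverse_cancel _ (isUnit_27 hp)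
  have h1 : ((k : ℤ_[p]) + 1) * ((2 * (k + 1)).choose (k + 1) : ℤ_[p]) = 2 * (2 * k + 1) * ((2 * k).choose k : ℤ_[p]) := by
    exact_mod_cast choose2_rec k
  have h2 : (2 * (k : ℤ_[p]) + 1) * (2 * (k + 1)) * ((3 * (k + 1)).choose (k + 1) : ℤ_[p]) =
    3 * (3 * k + 1) * (3 * k + 2) * ((3 * k).choose k : ℤ_[p]) := by
    exact_mod_cast choose3_rec k
  unfold aa
  rw [pow_succ]
  set i := Ring.inverse (27 : ℤ_[p])
  set B' := ((2 * (k + 1)).choose (k + 1) : ℤ_[p])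
  set B := ((2 * k).choose k : ℤ_[p])
  set C' := ((3 * (k + 1)).choose (k + 1) : ℤ_[p])
  set C0 := ((3 * k).choose k : ℤ_[p])
  linear_combination 9 * i ^ k * i * (k + 1) * C' * h1 + 9 * i ^ k * i * B * h2 +
    (3 * (k:ℤ_[p]) + 1) * (3 * k + 2) * (B * C0) * i ^ k * h

lemma isUnit_succ {k : ℕ} (hk : k + 1 < p) : IsUnit ((k : ℤ_[p]) + 1) := by
  exact_mod_cast isUnit_nat_lt (p := p) (n := k + 1) (by omega) hk

lemma isUnit_18 (hp : 3 < p) : IsUnit (18 : ℤ_[p]) := by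
  have := ((isUnit_two hp)).mul ((isUnit_three hp).pow 2)
  norm_num at this; exact this

lemma AA_step (hp : 3 < p) {k : ℕ} (hk : k + 1 < p) {d : ℤ_[p]}
    (h : d ∣ (2 * k + 1) * (3 * k + 1) * (3 * k + 2) * AA p k) : d ∣ AA p (k + 1) := by
  rw [← AA_rec hp] at h
  exact (((isUnit_18 hp).mul ((isUnit_succ hk).pow 3)).dvd_mul_left).1 h

lemma aa_step (hp : 3 < p) {k : ℕ} (hk : k + 1 < p) {d : ℤ_[p]}
    (h : d ∣ (3 * k + 1) * (3 * k + 2) * aa p k) : d ∣ aa p (k + 1) := by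
  rw [← aa_rec hp] at h
  have : IsUnit (3 * (k : ℤ_[p]) + 3) := by
    have := (isUnit_three hp).mul (isUnit_succ hk)
    rwa [mul_add, mul_one] at this
  exact ((this.pow 2).dvd_mul_left).1 h

lemma AA_mono (hp : 3 < p) {k l : ℕ} (hkl : k ≤ l) (hl : l < p) {d : ℤ_[p]} (h : d ∣ AA p k) :
    d ∣ AA p l := by
  induction l, hkl using Nat.le_induction with
  | base => exact h
  | succ n hn ih => exact AA_step hp hl (Dvd.dvd.mul_left (ih (by omega)) _)

lemma aa_mono (hp : 3 < p) {k l : ℕ} (hkl : k ≤ l) (hl : l < p) {d : ℤ_[p]} (h : d ∣ aa p k) :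
    d ∣ aa p l := by
  induction l, hkl using Nat.le_induction with
  | base => exact h
  | succ n hn ih => exact aa_step hp hl (Dvd.dvd.mul_left (ih (by omega)) _)

lemma p_mod3 (hp : 3 < p) : p % 3 = 1 ∨ p % 3 = 2 := by
  have h := (Fact.out : p.Prime)
  have : p % 3 ≠ 0 := by
    intro h0
    have := (Nat.prime_dvd_prime_iff_eq Nat.prime_three h).1 (Nat.dvd_of_mod_eq_zero h0)
    omega
  omega

lemma p_odd (hp : 3 < p) : p % 2 = 1 := by
  have h := (Fact.out : p.Prime)
  rcases h.eq_two_or_odd with h | h <;> omega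

/-- some factor is `≡ 0`. -/
lemma fac_dvd (hp : 3 < p) (j k : ℕ) (hj : 0 < j) (hj' : j < 3) (hk1 : j * p < 3 * k + 3) (hk2 : 3 * k < j * p) :
    (p : ℤ_[p]) ∣ (3 * k + 1) * (3 * k + 2) := by
  have h3 := p_mod3 hp
  have : (j * p) % 3 ≠ 0 := by
    interval_cases j <;> omega
  have : 3 * k + 1 = j * p ∨ 3 * k + 2 = j * p := by omega
  rcases this with h | h
  · have : (3 * (k : ℤ_[p]) + 1) = j * p := by exact_mod_cast h
    rw [this]; exact Dvd.dvd.mul_right (dvd_mul_left _ _) _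
  · have : (3 * (k : ℤ_[p]) + 2) = j * p := by exact_mod_cast h
    rw [this]; exact Dvd.dvd.mul_left (dvd_mul_left _ _) _

lemma AA_dvd1 (hp : 3 < p) {k : ℕ} (hk : k < p) (h : p ≤ 3 * k) : (p : ℤ_[p]) ∣ AA p k := by
  have h3 := p_mod3 hp
  refine AA_mono hp (k := p / 3 + 1) (by omega) hk (AA_step hp (by omega) ?_)
  have := fac_dvd hp 1 (p / 3) (by omega) (by omega) (by omega) (by omega)
  rw [mul_assoc (2 * _ + 1 : ℤ_[p])]
  exact Dvd.dvd.mul_right (Dvd.dvd.mul_left this _) _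

lemma AA_dvd2 (hp : 3 < p) {k : ℕ} (hk : k < p) (h : p ≤ 2 * k) : (p : ℤ_[p]) ^ 2 ∣ AA p k := by
  have h3 := p_odd hp
  refine AA_mono hp (k := p / 2 + 1) (by omega) hk (AA_step hp (by omega) ?_)
  have h1 := AA_dvd1 hp (k := p / 2) (by omega) (by omega)
  have h2 : (p : ℤ_[p]) ∣ 2 * ((p / 2 : ℕ) : ℤ_[p]) + 1 := by
    have : 2 * (p / 2) + 1 = p := by omega
    have : 2 * ((p / 2 : ℕ) : ℤ_[p]) + 1 = p := by exact_mod_cast this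
    rw [this]
  rw [pow_two]
  exact mul_dvd_mul (Dvd.dvd.mul_right (Dvd.dvd.mul_right h2 _) _) h1

lemma AA_dvd3 (hp : 3 < p) {k : ℕ} (hk : k < p) (h : 2 * p ≤ 3 * k) : (p : ℤ_[p]) ^ 3 ∣ AA p k := by
  have h3 := p_mod3 hp
  refine AA_mono hp (k := 2 * p / 3 + 1) (by omega) hk (AA_step hp (by omega) ?_)
  have h1 := AA_dvd2 hp (k := 2 * p / 3) (by omega) (by omega)
  have := fac_dvd hp 2 (2 * p / 3) (by omega) (by omega) (by omega) (by omega)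
  rw [mul_assoc (2 * _ + 1 : ℤ_[p]), pow_succ']
  exact mul_dvd_mul (Dvd.dvd.mul_left this _) h1

lemma aa_dvd1 (hp : 3 < p) {k : ℕ} (hk : k < p) (h : p ≤ 3 * k) : (p : ℤ_[p]) ∣ aa p k := by
  have h3 := p_mod3 hp
  refine aa_mono hp (k := p / 3 + 1) (by omega) hk (aa_step hp (by omega) ?_)
  exact Dvd.dvd.mul_right (fac_dvd hp 1 (p / 3) (by omega) (by omega) (by omega) (by omega)) _

lemma aa_dvd2 (hp : 3 < p) {k : ℕ} (hk : k < p) (h : 2 * p ≤ 3 * k) : (p : ℤ_[p]) ^ 2 ∣ aa p k := by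
  have h3 := p_mod3 hp
  refine aa_mono hp (k := 2 * p / 3 + 1) (by omega) hk (aa_step hp (by omega) ?_)
  rw [pow_two]
  exact mul_dvd_mul (fac_dvd hp 2 (2 * p / 3) (by omega) (by omega) (by omega) (by omega))
    (aa_dvd1 hp (by omega) (by omega))

/-- coefficients of the deformed rank two series -/
noncomputable def cc (w : ℤ_[p]) : ℕ → ℤ_[p]
  | 0 => 1
  | k + 1 => (3 * k + 1 - w) * (3 * k + 2 - w) * (Ring.inverse (3 * k + 3 - w)) ^ 2 * cc w k

lemma isUnit_cc (hp : 3 < p) {w : ℤ_[p]} (hw : (p : ℤ_[p]) ∣ w) {k : ℕ} (hk : k + 1 < p) :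
    IsUnit (3 * (k : ℤ_[p]) + 3 - w) := by
  have : IsUnit (3 * (k : ℤ_[p]) + 3) := by
    have := (isUnit_three hp).mul (isUnit_succ hk)
    rwa [mul_add, mul_one] at this
  rw [isUnit_iff_toZMod] at *
  rw [map_sub, (toZMod_eq_zero w).2 hw, sub_zero]; exact this

lemma cc_rec (hp : 3 < p) {w : ℤ_[p]} (hw : (p : ℤ_[p]) ∣ w) {k : ℕ} (hk : k + 1 < p) :
    (3 * (k : ℤ_[p]) + 3 - w) ^ 2 * cc w (k + 1) = (3 * k + 1 - w) * (3 * k + 2 - w) * cc w k := by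
  have h := Ring.mul_inverse_cancel _ (isUnit_cc hp hw hk)
  rw [cc]
  set i := Ring.inverse (3 * (k : ℤ_[p]) + 3 - w)
  have h2 : ((3 * (k : ℤ_[p]) + 3 - w) * i) ^ 2 = 1 := by rw [h, one_pow]
  linear_combination (3 * (k : ℤ_[p]) + 1 - w) * (3 * k + 2 - w) * cc w k * h2

lemma cc_mod (hp : 3 < p) {w : ℤ_[p]} (hw : (p : ℤ_[p]) ∣ w) {k : ℕ} (hk : k < p) :
    PadicInt.toZMod (cc w k) = PadicInt.toZMod (aa p k) := by
  induction k with
  | zero => simp [cc, aa]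
  | succ k ih =>
    have h1 := congrArg (PadicInt.toZMod) (cc_rec hp hw hk)
    have h2 := congrArg (PadicInt.toZMod) (aa_rec hp k)
    have h0 : (3 * (k : ZMod p) + 3) ≠ 0 := by
      have := (isUnit_iff_toZMod _).1 (isUnit_cc hp (dvd_zero _) hk)
      have e3 : PadicInt.toZMod (3 : ℤ_[p]) = 3 := map_ofNat _ 3
      rwa [sub_zero, map_add, map_mul, e3, map_natCast] at this
    simp only [map_mul, map_sub, map_add, map_pow, map_natCast, (toZMod_eq_zero w).2 hw, sub_zero,
      map_ofNat, map_one, ih (by omega)] at h1 h2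
    exact mul_left_cancel₀ (pow_ne_zero 2 h0) (h1.trans h2.symm)

lemma cc_zero_of (w : ℤ_[p]) {k l : ℕ} (h : cc w k = 0) (hkl : k ≤ l) : cc w l = 0 := by
  induction l, hkl using Nat.le_induction with
  | base => exact h
  | succ n hn ih => rw [cc, ih, mul_zero]

lemma cc_term (hp : 3 < p) (j : ℕ) (hj : 0 < j) (hj' : j < 3) {k : ℕ} (hk : j * p / 3 < k) :
    cc ((j : ℤ_[p]) * (p : ℤ_[p])) k = 0 := by
  refine cc_zero_of _ (k := j * p / 3 + 1) ?_ hk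
  have h3 := p_mod3 hp
  have : (j * p) % 3 ≠ 0 := by
    interval_cases j <;> omega
  have : 3 * (j * p / 3) + 1 = j * p ∨ 3 * (j * p / 3) + 2 = j * p := by omega
  rw [cc]
  rcases this with h | h
  · have : 3 * ((j * p / 3 : ℕ) : ℤ_[p]) + 1 = j * p := by exact_mod_cast h
    rw [this, sub_self]; ring
  · have : 3 * ((j * p / 3 : ℕ) : ℤ_[p]) + 2 = j * p := by exact_mod_cast h
    rw [this, sub_self]; ring
end data
end S8

namespace S8
open PowerSeries
section harm

lemma prod_expand {R ι : Type*} [CommRing R] (s : Finset ι) (P : R) (a : ι → R) :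
    P ^ 3 ∣ 2 * ∏ i ∈ s, (1 + P * a i) -
      (2 + 2 * P * ∑ i ∈ s, a i + P ^ 2 * ((∑ i ∈ s, a i) ^ 2 - ∑ i ∈ s, a i ^ 2)) := by
  classical
  induction s using Finset.induction_on with
  | empty => simp
  | insert i s hi ih =>
    rw [Finset.prod_insert hi, Finset.sum_insert hi, Finset.sum_insert hi]
    obtain ⟨g, hg⟩ := ih
    refine ⟨g * (1 + P * a i) + a i * ((∑ i ∈ s, a i) ^ 2 - ∑ i ∈ s, a i ^ 2), ?_⟩
    linear_combination (1 + P * a i) * hg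

variable (p : ℕ) [Fact p.Prime]
noncomputable def iv (j : ℕ) : ℤ_[p] := Ring.inverse (j : ℤ_[p])
noncomputable def Hs (e n : ℕ) : ℤ_[p] := ∑ j ∈ Finset.range n, iv p (j + 1) ^ e

variable {p}
lemma iv_mul {j : ℕ} (h0 : 0 < j) (h : j < p) : (j : ℤ_[p]) * iv p j = 1 :=
  Ring.mul_inverse_cancel _ (isUnit_nat_lt h0 h)

lemma iv_refl {j : ℕ} (h0 : 0 < j) (h : j < p) :
    iv p (p - j) + iv p j + p * iv p j ^ 2 = (p : ℤ_[p]) ^ 2 * (iv p (p - j) * iv p j ^ 2) := by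
  have h1 := iv_mul h0 h
  have h2 := iv_mul (p := p) (j := p - j) (by omega) (by omega)
  rw [Nat.cast_sub h.le] at h2
  set a := iv p (p - j)
  set b := iv p j
  linear_combination (1 + p * b) * (-b * h2 - a * h1)

lemma Hs_refl (e m : ℕ) (hm : m ≤ p - 1) :
    Hs p e (p - 1) - Hs p e (p - 1 - m) = ∑ j ∈ Finset.range m, iv p (p - (j + 1)) ^ e := by
  induction m with
  | zero => simp
  | succ m ih =>
    rw [Finset.sum_range_succ, ← ih (by omega)]
    have : Hs p e (p - 1 - m) = Hs p e (p - 1 - (m + 1)) + iv p (p - (m + 1)) ^ e := by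
      rw [show p - 1 - m = (p - 1 - (m + 1)) + 1 by omega, Hs, Finset.sum_range_succ, Hs,
        show p - 1 - (m + 1) + 1 = p - (m + 1) by omega]
    rw [this]; ring

lemma sum_zmod {M : Type*} [AddCommMonoid M] (f : ZMod p → M) :
    ∑ x : ZMod p, f x = ∑ j ∈ Finset.range p, f (j : ZMod p) := by
  symm
  refine Finset.sum_nbij' (fun j => (j : ZMod p)) (fun x => x.val) ?_ ?_ ?_ ?_ ?_
  · simp
  · intro x _; simpa using ZMod.val_lt x
  · intro j hj; exact ZMod.val_cast_of_lt (by simpa using hj)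
  · intro x _; simp
  · simp

lemma H2_dvd (hp : 3 < p) : (p : ℤ_[p]) ∣ Hs p 2 (p - 1) := by
  rw [← toZMod_eq_zero]
  have h := FiniteField.sum_pow_lt_card_sub_one (ZMod p) (p - 3) (by rw [ZMod.card]; omega)
  have hr : Finset.range p = Finset.range ((p - 1) + 1) := by congr 1; omega
  rw [sum_zmod, hr, Finset.sum_range_succ'] at h
  simp only [Nat.cast_zero, zero_pow (show p - 3 ≠ 0 by omega), add_zero] at h
  rw [Hs, map_sum, ← h]
  apply Finset.sum_congr rfl
  intro j hj
  have hj' : j + 1 < p := by have := Finset.mem_range.1 hj; omega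
  have h1 := congrArg (PadicInt.toZMod (p := p)) (iv_mul (p := p) (j := j + 1) (by omega) hj')
  rw [map_mul, map_natCast, map_one] at h1
  rw [map_pow]
  have hne : ((j + 1 : ℕ) : ZMod p) ≠ 0 := left_ne_zero_of_mul_eq_one h1
  have hf := ZMod.pow_card_sub_one_eq_one hne
  rw [show p - 1 = (p - 3) + 2 by omega, pow_add] at hf
  have h2 : ((j + 1 : ℕ) : ZMod p) ^ 2 * (PadicInt.toZMod (iv p (j + 1))) ^ 2 = 1 := by
    rw [← mul_pow, h1, one_pow]
  have := pow_ne_zero 2 hne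
  apply mul_left_cancel₀ this
  rw [h2, mul_comm, hf]

lemma H1_dvd (hp : 3 < p) : (p : ℤ_[p]) ^ 2 ∣ Hs p 1 (p - 1) := by
  have h := Hs_refl (p := p) 1 (p - 1) le_rfl
  rw [Nat.sub_self] at h
  have h1 : ∑ j ∈ Finset.range (p - 1), iv p (p - (j + 1)) ^ 1 =
     ∑ j ∈ Finset.range (p - 1), (p ^ 2 * (iv p (p - (j + 1)) * iv p (j + 1) ^ 2)
       - iv p (j + 1) ^ 1 - p * iv p (j + 1) ^ 2) := by
    apply Finset.sum_congr rfl
    intro j hj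
    have hj' : j + 1 < p := by have := Finset.mem_range.1 hj; omega
    have := iv_refl (p := p) (j := j + 1) (by omega) hj'
    linear_combination this
  rw [h1, Finset.sum_sub_distrib, Finset.sum_sub_distrib, ← Finset.mul_sum, ← Finset.mul_sum] at h
  obtain ⟨g, hg⟩ := H2_dvd hp
  have h0 : Hs p 1 0 = 0 := by simp [Hs]
  have h2 : (p : ℤ_[p]) ^ 2 ∣ 2 * Hs p 1 (p - 1) := by
    refine ⟨(∑ j ∈ Finset.range (p - 1), iv p (p - (j + 1)) * iv p (j + 1) ^ 2) - g, ?_⟩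
    have e1 : ∑ j ∈ Finset.range (p - 1), iv p (j + 1) ^ 1 = Hs p 1 (p - 1) := rfl
    have e2 : ∑ j ∈ Finset.range (p - 1), iv p (j + 1) ^ 2 = Hs p 2 (p - 1) := rfl
    rw [e1, e2, h0] at h
    linear_combination h - p * hg
  exact ((isUnit_two hp).dvd_mul_left).1 h2

/-- `H_{p-1-m} ≡ H_m + p H_m^{(2)} (mod p²)` -/
lemma H1_refl (hp : 3 < p) {m : ℕ} (hm : m ≤ p - 1) :
    (p : ℤ_[p]) ^ 2 ∣ Hs p 1 (p - 1 - m) - Hs p 1 m - p * Hs p 2 m := by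
  have h := Hs_refl (p := p) 1 m hm
  have h1 : ∑ j ∈ Finset.range m, iv p (p - (j + 1)) ^ 1 =
     ∑ j ∈ Finset.range m, (p ^ 2 * (iv p (p - (j + 1)) * iv p (j + 1) ^ 2)
       - iv p (j + 1) ^ 1 - p * iv p (j + 1) ^ 2) := by
    apply Finset.sum_congr rfl
    intro j hj
    have hj' : j + 1 < p := by have := Finset.mem_range.1 hj; omega
    have := iv_refl (p := p) (j := j + 1) (by omega) hj'
    linear_combination this
  rw [h1, Finset.sum_sub_distrib, Finset.sum_sub_distrib, ← Finset.mul_sum, ← Finset.mul_sum] at h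
  obtain ⟨g, hg⟩ := H1_dvd hp
  refine ⟨g - (∑ j ∈ Finset.range m, iv p (p - (j + 1)) * iv p (j + 1) ^ 2), ?_⟩
  have e1 : ∑ j ∈ Finset.range m, iv p (j + 1) ^ 1 = Hs p 1 m := rfl
  have e2 : ∑ j ∈ Finset.range m, iv p (j + 1) ^ 2 = Hs p 2 m := rfl
  rw [e1, e2] at h
  linear_combination hg - h

lemma H2_refl (hp : 3 < p) {m : ℕ} (hm : m ≤ p - 1) :
    (p : ℤ_[p]) ∣ Hs p 2 (p - 1 - m) + Hs p 2 m := by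
  have h := Hs_refl (p := p) 2 m hm
  have h1 : (p : ℤ_[p]) ∣ ∑ j ∈ Finset.range m, (iv p (p - (j + 1)) ^ 2 - iv p (j + 1) ^ 2) := by
    apply Finset.dvd_sum
    intro j hj
    have hj' : j + 1 < p := by have := Finset.mem_range.1 hj; omega
    have := iv_refl (p := p) (j := j + 1) (by omega) hj'
    set a := iv p (p - (j + 1))
    set b := iv p (j + 1)
    refine ⟨(a - b) * (p * (a * b ^ 2) - b ^ 2), ?_⟩
    linear_combination (a - b) * this
  rw [Finset.sum_sub_distrib, ← h] at h1
  obtain ⟨g, hg⟩ := H2_dvd hp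
  obtain ⟨g1, hg1⟩ := h1
  have e2 : ∑ j ∈ Finset.range m, iv p (j + 1) ^ 2 = Hs p 2 m := rfl
  rw [e2] at hg1
  exact ⟨g - g1, by linear_combination hg - hg1⟩

lemma choose_prod (n k : ℕ) (hk : k < p) :
    ((n + k).choose k : ℤ_[p]) = ∏ j ∈ Finset.range k, (1 + n * iv p (j + 1)) := by
  have h := Nat.ascFactorial_eq_factorial_mul_choose n k
  rw [Nat.ascFactorial_eq_prod_range, ← Finset.prod_range_add_one_eq_factorial] at h
  have h' : ∏ j ∈ Finset.range k, ((n : ℤ_[p]) + 1 + j) =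
     (∏ j ∈ Finset.range k, ((j : ℤ_[p]) + 1)) * ((n + k).choose k : ℤ_[p]) := by
    exact_mod_cast h
  have h2 : ∏ j ∈ Finset.range k, ((n : ℤ_[p]) + 1 + j) = (∏ j ∈ Finset.range k, ((j : ℤ_[p]) + 1)) *
     ∏ j ∈ Finset.range k, (1 + n * iv p (j + 1)) := by
    rw [← Finset.prod_mul_distrib]
    apply Finset.prod_congr rfl
    intro j hj
    have hj' : j + 1 < p := by have := Finset.mem_range.1 hj; omega
    have := iv_mul (p := p) (j := j + 1) (by omega) hj'
    push_cast at this
    linear_combination (-(n : ℤ_[p])) * this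
  have hu : IsUnit (∏ j ∈ Finset.range k, ((j : ℤ_[p]) + 1)) := by
    rw [IsUnit.prod_iff]
    intro j hj
    exact isUnit_succ (by have := Finset.mem_range.1 hj; omega)
  exact hu.mul_left_cancel (h'.symm.trans h2)

lemma wolst_prod (hp : 3 < p) (x : ℕ) :
    (p : ℤ_[p]) ^ 3 ∣ ((x * p + (p - 1)).choose (p - 1) : ℤ_[p]) - 1 := by
  rw [choose_prod _ _ (by omega)]
  have h := prod_expand (Finset.range (p - 1)) (p : ℤ_[p]) (fun j => x * iv p (j + 1))
  obtain ⟨g1, h1⟩ := H1_dvd hp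
  obtain ⟨g2, h2⟩ := H2_dvd hp
  have e1 : ∑ j ∈ Finset.range (p - 1), (x : ℤ_[p]) * iv p (j + 1) = x * Hs p 1 (p - 1) := by
    rw [← Finset.mul_sum]; simp [Hs]
  have e2 : ∑ j ∈ Finset.range (p - 1), ((x : ℤ_[p]) * iv p (j + 1)) ^ 2 = x ^ 2 * Hs p 2 (p - 1) := by
    simp only [mul_pow]; rw [← Finset.mul_sum]; simp [Hs]
  simp only [e1, e2, h1, h2] at h
  obtain ⟨g, hg⟩ := h
  apply ((isUnit_two hp).dvd_mul_left).1
  have e3 : ∏ j ∈ Finset.range (p - 1), (1 + ((x * p : ℕ) : ℤ_[p]) * iv p (j + 1)) =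
    ∏ j ∈ Finset.range (p - 1), (1 + (p : ℤ_[p]) * (x * iv p (j + 1))) := by
    apply Finset.prod_congr rfl; intro j _; push_cast; ring
  rw [e3]
  exact ⟨g + 2 * x * g1 + p ^ 3 * x ^ 2 * g1 ^ 2 - x ^ 2 * g2, by linear_combination hg⟩

lemma choose_mul_p (x : ℕ) : ((x + 1) * p).choose p = (x + 1) * (x * p + (p - 1)).choose (p - 1) := by
  have hpp := (Fact.out : p.Prime).pos
  have h := Nat.add_one_mul_choose_eq (x * p + (p - 1)) (p - 1)
  rw [show x * p + (p - 1) + 1 = (x + 1) * p by rw [add_assoc, Nat.sub_add_cancel hpp]; ring,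
    Nat.sub_add_cancel hpp] at h
  apply Nat.eq_of_mul_eq_mul_right hpp
  rw [← h]; ring

lemma wolst2 (hp : 3 < p) : (p : ℤ_[p]) ^ 3 ∣ ((2 * p).choose p : ℤ_[p]) - 2 := by
  obtain ⟨g, hg⟩ := wolst_prod hp 1
  have := choose_mul_p (p := p) 1
  norm_num at this hg
  rw [this]; push_cast
  exact ⟨2 * g, by linear_combination 2 * hg⟩

lemma wolst3 (hp : 3 < p) : (p : ℤ_[p]) ^ 3 ∣ ((3 * p).choose p : ℤ_[p]) - 3 := by
  obtain ⟨g, hg⟩ := wolst_prod hp 2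
  have := choose_mul_p (p := p) 2
  norm_num at this hg
  rw [this]; push_cast
  exact ⟨3 * g, by linear_combination 3 * hg⟩
end harm
end S8

namespace S8
open PowerSeries
section esec
lemma C_2 {p : ℕ} [Fact p.Prime] : C (R := ℤ_[p]) 2 = 2 := map_ofNat _ 2
lemma C_3 {p : ℕ} [Fact p.Prime] : C (R := ℤ_[p]) 3 = 3 := map_ofNat _ 3
lemma C_18 {p : ℕ} [Fact p.Prime] : C (R := ℤ_[p]) 18 = 18 := map_ofNat _ 18
lemma cC_ofNat {K : Type*} [CommRing K] (n : ℕ) [n.AtLeastTwo] :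
    constantCoeff (R := K) (OfNat.ofNat n : K⟦X⟧) = (OfNat.ofNat n : K) := map_ofNat _ n
lemma coe_ofNat {K : Type*} [CommRing K] (n : ℕ) [n.AtLeastTwo] :
    ((OfNat.ofNat n : Polynomial K) : K⟦X⟧) = (OfNat.ofNat n : K⟦X⟧) :=
  map_ofNat (Polynomial.coeToPowerSeries.ringHom (R := K)) n
lemma map_ps_ofNat {K L : Type*} [CommRing K] [CommRing L] (f : K →+* L) (n : ℕ) [n.AtLeastTwo] :
    PowerSeries.map f (OfNat.ofNat n : K⟦X⟧) = (OfNat.ofNat n : L⟦X⟧) := map_ofNat _ n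
lemma toZMod_ofNat {p : ℕ} [Fact p.Prime] (n : ℕ) [n.AtLeastTwo] :
    PadicInt.toZMod (p := p) (OfNat.ofNat n) = (OfNat.ofNat n : ZMod p) := map_ofNat _ n
lemma red_ofNat {p : ℕ} [Fact p.Prime] (n : ℕ) [n.AtLeastTwo] :
    red p (OfNat.ofNat n) = (OfNat.ofNat n : (ZMod p)⟦X⟧) := map_ofNat _ n
variable (p : ℕ) [Fact p.Prime]
noncomputable def fS : ℤ_[p]⟦X⟧ := ∑ k ∈ Finset.range p, C (aa p k) * (X ^ 3) ^ k
noncomputable def VS : ℤ_[p]⟦X⟧ := ∑ k ∈ Finset.range p, C (AA p k) * (4 * X ^ 3 * (1 - X ^ 3)) ^ k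
noncomputable def dS : ℤ_[p]⟦X⟧ := VS p - fS p * fS p

variable {p}
lemma MM_VS (hp : 3 < p) : 2 * MM (D1 ℤ_[p]) (X ^ 3) (VS p) =
    -(54 * (1 - 2 * X ^ 3) * (p : ℤ_[p]⟦X⟧) ^ 3 * C (AA p p) * (4 * X ^ 3 * (1 - X ^ 3)) ^ p) := by
  apply MM_V0 (D1 ℤ_[p]) (X ^ 3) _ D1_X3 rfl (fun k => C (AA p k)) (fun k => D1_C _)
  intro k
  have := congrArg (C (R := ℤ_[p])) (AA_rec hp k)
  simpa [C_2, C_3, C_18] using this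

lemma LL_fS (hp : 3 < p) : LL (D1 ℤ_[p]) (X ^ 3) (fS p) =
    -(9 * (p : ℤ_[p]⟦X⟧) ^ 2 * C (aa p p)) * (X ^ (3 * p) * (1 - X ^ 3)) := by
  have h := ODE_phi (D1 ℤ_[p]) (X ^ 3) 0 D1_X3 (map_zero _) (fun k => C (aa p k)) (fun k => D1_C _) (p - 1)
    (by
      intro k _
      have := congrArg (C (R := ℤ_[p])) (aa_rec hp k)
      simpa [C_2, C_3, C_18] using this) (fS p) (by rw [show p - 1 + 1 = p by omega]; rfl)
  rw [show p - 1 + 1 = p by omega, ← pow_mul] at h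
  have h2 := congrArg (C (R := ℤ_[p])) (aa_rec hp (p - 1))
  rw [show p - 1 + 1 = p by omega] at h2
  have h3 : ((p - 1 : ℕ) : ℤ_[p]) = p - 1 := by rw [Nat.cast_sub (by omega)]; simp
  have h3' : ((p - 1 : ℕ) : ℤ_[p]⟦X⟧) = p - 1 := by rw [Nat.cast_sub (by omega)]; simp
  rw [h3] at h2
  rw [h3'] at h
  simp only [map_mul, map_pow, map_add, map_sub, map_one, map_natCast, C_2, C_3] at h2
  linear_combination h + (1 - X ^ 3) * X ^ (3 * p) * h2

lemma MM_dS (hp : 3 < p) : 2 * MM (D1 ℤ_[p]) (X ^ 3) (dS p) =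
    X ^ (3 * p) * (-(54 * (1 - 2 * X ^ 3) * (p : ℤ_[p]⟦X⟧) ^ 3 * C (AA p p) * (4 * (1 - X ^ 3)) ^ p)
      + 36 * (p : ℤ_[p]⟦X⟧) ^ 2 * C (aa p p) *
        ((1 - X ^ 3) * (3 * (p : ℤ_[p]⟦X⟧) * (1 - X ^ 3) - 3 * X ^ 3) * fS p + 3 * (1 - X ^ 3) * D1 ℤ_[p] (fS p))) := by
  rw [dS, MM_sub, mul_sub, MM_VS hp, MM_prod, LL_fS hp]
  have h1 : D1 ℤ_[p] (-(9 * (p : ℤ_[p]⟦X⟧) ^ 2 * C (aa p p)) * (X ^ (3 * p) * (1 - X ^ 3))) =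
    -(9 * (p : ℤ_[p]⟦X⟧) ^ 2 * C (aa p p)) * (X ^ (3 * p) * (1 - X ^ 3) * (3 * (p : ℤ_[p]⟦X⟧) * (1 - X ^ 3) - 3 * X ^ 3)) := by
    have e : -(9 * (p : ℤ_[p]⟦X⟧) ^ 2 * C (aa p p)) = C (-(9 * (p : ℤ_[p]) ^ 2 * aa p p)) := by
      have e9 : C (R := ℤ_[p]) 9 = 9 := map_ofNat _ 9
      simp [e9]
    have e1 := D_pow_log (D1 ℤ_[p]) X _ D1_X (3 * p)
    rw [e, Derivation.leibniz, D1_C, Derivation.leibniz, map_sub, D1_X3, e1]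
    simp only [Derivation.map_one_eq_zero, smul_eq_mul]
    push_cast
    ring
  rw [h1, show (4 * (X : ℤ_[p]⟦X⟧) ^ 3 * (1 - X ^ 3)) = X ^ 3 * (4 * (1 - X ^ 3)) by ring, mul_pow (X ^ 3), ← pow_mul]
  ring

lemma coeff_fS (n : ℕ) : coeff n (fS p) = if n % 3 = 0 ∧ n / 3 < p then aa p (n / 3) else 0 := by
  rw [fS, map_sum]
  simp only [coeff_C_mul, ← pow_mul, coeff_X_pow]
  split_ifs with h
  · rw [Finset.sum_eq_single (n / 3)]
    · rw [if_pos (by omega), mul_one]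
    · intro b _ hb; rw [if_neg (by omega), mul_zero]
    · intro hb; exact absurd (Finset.mem_range.2 h.2) hb
  · apply Finset.sum_eq_zero
    intro b hb
    rw [if_neg, mul_zero]
    rintro rfl
    have := Finset.mem_range.1 hb
    omega

lemma coeff_two_mul (f : ℤ_[p]⟦X⟧) (n : ℕ) : coeff n (2 * f) = 2 * coeff n f := by
  have e2 : C (R := ℤ_[p]) 2 = 2 := map_ofNat _ 2
  rw [← e2, coeff_C_mul]

lemma aa_zero : aa p 0 = 1 := by simp [aa]
lemma AA_zero : AA p 0 = 1 := by simp [AA]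

lemma dS_low (hp : 3 < p) (n : ℕ) (hn : n < 3 * p) : coeff n (dS p) = 0 := by
  induction n using Nat.strong_induction_on with
  | _ n ih =>
    rcases Nat.eq_zero_or_pos n with rfl | h0
    · rw [dS, map_sub, show coeff 0 (fS p * fS p) = coeff 0 (fS p) * coeff 0 (fS p) by simp]
      rw [coeff_fS, VS]
      simp only [map_sum, coeff_zero_eq_constantCoeff, map_mul, map_pow]
      rw [Finset.sum_eq_single 0]
      · simp [aa_zero, AA_zero, (Fact.out : p.Prime).pos]
      · intro b _ hb; simp [hb]
      · simp; omega
    · have hh : Hn n (dS p) := fun m hm _ => ih m hm (by omega)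
      have h1 := coeff_MM hh
      have h2 : coeff n (2 * MM (D1 ℤ_[p]) (X ^ 3) (dS p)) = 0 := by
        rw [MM_dS hp, coeff_X_pow_mul', if_neg (by omega)]
      rw [coeff_two_mul, h1] at h2
      have : (n : ℤ_[p]) ≠ 0 := by exact_mod_cast h0.ne'
      simpa [this] using h2

lemma inv27 (hp : 3 < p) : 4 * Ring.inverse (108 : ℤ_[p]) = Ring.inverse 27 := by
  have h := Ring.mul_inverse_cancel _ (isUnit_108 hp)
  have h2 := Ring.mul_inverse_cancel _ (isUnit_27 hp)
  apply (isUnit_27 hp).mul_left_cancel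
  linear_combination h - h2

lemma four_AA (hp : 3 < p) : (4 : ℤ_[p]) ^ p * AA p p = ((2 * p).choose p : ℤ_[p]) * aa p p := by
  have h : (4 : ℤ_[p]) ^ p * Ring.inverse 108 ^ p = Ring.inverse 27 ^ p := by
    rw [← mul_pow, inv27 hp]
  rw [AA, aa]
  linear_combination ((2 * p).choose p : ℤ_[p]) ^ 2 * ((3 * p).choose p : ℤ_[p]) * h

lemma dvd_to_zmod {a b : ℤ_[p]} {r : ℕ} (hr : r ≠ 0) (h : (p : ℤ_[p]) ^ r ∣ a - b) :
    PadicInt.toZMod a = PadicInt.toZMod b := by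
  rw [← sub_eq_zero, ← map_sub, toZMod_eq_zero]
  exact (dvd_pow_self _ hr).trans h

lemma z_2 : PadicInt.toZMod (p := p) 2 = 2 := map_ofNat _ 2
lemma z_3 : PadicInt.toZMod (p := p) 3 = 3 := map_ofNat _ 3
lemma z_4 : PadicInt.toZMod (p := p) 4 = 4 := map_ofNat _ 4
lemma z_9 : PadicInt.toZMod (p := p) 9 = 9 := map_ofNat _ 9
lemma z_27 : PadicInt.toZMod (p := p) 27 = 27 := map_ofNat _ 27

lemma nine_aap (hp : 3 < p) : 9 * PadicInt.toZMod (aa p p) = 2 := by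
  have h2 := dvd_to_zmod (by norm_num) (wolst2 hp)
  have h3 := dvd_to_zmod (by norm_num) (wolst3 hp)
  have h4 := congrArg (PadicInt.toZMod (p := p)) (Ring.mul_inverse_cancel _ (isUnit_27 hp))
  rw [map_mul, map_one, z_27] at h4
  rw [z_2] at h2
  rw [z_3] at h3
  rw [aa, map_mul, map_mul, map_pow, ZMod.pow_card, h2, h3]
  linear_combination 2 * h4

lemma dS_3p (hp : 3 < p) : (p : ℤ_[p]) ^ 3 ∣ coeff (3 * p) (dS p) := by
  have hh : Hn (3 * p) (dS p) := fun m hm _ => dS_low hp m hm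
  have h1 := coeff_MM hh
  have h2 := congrArg (coeff (3 * p)) (MM_dS hp)
  rw [coeff_two_mul, h1, coeff_X_pow_mul', if_pos le_rfl, Nat.sub_self] at h2
  have h0 : coeff 0 (D1 ℤ_[p] (fS p)) = 0 := by rw [coeff_D1]; simp
  have hf0 : coeff 0 (fS p) = 1 := by rw [coeff_fS]; simp [aa_zero]; omega
  rw [coeff_zero_eq_constantCoeff] at h2 h0 hf0
  simp only [map_mul, map_add, map_sub, map_neg, map_pow, map_natCast, constantCoeff_C, constantCoeff_X, h0, hf0, map_one] at h2
  have e54 : constantCoeff (R := ℤ_[p]) 54 = 54 := map_ofNat _ 54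
  have e2 : constantCoeff (R := ℤ_[p]) 2 = 2 := map_ofNat _ 2
  have e3 : constantCoeff (R := ℤ_[p]) 3 = 3 := map_ofNat _ 3
  have e4 : constantCoeff (R := ℤ_[p]) 4 = 4 := map_ofNat _ 4
  have e36 : constantCoeff (R := ℤ_[p]) 36 = 36 := map_ofNat _ 36
  simp only [e54, e2, e3, e4, e36] at h2
  have hp0 : (p : ℤ_[p]) ≠ 0 := by exact_mod_cast (Fact.out : p.Prime).ne_zero
  obtain ⟨g, hg⟩ := wolst2 hp
  have h5 := four_AA hp
  have h6 : (54 * (p : ℤ_[p]) ^ 3) * coeff (3 * p) (dS p) = (54 * (p : ℤ_[p]) ^ 3) * (-(p : ℤ_[p]) ^ 3 * g * aa p p) := by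
    have e : (4 * (1 - (0:ℤ_[p]) ^ 3)) ^ p = 4 ^ p := by norm_num
    rw [e] at h2
    push_cast at h2
    linear_combination h2 - 54 * (p : ℤ_[p]) ^ 3 * h5 - 54 * (p : ℤ_[p]) ^ 3 * aa p p * hg
  have h7 := mul_left_cancel₀ (mul_ne_zero (by norm_num) (pow_ne_zero 3 hp0)) h6
  rw [h7]
  exact ⟨-g * aa p p, by ring⟩

lemma coeff_VS_dvd (r K : ℕ) (hr : ∀ k, k < p → K ≤ k → (p : ℤ_[p]) ^ r ∣ AA p k)
    (n : ℕ) (hn : 6 * K ≤ n + 5) : (p : ℤ_[p]) ^ r ∣ coeff n (VS p) := by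
  rw [VS, map_sum]
  apply Finset.dvd_sum
  intro k hk
  rw [coeff_C_mul]
  by_cases h : K ≤ k
  · exact (hr k (Finset.mem_range.1 hk) h).mul_right _
  · have : coeff n ((4 * X ^ 3 * (1 - X ^ 3) : ℤ_[p]⟦X⟧) ^ k) = 0 := by
      have e : ((4 * X ^ 3 * (1 - X ^ 3) : ℤ_[p]⟦X⟧) ^ k) =
         (((4 * Polynomial.X ^ 3 * (1 - Polynomial.X ^ 3)) ^ k : Polynomial ℤ_[p]) : ℤ_[p]⟦X⟧) := by
        push_cast; rw [coe_ofNat]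
      rw [e, Polynomial.coeff_coe]
      apply Polynomial.coeff_eq_zero_of_natDegree_lt
      have : ((4 * Polynomial.X ^ 3 * (1 - Polynomial.X ^ 3)) ^ k : Polynomial ℤ_[p]).natDegree ≤ k * 6 := by
        apply Polynomial.natDegree_pow_le_of_le
        compute_degree
      omega
    rw [this, mul_zero]; exact dvd_zero _

lemma coeff_ff_dvd (hp : 3 < p) (n : ℕ) (hn : 3 * p ≤ n) : (p : ℤ_[p]) ^ 2 ∣ coeff n (fS p * fS p) := by
  rw [coeff_mul]
  apply Finset.dvd_sum
  rintro ⟨i, j⟩ hij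
  rw [Finset.HasAntidiagonal.mem_antidiagonal] at hij
  simp only at hij ⊢
  rw [coeff_fS, coeff_fS]
  split_ifs with hi hj hj
  · by_cases a : 2 * p ≤ i
    · exact (aa_dvd2 hp hi.2 (by omega)).mul_right _
    by_cases b : 2 * p ≤ j
    · exact (aa_dvd2 hp hj.2 (by omega)).mul_left _
    rw [pow_two]
    exact mul_dvd_mul (aa_dvd1 hp hi.2 (by omega)) (aa_dvd1 hp hj.2 (by omega))
  all_goals simp

lemma coeff_ff_dvd3 (hp : 3 < p) (n : ℕ) (hn : 4 * p ≤ n) : (p : ℤ_[p]) ^ 3 ∣ coeff n (fS p * fS p) := by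
  rw [coeff_mul]
  apply Finset.dvd_sum
  rintro ⟨i, j⟩ hij
  rw [Finset.HasAntidiagonal.mem_antidiagonal] at hij
  simp only at hij ⊢
  rw [coeff_fS, coeff_fS]
  split_ifs with hi hj hj
  · by_cases a : 2 * p ≤ i
    · rw [pow_succ]
      exact mul_dvd_mul (aa_dvd2 hp hi.2 (by omega)) (aa_dvd1 hp hj.2 (by omega))
    · rw [pow_succ']
      exact mul_dvd_mul (aa_dvd1 hp hi.2 (by omega)) (aa_dvd2 hp hj.2 (by omega))
  all_goals simp

lemma dS_dvd2 (hp : 3 < p) : (p : ℤ_[p]⟦X⟧) ^ 2 ∣ dS p := by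
  rw [dvd_coeff_iff]
  intro n
  by_cases h : n < 3 * p
  · rw [dS_low hp n h]; exact dvd_zero _
  · rw [dS, map_sub]
    refine dvd_sub (coeff_VS_dvd 2 ((p + 1) / 2) (fun k hk hk2 => AA_dvd2 hp hk (by omega)) n ?_)
      (coeff_ff_dvd hp n (by omega))
    have := p_odd hp
    omega

lemma dS_dvd3 (hp : 3 < p) (n : ℕ) (hn : 4 * p ≤ n) : (p : ℤ_[p]) ^ 3 ∣ coeff n (dS p) := by
  rw [dS, map_sub]
  refine dvd_sub (coeff_VS_dvd 3 ((2 * p + 2) / 3) (fun k hk hk2 => AA_dvd3 hp hk (by omega)) n ?_)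
      (coeff_ff_dvd3 hp n (by omega))
  omega


lemma red_VS (hp : 3 < p) : red p (VS p) = red p (fS p) * red p (fS p) := by
  have : red p (dS p) = 0 := by
    rw [red_eq_zero]; exact (dvd_pow_self _ two_ne_zero).trans (dS_dvd2 hp)
  rw [dS, map_sub, map_mul, sub_eq_zero] at this
  exact this

lemma red_2 : red p 2 = 2 := map_ofNat _ 2
lemma red_3 : red p 3 = 3 := map_ofNat _ 3
lemma red_4 : red p 4 = 4 := map_ofNat _ 4
lemma red_18 : red p 18 = 18 := map_ofNat _ 18
lemma red_36 : red p 36 = 36 := map_ofNat _ 36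
lemma red_27 : red p 27 = 27 := map_ofNat _ 27
lemma red_54 : red p 54 = 54 := map_ofNat _ 54
lemma red_9 : red p 9 = 9 := map_ofNat _ 9
lemma red_1 : red p 1 = 1 := map_one _
lemma red_C (c : ℤ_[p]) : red p (C c) = C (PadicInt.toZMod c) := by simp [red]

lemma two_ne_zmod (hp : 3 < p) : (2 : ZMod p) ≠ 0 := by
  have := (isUnit_iff_toZMod _).1 (isUnit_two hp); rwa [z_2] at this
lemma three_ne_zmod (hp : 3 < p) : (3 : ZMod p) ≠ 0 := by
  have := (isUnit_iff_toZMod _).1 (isUnit_three hp); rwa [z_3] at this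

/-- the correction polynomial -/
lemma exists_e (hp : 3 < p) : ∃ e : Polynomial ℤ_[p], e.natDegree ≤ p - 1 ∧ e.coeff 0 = 0 ∧
    MM (D1 (ZMod p)) (X ^ 3) (red p (e : ℤ_[p]⟦X⟧)) =
      54 * (-(X ^ 3 * (1 - X ^ 3)) * red p (fS p) + (1 - X ^ 3) * D1 (ZMod p) (red p (fS p))) := by
  obtain ⟨d, hd⟩ := dS_dvd2 hp
  have hp0 : (p : ℤ_[p]) ≠ 0 := by exact_mod_cast (Fact.out : p.Prime).ne_zero
  have hc : ∀ n, coeff n (dS p) = (p : ℤ_[p]) ^ 2 * coeff n d := by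
    intro n
    have e : (p : ℤ_[p]⟦X⟧) ^ 2 = C ((p : ℤ_[p]) ^ 2) := by simp
    rw [hd, e, coeff_C_mul]
  have hlow : ∀ n, n < 3 * p → coeff n d = 0 := by
    intro n hn
    have := hc n
    rw [dS_low hp n hn] at this
    simpa [hp0] using this.symm
  have h3 : ∀ n, (p : ℤ_[p]) ^ 3 ∣ coeff n (dS p) → (p : ℤ_[p]) ∣ coeff n d := by
    intro n hn
    rw [hc, pow_succ] at hn
    exact (mul_dvd_mul_iff_left (pow_ne_zero 2 hp0)).1 hn
  let e : Polynomial ℤ_[p] := ∑ m ∈ Finset.range p,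
    if m = 0 then 0 else Polynomial.monomial m (9 * Ring.inverse 2 * coeff (3 * p + m) d)
  have hecoeff : ∀ n, e.coeff n = if n ≠ 0 ∧ n < p then 9 * Ring.inverse 2 * coeff (3 * p + n) d else 0 := by
    intro n
    simp only [e, Polynomial.finset_sum_coeff]
    split_ifs with h
    · rw [Finset.sum_eq_single n]
      · simp [h.1]
      · intro b _ hb; split_ifs <;> simp [Polynomial.coeff_monomial, hb]
      · intro hb; exact absurd (Finset.mem_range.2 h.2) hb
    · apply Finset.sum_eq_zero
      intro b hb
      have := Finset.mem_range.1 hb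
      split_ifs with h0
      · simp
      · rw [Polynomial.coeff_monomial, if_neg]; rintro rfl; exact h ⟨h0, this⟩
  refine ⟨e, ?_, ?_, ?_⟩
  · rw [Polynomial.natDegree_le_iff_coeff_eq_zero]
    intro n hn
    rw [hecoeff, if_neg (by omega)]
  · rw [hecoeff, if_neg (by simp)]
  ·
    have hred : red p d * 9 = X ^ (3 * p) * red p (e : ℤ_[p]⟦X⟧) * 2 := by
      have h2i : (2 : ZMod p) * PadicInt.toZMod (Ring.inverse (2 : ℤ_[p])) = 1 := by
        rw [← z_2, ← map_mul, Ring.mul_inverse_cancel _ (isUnit_two hp), map_one]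
      have e9 : (9 : (ZMod p)⟦X⟧) = C (9 : ZMod p) := (map_ofNat _ 9).symm
      have e2 : (2 : (ZMod p)⟦X⟧) = C (2 : ZMod p) := (map_ofNat _ 2).symm
      rw [e9, e2]
      ext n
      rw [coeff_mul_C, coeff_mul_C, coeff_X_pow_mul', red, coeff_map]
      by_cases hn : n < 3 * p
      · rw [hlow n hn, if_neg (by omega)]; simp
      · rw [if_pos (by omega), coeff_map, Polynomial.coeff_coe, hecoeff,
          show 3 * p + (n - 3 * p) = n by omega]
        split_ifs with h
        · rw [map_mul, map_mul, z_9]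
          linear_combination (-(9 * PadicInt.toZMod (coeff n d))) * h2i
        · have : PadicInt.toZMod (coeff n d) = 0 := by
            rw [toZMod_eq_zero]
            apply h3
            by_cases h4 : n = 3 * p
            · rw [h4]; exact dS_3p hp
            · exact dS_dvd3 hp n (by omega)
          rw [this]; simp
    have hM := MM_dS hp
    rw [hd, MM_const _ _ _ _ (D1_p 2)] at hM
    have hM2 : 2 * MM (D1 ℤ_[p]) (X ^ 3) d =
      X ^ (3 * p) * (-(54 * (1 - 2 * X ^ 3) * (p : ℤ_[p]⟦X⟧) * C (AA p p) * (4 * (1 - X ^ 3)) ^ p)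
      + 36 * C (aa p p) *
        ((1 - X ^ 3) * (3 * (p : ℤ_[p]⟦X⟧) * (1 - X ^ 3) - 3 * X ^ 3) * fS p + 3 * (1 - X ^ 3) * D1 ℤ_[p] (fS p))) := by
      apply mul_left_cancel₀ (pow_ne_zero 2 (p_ne_zero_ps (p := p)))
      linear_combination hM
    have hM3 := congrArg (red p) hM2
    simp only [map_mul, map_add, map_sub, map_neg, map_pow, red_2, red_3, red_4, red_36, red_54, red_1, red_p, red_X, red_MM, red_D1, red_C] at hM3
    have hX : D1 (ZMod p) (X ^ (3 * p)) = 0 := D1_pow_char p X _ (dvd_mul_left _ _)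
    have hc9 : D1 (ZMod p) (9 : (ZMod p)⟦X⟧) = 0 := by
      rw [show (9 : (ZMod p)⟦X⟧) = C (9 : ZMod p) from (map_ofNat _ 9).symm, D1_C]
    have hc2 : D1 (ZMod p) (2 : (ZMod p)⟦X⟧) = 0 := by
      rw [show (2 : (ZMod p)⟦X⟧) = C (2 : ZMod p) from (map_ofNat _ 2).symm, D1_C]
    have hM4 := congrArg (MM (D1 (ZMod p)) (X ^ 3)) hred
    rw [mul_comm _ (9 : (ZMod p)⟦X⟧), MM_const _ _ _ _ hc9, mul_comm _ (2 : (ZMod p)⟦X⟧), MM_const _ _ _ _ hc2,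
      MM_const _ _ _ _ hX] at hM4
    have h9 : 9 * C (PadicInt.toZMod (aa p p)) = (2 : (ZMod p)⟦X⟧) := by
      rw [show (9 : (ZMod p)⟦X⟧) = C (9 : ZMod p) from (map_ofNat _ 9).symm, ← map_mul, nine_aap hp]
      exact map_ofNat _ 2
    have h4 : (4 : (ZMod p)⟦X⟧) ≠ 0 := by
      rw [show (4 : (ZMod p)⟦X⟧) = C (4 : ZMod p) from (map_ofNat _ 4).symm]
      intro h
      rw [map_eq_zero_iff _ (PowerSeries.C_injective)] at h
      have := mul_ne_zero (two_ne_zmod hp) (two_ne_zmod hp)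
      apply this; rw [← h]; norm_num
    have hX3 : (X : (ZMod p)⟦X⟧) ^ (3 * p) ≠ 0 := pow_ne_zero _ X_ne_zero
    apply mul_left_cancel₀ hX3
    apply mul_left_cancel₀ h4
    linear_combination (-2) * hM4 + 9 * hM3 + X ^ (3 * p) * 36 * ((1 - X ^ 3) * ( - 3 * X ^ 3) * red p (fS p) + 3 * (1 - X ^ 3) * D1 (ZMod p) (red p (fS p))) * h9

end esec
end S8

namespace S8
open PowerSeries
section lemS
variable (p : ℕ) [Fact p.Prime]
noncomputable def ph (j : ℕ) : Polynomial ℤ_[p] :=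
  ∑ k ∈ Finset.range p, Polynomial.C (cc ((j : ℤ_[p]) * (p : ℤ_[p])) k) * (Polynomial.X ^ 3) ^ k
noncomputable def gp : Polynomial (ZMod p) := (ph p 1).map PadicInt.toZMod

variable {p}
lemma coeff_ph (j n : ℕ) : (ph p j).coeff n =
    if n % 3 = 0 ∧ n / 3 < p then cc ((j : ℤ_[p]) * (p : ℤ_[p])) (n / 3) else 0 := by
  rw [ph, Polynomial.finsetSum_coeff]
  simp only [Polynomial.coeff_C_mul, ← pow_mul, Polynomial.coeff_X_pow]
  split_ifs with h
  · rw [Finset.sum_eq_single (n / 3)]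
    · rw [if_pos (by omega), mul_one]
    · intro b _ hb; rw [if_neg (by omega), mul_zero]
    · intro hb; exact absurd (Finset.mem_range.2 h.2) hb
  · apply Finset.sum_eq_zero
    intro b hb
    rw [if_neg, mul_zero]
    rintro rfl
    have := Finset.mem_range.1 hb
    omega

lemma natDegree_ph (hp : 3 < p) (j : ℕ) (hj : 0 < j) (hj' : j < 3) : (ph p j).natDegree ≤ 3 * (j * p / 3) := by
  rw [Polynomial.natDegree_le_iff_coeff_eq_zero]
  intro n hn
  rw [coeff_ph]
  split_ifs with h
  · exact cc_term hp j hj hj' (by omega)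
  · rfl

lemma red_coe (f : Polynomial ℤ_[p]) : red p (f : ℤ_[p]⟦X⟧) = ((f.map PadicInt.toZMod : Polynomial (ZMod p)) : (ZMod p)⟦X⟧) := by
  ext n; simp [red]

lemma red_ph (hp : 3 < p) (j : ℕ) : red p (ph p j : ℤ_[p]⟦X⟧) = red p (fS p) := by
  ext n
  rw [red, coeff_map, coeff_map, Polynomial.coeff_coe, coeff_ph, coeff_fS]
  split_ifs with h
  · exact cc_mod hp (dvd_mul_left _ _) h.2
  · rfl

lemma coe_gp (hp : 3 < p) : (gp p : (ZMod p)⟦X⟧) = red p (fS p) := by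
  rw [gp, ← red_coe, red_ph hp]

lemma LL_map' (f : ℤ_[p]⟦X⟧) : red p (LL (D1 _) (X ^ 3) f) = LL (D1 _) (X ^ 3) (red p f) := by
  simp only [LL, map_sub, map_mul, map_pow, red_D1, red_X, red_1, red_2]

lemma LL_gp (hp : 3 < p) : LL (D1 (ZMod p)) (X ^ 3) (gp p : (ZMod p)⟦X⟧) = 0 := by
  rw [coe_gp hp, ← LL_map', LL_fS hp]
  simp only [map_mul, map_neg, map_pow, red_p]; simp

lemma MM_gp (hp : 3 < p) : MM (D1 (ZMod p)) (X ^ 3) ((gp p : (ZMod p)⟦X⟧) * (gp p : (ZMod p)⟦X⟧)) = 0 := by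
  rw [MM_prod, LL_gp hp]; simp

lemma cc_unit (hp : 3 < p) (k : ℕ) (hk : 3 * k < p) : PadicInt.toZMod (cc (((1:ℕ) : ℤ_[p]) * (p : ℤ_[p])) k) ≠ 0 := by
  induction k with
  | zero => simp [cc]
  | succ k ih =>
    have h := congrArg (PadicInt.toZMod (p := p)) (cc_rec hp (w := ((1:ℕ) : ℤ_[p]) * (p : ℤ_[p])) (dvd_mul_left _ _) (k := k) (by omega))
    simp only [map_mul, map_pow, map_sub, map_add, z_3, z_2, map_one, map_natCast, CharP.cast_eq_zero, mul_zero, sub_zero] at h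
    intro h0
    rw [h0, mul_zero] at h
    have ih' := ih (by omega)
    have h1 : (3 * (k : ZMod p) + 1) ≠ 0 := by
      have := (ZMod.natCast_eq_zero_iff (3 * k + 1) p).not.2 (Nat.not_dvd_of_pos_of_lt (by omega) (by omega))
      exact_mod_cast this
    have h2 : (3 * (k : ZMod p) + 2) ≠ 0 := by
      have := (ZMod.natCast_eq_zero_iff (3 * k + 2) p).not.2 (Nat.not_dvd_of_pos_of_lt (by omega) (by omega))
      exact_mod_cast this
    exact mul_ne_zero (mul_ne_zero h1 h2) ih' h.symm

lemma natDegree_gp (hp : 3 < p) : (gp p).natDegree = 3 * (p / 3) := by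
  apply le_antisymm
  · refine (Polynomial.natDegree_map_le).trans ?_
    have := natDegree_ph hp 1 (by norm_num) (by norm_num)
    rwa [one_mul] at this
  · apply Polynomial.le_natDegree_of_ne_zero
    rw [gp, Polynomial.coeff_map, coeff_ph, if_pos (by omega)]
    rw [show 3 * (p / 3) / 3 = p / 3 by omega]
    exact cc_unit hp _ (by have := p_mod3 hp; omega)

lemma gp_ne (hp : 3 < p) : gp p ≠ 0 := by
  intro h
  have := natDegree_gp hp
  rw [h] at this; simp at this; omega

/-- solutions of `MM F = 0` mod `p` start in degree divisible by `p`. -/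
lemma sol_low (F : (ZMod p)⟦X⟧) (hM : MM (D1 (ZMod p)) (X ^ 3) F = 0) (N : ℕ)
    (h : ∀ j, p * j < N → coeff (p * j) F = 0) (n : ℕ) (hn : n < N) : coeff n F = 0 := by
  induction n using Nat.strong_induction_on with
  | _ n ih =>
    by_cases hd : p ∣ n
    · obtain ⟨j, rfl⟩ := hd; exact h j hn
    · have hh : Hn n F := fun m hm _ => ih m hm (by omega)
      have h1 := coeff_MM hh
      rw [hM, map_zero] at h1
      have : (n : ZMod p) ≠ 0 := fun h0 => hd ((ZMod.natCast_eq_zero_iff n p).1 h0)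
      simpa [this] using h1.symm

lemma MM_X_pow (j : ℕ) (F : (ZMod p)⟦X⟧) : MM (D1 (ZMod p)) (X ^ 3) (X ^ (p * j) * F) =
    X ^ (p * j) * MM (D1 (ZMod p)) (X ^ 3) F :=
  MM_const _ _ _ _ (D1_pow_char p X _ (dvd_mul_right _ _))

lemma MM_Cmul (c : ZMod p) (F : (ZMod p)⟦X⟧) : MM (D1 (ZMod p)) (X ^ 3) (C c * F) =
    C c * MM (D1 (ZMod p)) (X ^ 3) F := MM_const _ _ _ _ (D1_C _)

lemma sol_split (F : (ZMod p)⟦X⟧) (hM : MM (D1 (ZMod p)) (X ^ 3) F = 0) (j : ℕ)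
    (h : ∀ i, i < j → coeff (p * i) F = 0) : ∃ F1, F = X ^ (p * j) * F1 ∧
      MM (D1 (ZMod p)) (X ^ 3) F1 = 0 := by
  have : (X : (ZMod p)⟦X⟧) ^ (p * j) ∣ F := by
    rw [X_pow_dvd_iff]
    intro m hm
    refine sol_low F hM (p * j) (fun i hi => h i (lt_of_mul_lt_mul_left hi (Nat.zero_le _))) m hm
  obtain ⟨F1, rfl⟩ := this
  refine ⟨F1, rfl, ?_⟩
  rw [MM_X_pow] at hM
  exact (mul_eq_zero.1 hM).resolve_left (pow_ne_zero _ X_ne_zero)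

lemma gp0 (hp : 3 < p) : coeff 0 ((gp p : (ZMod p)⟦X⟧) * (gp p : (ZMod p)⟦X⟧)) = 1 := by
  have h : coeff 0 (gp p : (ZMod p)⟦X⟧) = 1 := by
    rw [Polynomial.coeff_coe, gp, Polynomial.coeff_map, coeff_ph, if_pos (by simp; omega)]
    simp [cc]
  rw [coeff_zero_eq_constantCoeff] at *
  rw [map_mul, h, one_mul]

lemma wronsk (hp : 3 < p) (J : ℕ) : ∀ (F : (ZMod p)⟦X⟧) (_ : MM (D1 (ZMod p)) (X ^ 3) F = 0),
    X ^ J ∣ F * D1 _ ((gp p : (ZMod p)⟦X⟧) * (gp p : (ZMod p)⟦X⟧)) - ((gp p : (ZMod p)⟦X⟧) * (gp p : (ZMod p)⟦X⟧)) * D1 _ F := by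
  induction J with
  | zero => intro F _; simp
  | succ J ih =>
    intro F hM
    set G := ((gp p : (ZMod p)⟦X⟧) * (gp p : (ZMod p)⟦X⟧)) with hG
    have hGM : MM (D1 (ZMod p)) (X ^ 3) G = 0 := MM_gp hp
    obtain ⟨F1, hF, hF1⟩ := sol_split (F - C (coeff 0 F) * G) (by rw [MM_sub, hM, MM_Cmul, hGM]; simp) 1
      (by
        intro i hi
        obtain rfl : i = 0 := by omega
        rw [mul_zero, map_sub, coeff_C_mul, hG, gp0 hp]; simp)
    obtain ⟨r, hr⟩ := ih F1 hF1
    have hF' : F = C (coeff 0 F) * G + X ^ (p * 1) * F1 := by rw [← hF]; ring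
    have hX : D1 (ZMod p) (X ^ (p * 1)) = 0 := D1_pow_char p X _ (dvd_mul_right _ _)
    set c := coeff 0 F
    rw [hF', map_add, Derivation.leibniz _ (C c) G, D1_C, Derivation.leibniz _ (X ^ (p * 1)) F1, hX]
    simp only [smul_eq_mul, mul_zero, add_zero]
    refine ⟨r * X ^ (p * 1 - 1), ?_⟩
    have e : (X : (ZMod p)⟦X⟧) ^ (p * 1) = X * X ^ (p * 1 - 1) := by
      rw [← pow_succ']; congr 1; omega
    rw [pow_succ, e]
    linear_combination (X * X ^ (p * 1 - 1)) * hr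

lemma wronsk0 (hp : 3 < p) (F : (ZMod p)⟦X⟧) (hM : MM (D1 (ZMod p)) (X ^ 3) F = 0) :
    F * D1 _ ((gp p : (ZMod p)⟦X⟧) * (gp p : (ZMod p)⟦X⟧)) = ((gp p : (ZMod p)⟦X⟧) * (gp p : (ZMod p)⟦X⟧)) * D1 _ F := by
  rw [← sub_eq_zero]
  ext n
  have := wronsk hp (n + 1) F hM
  rw [X_pow_dvd_iff] at this
  simpa using this n (by omega)

/-- a polynomial solution has degree congruent to that of `G` mod `p`. -/
lemma sol_degree (hp : 3 < p) (P : Polynomial (ZMod p)) (hP : P ≠ 0)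
    (hM : MM (D1 (ZMod p)) (X ^ 3) (P : (ZMod p)⟦X⟧) = 0) :
    ((P.natDegree : ℕ) : ZMod p) = ((2 * (3 * (p / 3)) : ℕ) : ZMod p) := by
  have h := wronsk0 hp P hM
  set G := gp p * gp p with hG
  have hGne : G ≠ 0 := mul_ne_zero (gp_ne hp) (gp_ne hp)
  have hGd : G.natDegree = 2 * (3 * (p / 3)) := by
    rw [hG, Polynomial.natDegree_mul (gp_ne hp) (gp_ne hp), natDegree_gp hp]; ring
  have e : ((gp p : (ZMod p)⟦X⟧) * (gp p : (ZMod p)⟦X⟧)) = (G : (ZMod p)⟦X⟧) := by rw [hG]; push_cast; rfl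
  rw [e, D1_apply, D1_apply] at h
  have hX : (X : (ZMod p)⟦X⟧) * (1 - X ^ 3) ≠ 0 := by
    apply mul_ne_zero X_ne_zero
    intro h0
    have := congrArg (constantCoeff (R := ZMod p)) h0
    simp at this
  have h2 : (P : (ZMod p)⟦X⟧) * (d⁄dX (ZMod p) (G : (ZMod p)⟦X⟧)) = (G : (ZMod p)⟦X⟧) * d⁄dX (ZMod p) (P : (ZMod p)⟦X⟧) := by
    apply mul_left_cancel₀ hX
    linear_combination h
  rw [PowerSeries.derivative_coe, PowerSeries.derivative_coe] at h2
  have h3 : P * (Polynomial.X * Polynomial.derivative G) = G * (Polynomial.X * Polynomial.derivative P) := by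
    have : P * Polynomial.derivative G = G * Polynomial.derivative P := by
      apply Polynomial.coe_injective
      push_cast; exact h2
    linear_combination Polynomial.X * this
  have hth : ∀ Q : Polynomial (ZMod p), (Polynomial.X * Polynomial.derivative Q).natDegree ≤ Q.natDegree ∧
      (Polynomial.X * Polynomial.derivative Q).coeff Q.natDegree = Q.natDegree * Q.leadingCoeff := by
    intro Q
    have hc : ∀ n, (Polynomial.X * Polynomial.derivative Q).coeff n = n * Q.coeff n := by
      intro n
      cases n with
      | zero => simp
      | succ n => rw [Polynomial.coeff_X_mul, Polynomial.coeff_derivative]; push_cast; ring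
    refine ⟨?_, hc _⟩
    rw [Polynomial.natDegree_le_iff_coeff_eq_zero]
    intro n hn
    rw [hc, Polynomial.coeff_eq_zero_of_natDegree_lt hn, mul_zero]
  have h4 := congrArg (fun Q => Polynomial.coeff Q (P.natDegree + G.natDegree)) h3
  rw [Polynomial.coeff_mul_add_eq_of_natDegree_le le_rfl (hth G).1, (hth G).2, add_comm P.natDegree,
    Polynomial.coeff_mul_add_eq_of_natDegree_le le_rfl (hth P).1, (hth P).2] at h4
  rw [← hGd]
  have hl : P.leadingCoeff * G.leadingCoeff ≠ 0 := mul_ne_zero (Polynomial.leadingCoeff_ne_zero.2 hP) (Polynomial.leadingCoeff_ne_zero.2 hGne)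
  apply mul_left_cancel₀ hl
  simp only [Polynomial.coeff_natDegree] at h4
  linear_combination -h4

lemma coe_X_pow_dvd (P : Polynomial (ZMod p)) (n : ℕ) (F : (ZMod p)⟦X⟧) (h : (P : (ZMod p)⟦X⟧) = X ^ n * F) :
    ∃ P2 : Polynomial (ZMod p), P = Polynomial.X ^ n * P2 ∧ F = P2 := by
  have hd : Polynomial.X ^ n ∣ P := by
    rw [Polynomial.X_pow_dvd_iff]
    intro d hd
    rw [← Polynomial.coeff_coe, h, coeff_X_pow_mul', if_neg (by omega)]
  obtain ⟨P2, rfl⟩ := hd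
  refine ⟨P2, rfl, ?_⟩
  push_cast at h
  exact (mul_left_cancel₀ (pow_ne_zero _ X_ne_zero) h).symm

lemma gp_sq_mod3 (n : ℕ) (h : n % 3 ≠ 0) : (gp p * gp p).coeff n = 0 := by
  rw [Polynomial.coeff_mul]
  apply Finset.sum_eq_zero
  rintro ⟨i, j⟩ hij
  rw [Finset.HasAntidiagonal.mem_antidiagonal] at hij
  simp only at hij ⊢
  rw [gp, Polynomial.coeff_map, Polynomial.coeff_map, coeff_ph, coeff_ph]
  by_cases h1 : i % 3 = 0
  · rw [if_neg (show ¬ (j % 3 = 0 ∧ j / 3 < p) by omega)]; simp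
  · rw [if_neg (show ¬ (i % 3 = 0 ∧ i / 3 < p) by omega)]; simp

lemma lemmaS (hp : 3 < p) (P : Polynomial (ZMod p)) (hd : P.natDegree ≤ 4 * p - 2)
    (hM : MM (D1 (ZMod p)) (X ^ 3) (P : (ZMod p)⟦X⟧) = 0) (h0 : P.coeff 0 = 0) (h1 : P.coeff p = 0) :
    ∃ c, P = Polynomial.C c * Polynomial.X ^ (2 * p) * (gp p * gp p) := by
  have hGd : (gp p * gp p).natDegree = 2 * (3 * (p / 3)) := by
    rw [Polynomial.natDegree_mul (gp_ne hp) (gp_ne hp), natDegree_gp hp]; ring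
  set G := gp p * gp p with hG
  have eG : ((gp p : (ZMod p)⟦X⟧) * (gp p : (ZMod p)⟦X⟧)) = (G : (ZMod p)⟦X⟧) := by rw [hG]; push_cast; rfl
  have hGM : MM (D1 (ZMod p)) (X ^ 3) (G : (ZMod p)⟦X⟧) = 0 := by rw [← eG]; exact MM_gp hp
  have hG0 : coeff 0 (G : (ZMod p)⟦X⟧) = 1 := by rw [← eG]; exact gp0 hp
  set c := P.coeff (2 * p) with hc
  refine ⟨c, ?_⟩
  set R := P - Polynomial.C c * Polynomial.X ^ (2 * p) * G with hR
  have hRc : (R : (ZMod p)⟦X⟧) = (P : (ZMod p)⟦X⟧) - C c * (X ^ (p * 2) * (G : (ZMod p)⟦X⟧)) := by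
    rw [hR]; push_cast; rw [mul_comm p 2, mul_assoc]
  have hRM : MM (D1 (ZMod p)) (X ^ 3) (R : (ZMod p)⟦X⟧) = 0 := by
    rw [hRc, MM_sub, hM, MM_Cmul, MM_X_pow, hGM]; simp
  have hpp := (Fact.out : p.Prime).pos
  obtain ⟨F1, hF, hF1⟩ := sol_split (R : (ZMod p)⟦X⟧) hRM 3 (by
    intro i hi
    rw [hRc, map_sub, coeff_C_mul, coeff_X_pow_mul', Polynomial.coeff_coe]
    interval_cases i
    · rw [mul_zero, h0, if_neg (by omega)]; simp
    · rw [mul_one, h1, if_neg (by omega)]; simp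
    · rw [if_pos le_rfl, Nat.sub_self, hG0, mul_comm p 2, ← hc]; simp)
  obtain ⟨P2, hP2, rfl⟩ := coe_X_pow_dvd R _ _ hF
  have hRd : R.natDegree ≤ 4 * p - 2 := by
    refine (Polynomial.natDegree_sub_le _ _).trans (max_le hd ?_)
    refine (Polynomial.natDegree_mul_le).trans ?_
    rw [hGd]
    have := Polynomial.natDegree_C_mul_X_pow_le c (2 * p)
    have := p_mod3 hp
    omega
  by_cases hP20 : P2 = 0
  · rw [hP20, mul_zero] at hP2
    exact sub_eq_zero.1 hP2
  exfalso
  have hP2d : P2.natDegree ≤ p - 2 := by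
    have := Polynomial.natDegree_X_pow_mul (p * 3) hP20
    rw [← hP2] at this
    omega
  have hdeg := sol_degree hp P2 hP20 hF1
  have h3 : P2.natDegree % 3 = 0 := by
    by_contra h3
    have h4 := sol_low ((P2 : (ZMod p)⟦X⟧) - C (P2.coeff 0) * (G : (ZMod p)⟦X⟧)) (by rw [MM_sub, hF1, MM_Cmul, hGM]; simp) p
      (by
        intro j hj
        have : j = 0 := by
          by_contra h; have := Nat.le_mul_of_pos_right p (Nat.pos_of_ne_zero h); omega
        subst this
        rw [mul_zero, map_sub, coeff_C_mul, hG0, Polynomial.coeff_coe]; simp) P2.natDegree (by omega)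
    rw [map_sub, coeff_C_mul, Polynomial.coeff_coe, Polynomial.coeff_coe, hG, gp_sq_mod3 _ h3, mul_zero, sub_zero] at h4
    exact hP20 (Polynomial.leadingCoeff_eq_zero.1 h4)
  rw [ZMod.natCast_eq_natCast_iff] at hdeg
  rcases p_mod3 hp with h | h
  · have e : P2.natDegree + 2 ≡ 2 * (3 * (p / 3)) + 2 [MOD p] := hdeg.add_right 2
    have e2 : p ∣ 2 * (3 * (p / 3)) + 2 := ⟨2, by omega⟩
    have e3 : p ∣ P2.natDegree + 2 := (e.dvd_iff dvd_rfl).2 e2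
    have := Nat.le_of_dvd (by omega) e3
    omega
  · have e : P2.natDegree + 4 ≡ 2 * (3 * (p / 3)) + 4 [MOD p] := hdeg.add_right 4
    have e2 : p ∣ 2 * (3 * (p / 3)) + 4 := ⟨2, by omega⟩
    have e3 : p ∣ P2.natDegree + 4 := (e.dvd_iff dvd_rfl).2 e2
    obtain ⟨q, hq⟩ := e3
    have : q = 1 := by
      have : 0 < q := by rcases Nat.eq_zero_or_pos q with rfl | h; (· omega); exact h
      by_contra h1
      have : p * 2 ≤ p * q := Nat.mul_le_mul_left p (by omega)
      omega
    subst this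
    omega

end lemS
end S8

namespace S8
open PowerSeries
section cand
variable {p : ℕ} [Fact p.Prime]

lemma pZ_ne : (p : ℤ_[p]) ≠ 0 := by exact_mod_cast (Fact.out : p.Prime).ne_zero

lemma exists_ch (hp : 3 < p) : ∃ g : Polynomial ℤ_[p], ph p 1 - ph p 2 = (p : Polynomial ℤ_[p]) * g := by
  have h : Polynomial.C (p : ℤ_[p]) ∣ ph p 1 - ph p 2 := by
    rw [Polynomial.C_dvd_iff_dvd_coeff]
    intro n
    rw [Polynomial.coeff_sub, coeff_ph, coeff_ph, ← toZMod_eq_zero, map_sub]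
    split_ifs with h
    · rw [cc_mod hp (dvd_mul_left _ _) h.2, cc_mod hp (dvd_mul_left _ _) h.2, sub_self]
    · simp
  simpa [Dvd.dvd] using h

variable (p) in
open Classical in
noncomputable def ch : Polynomial ℤ_[p] := if h : 3 < p then (exists_ch h).choose else 0
variable (p) in
open Classical in
noncomputable def eh : Polynomial ℤ_[p] := if h : 3 < p then (exists_e h).choose else 0

lemma ch_spec (hp : 3 < p) : ph p 1 - ph p 2 = (p : Polynomial ℤ_[p]) * ch p := by
  rw [ch, dif_pos hp]; exact (exists_ch hp).choose_spec

lemma eh_spec (hp : 3 < p) : (eh p).natDegree ≤ p - 1 ∧ (eh p).coeff 0 = 0 ∧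
    MM (D1 (ZMod p)) (X ^ 3) (red p (eh p : ℤ_[p]⟦X⟧)) =
      54 * (-(X ^ 3 * (1 - X ^ 3)) * red p (fS p) + (1 - X ^ 3) * D1 (ZMod p) (red p (fS p))) := by
  rw [eh, dif_pos hp]; exact (exists_e hp).choose_spec

lemma coeff_natCast_mul (g : Polynomial ℤ_[p]) (n : ℕ) :
    ((p : Polynomial ℤ_[p]) * g).coeff n = p * g.coeff n := by
  rw [← Polynomial.C_eq_natCast, Polynomial.coeff_C_mul]

lemma ch_deg (hp : 3 < p) : (ch p).natDegree ≤ 3 * (2 * p / 3) := by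
  rw [Polynomial.natDegree_le_iff_coeff_eq_zero]
  intro n hn
  have h := congrArg (fun f => Polynomial.coeff f n) (ch_spec hp)
  simp only [Polynomial.coeff_sub, coeff_natCast_mul] at h
  have h1 := natDegree_ph hp 1 (by norm_num) (by norm_num)
  have h2 := natDegree_ph hp 2 (by norm_num) (by norm_num)
  rw [Polynomial.coeff_eq_zero_of_natDegree_lt (by omega), Polynomial.coeff_eq_zero_of_natDegree_lt (by omega)] at h
  rw [sub_self] at h
  exact (mul_eq_zero.1 h.symm).resolve_left pZ_ne

/-- abbreviations as power series -/
noncomputable abbrev φS (p : ℕ) [Fact p.Prime] (j : ℕ) : ℤ_[p]⟦X⟧ := (ph p j : ℤ_[p]⟦X⟧)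
noncomputable abbrev χS (p : ℕ) [Fact p.Prime] : ℤ_[p]⟦X⟧ := (ch p : ℤ_[p]⟦X⟧)
noncomputable abbrev eS (p : ℕ) [Fact p.Prime] : ℤ_[p]⟦X⟧ := (eh p : ℤ_[p]⟦X⟧)

lemma φS_eq (j : ℕ) : φS p j = ∑ k ∈ Finset.range p, C (cc ((j : ℤ_[p]) * (p : ℤ_[p])) k) * (X ^ 3) ^ k := by
  have : φS p j = Polynomial.coeToPowerSeries.ringHom (ph p j) := rfl
  rw [this, ph, map_sum]
  simp

lemma ch_specS (hp : 3 < p) : φS p 1 - φS p 2 = (p : ℤ_[p]⟦X⟧) * χS p := by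
  have := congrArg (Polynomial.coeToPowerSeries.ringHom (R := ℤ_[p])) (ch_spec hp)
  rw [map_sub, map_mul, map_natCast] at this
  exact this

lemma LL_ph (hp : 3 < p) (j : ℕ) (hj : 0 < j) (hj' : j < 3) :
    LL (D1 ℤ_[p]) (X ^ 3) (φS p j) = ((j : ℤ_[p]⟦X⟧) * (p : ℤ_[p]⟦X⟧)) * (2 * (1 - X ^ 3) * D1 _ (φS p j) - 3 * (X ^ 3 * (1 - X ^ 3)) * φS p j)
      + ((j : ℤ_[p]⟦X⟧) * (p : ℤ_[p]⟦X⟧)) ^ 2 * (-(1 - X ^ 3) ^ 2 * φS p j + (1 - X ^ 3)) := by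
  have hw : (j : ℤ_[p]⟦X⟧) * (p : ℤ_[p]⟦X⟧) = C ((j : ℤ_[p]) * (p : ℤ_[p])) := by simp
  have h := ODE_phi (D1 ℤ_[p]) (X ^ 3) ((j : ℤ_[p]⟦X⟧) * (p : ℤ_[p]⟦X⟧)) D1_X3 (by rw [hw, D1_C])
    (fun k => C (cc ((j : ℤ_[p]) * (p : ℤ_[p])) k)) (fun k => D1_C _) (p - 1)
    (by
      intro k hk
      have := congrArg (C (R := ℤ_[p])) (cc_rec hp (w := (j : ℤ_[p]) * (p : ℤ_[p])) (dvd_mul_left _ _) (k := k) (by omega))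
      simpa [C_2, C_3] using this) (φS p j) (by rw [show p - 1 + 1 = p by omega]; exact φS_eq j)
  have h0 : cc ((j : ℤ_[p]) * (p : ℤ_[p])) (p - 1) = 0 := cc_term hp j hj hj' (by
    have : j = 1 ∨ j = 2 := by omega
    rcases this with rfl | rfl <;> omega)
  have h1 : cc ((j : ℤ_[p]) * (p : ℤ_[p])) 0 = 1 := by simp [cc]
  simp only [h0, h1, map_zero, map_one] at h
  linear_combination h

lemma h1_main (hp : 3 < p) : LL (D1 ℤ_[p]) (X ^ 3) (φS p 1) =
    (p : ℤ_[p]⟦X⟧) * (2 * (1 - X ^ 3) * D1 _ (φS p 1) - 3 * (X ^ 3 * (1 - X ^ 3)) * φS p 1)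
      + (p : ℤ_[p]⟦X⟧) ^ 2 * alphaF (X ^ 3) (φS p 1) := by
  have := LL_ph hp 1 (by norm_num) (by norm_num)
  rw [this, alphaF]; push_cast; ring

lemma h2_main (hp : 3 < p) : LL (D1 ℤ_[p]) (X ^ 3) (χS p) =
    -2 * (1 - X ^ 3) * D1 _ (φS p 1) + 3 * (X ^ 3 * (1 - X ^ 3)) * φS p 1
      + (p : ℤ_[p]⟦X⟧) * betaF (D1 _) (p : ℤ_[p]⟦X⟧) (X ^ 3) (φS p 1) (χS p) := by
  have h1 := LL_ph hp 1 (by norm_num) (by norm_num)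
  have h2 := LL_ph hp 2 (by norm_num) (by norm_num)
  have hs := ch_specS hp
  have e2 : φS p 2 = φS p 1 - (p : ℤ_[p]⟦X⟧) * χS p := by rw [← hs]; ring
  have hDp : D1 ℤ_[p] (p : ℤ_[p]⟦X⟧) = 0 := by have := D1_p (p := p) 1; rwa [pow_one] at this
  apply mul_left_cancel₀ (p_ne_zero_ps (p := p))
  have hL : (p : ℤ_[p]⟦X⟧) * LL (D1 ℤ_[p]) (X ^ 3) (χS p) = LL (D1 ℤ_[p]) (X ^ 3) (φS p 1) - LL (D1 ℤ_[p]) (X ^ 3) (φS p 2) := by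
    rw [e2]
    simp only [LL, map_sub, Derivation.leibniz, hDp, map_add, smul_eq_mul, mul_zero, add_zero]
    ring
  have hD2 : D1 ℤ_[p] (φS p 2) = D1 _ (φS p 1) - (p : ℤ_[p]⟦X⟧) * D1 _ (χS p) := by
    rw [e2]
    simp only [map_sub, Derivation.leibniz, hDp, smul_eq_mul, mul_zero, add_zero]
  rw [hL, h1, h2, hD2, e2, betaF]
  push_cast
  ring

variable (p) in
noncomputable def kap : ℤ_[p] := 36 ^ p * AA p p * Ring.inverse 4
lemma isUnit_four (hp : 3 < p) : IsUnit (4 : ℤ_[p]) := by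
  have := (isUnit_two hp).mul (isUnit_two hp); norm_num at this; exact this
lemma kap4 (hp : 3 < p) : 4 * kap p = 36 ^ p * AA p p := by
  rw [kap]; linear_combination 36 ^ p * AA p p * Ring.mul_inverse_cancel _ (isUnit_four hp)

lemma z_36 : PadicInt.toZMod (p := p) 36 = 36 := map_ofNat _ 36
lemma z_108 : PadicInt.toZMod (p := p) 108 = 108 := map_ofNat _ 108

lemma kap_mod (hp : 3 < p) : PadicInt.toZMod (kap p) = 1 := by
  have h := congrArg (PadicInt.toZMod (p := p)) (kap4 hp)
  have h2 := dvd_to_zmod (by norm_num) (wolst2 hp)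
  have h3 := dvd_to_zmod (by norm_num) (wolst3 hp)
  have h4 := congrArg (PadicInt.toZMod (p := p)) (Ring.mul_inverse_cancel _ (isUnit_108 hp))
  rw [map_mul, map_one, z_108] at h4
  rw [z_2] at h2
  rw [z_3] at h3
  rw [AA] at h
  simp only [map_mul, map_pow, ZMod.pow_card, h2, h3, z_4, z_36] at h
  have h44 : (4 : ZMod p) ≠ 0 := by
    have := (isUnit_iff_toZMod _).1 (isUnit_four hp); rwa [z_4] at this
  apply mul_left_cancel₀ h44
  linear_combination h + 4 * h4

variable (p) in
noncomputable def qhS : ℤ_[p]⟦X⟧ := 1 + 2 * (C (kap p) * X ^ p)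
variable (p) in
noncomputable def QhS : ℤ_[p]⟦X⟧ := invOfUnit (qhS p) 1
variable (p) in
noncomputable def qS : ℤ_[p]⟦X⟧ := 1 + 2 * X
variable (p) in
noncomputable def QS : ℤ_[p]⟦X⟧ := invOfUnit (qS p) 1

lemma hQh (hp : 3 < p) : qhS p * QhS p = 1 := by
  apply mul_invOfUnit
  simp [qhS]; right; omega
lemma hQ : (1 + 2 * X) * QS p = 1 := by
  apply mul_invOfUnit
  simp [qS]

lemma D_two : D1 ℤ_[p] (2 : ℤ_[p]⟦X⟧) = 0 := by exact_mod_cast (D1 ℤ_[p]).map_natCast 2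

lemma D_QhS (hp : 3 < p) : D1 ℤ_[p] (QhS p) = (p : ℤ_[p]⟦X⟧) * (1 - X ^ 3) * (QhS p ^ 2 - QhS p) := by
  have h := hQh hp
  have hD := congrArg (D1 ℤ_[p]) h
  rw [Derivation.leibniz, Derivation.map_one_eq_zero] at hD
  have hq : D1 ℤ_[p] (qhS p) = (p : ℤ_[p]⟦X⟧) * (1 - X ^ 3) * (qhS p - 1) := by
    rw [qhS, map_add, Derivation.leibniz, Derivation.leibniz, D1_C, D_two, D_pow_log _ X _ D1_X p,
      Derivation.map_one_eq_zero]
    simp only [smul_eq_mul]; ring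
  rw [hq] at hD
  simp only [smul_eq_mul] at hD
  linear_combination QhS p * hD - (D1 ℤ_[p] (QhS p) + (p : ℤ_[p]⟦X⟧) * (1 - X ^ 3) * QhS p) * h

variable (p) in
noncomputable def yS : ℤ_[p]⟦X⟧ := φS p 1 * QhS p + (p : ℤ_[p]⟦X⟧) * χS p * QhS p ^ 2
variable (p) in
noncomputable def WhS : ℤ_[p]⟦X⟧ := 9 * (yS p * yS p) + (18 * (p : ℤ_[p]⟦X⟧) ^ 2) * (QhS p ^ 4 * (χS p * χS p))
  + (p : ℤ_[p]⟦X⟧) ^ 2 * ((3 * QhS p - 1) * QhS p ^ 2 * eS p)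

lemma red_6 : red p 6 = 6 := map_ofNat _ 6
lemma red_TF (P x φ χ e Q y : ℤ_[p]⟦X⟧) (hx : x = X ^ 3) : red p (TF (D1 _) P x φ χ e Q y) =
    TF (D1 _) (red p P) (red p x) (red p φ) (red p χ) (red p e) (red p Q) (red p y) := by
  subst hx
  simp only [TF, rhoF, alphaF, betaF, map_add, map_mul, map_sub, map_neg, map_pow, red_MM, red_D1, red_X, red_1, red_2, red_3, red_4, red_6,
    red_18]

lemma MM_WhS_dvd (hp : 3 < p) : (p : ℤ_[p]⟦X⟧) ^ 3 ∣ MM (D1 ℤ_[p]) (X ^ 3) (WhS p) := by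
  have hDp : D1 ℤ_[p] (p : ℤ_[p]⟦X⟧) = 0 := by have := D1_p (p := p) 1; rwa [pow_one] at this
  have h := MM_What (D1 ℤ_[p]) (p : ℤ_[p]⟦X⟧) (X ^ 3) (φS p 1) (χS p) (eS p) (QhS p) (yS p) D1_X3 hDp (D_QhS hp)
    (h1_main hp) (h2_main hp) rfl
  rw [WhS, h]
  rw [pow_succ]
  apply mul_dvd_mul_left
  rw [← red_eq_zero, red_TF _ _ _ _ _ _ _ rfl]
  have hφ : red p (φS p 1) = red p (fS p) := red_ph hp 1
  have hy : red p (yS p) = red p (φS p 1) * red p (QhS p) := by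
    rw [yS]; simp only [map_add, map_mul, red_p, zero_mul, add_zero]
  rw [hy, red_p, map_pow, red_X]
  apply TF_zero _ _ _ _ _ _ D1_X3
  · rw [← red_D1, D_QhS hp]; simp only [map_mul, red_p, zero_mul]
  · rw [← LL_map', h1_main hp]; simp only [map_add, map_mul, map_pow, red_p]; simp
  · rw [← LL_map', h2_main hp]
    simp only [map_add, map_mul, map_sub, map_neg, map_pow, red_p, red_D1, red_X, red_1, red_2, red_3, zero_mul, add_zero]
  · rw [hφ]; exact (eh_spec hp).2.2

end cand
end S8

namespace S8
open PowerSeries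
section om
variable {p : ℕ} [Fact p.Prime]

variable (p) in
noncomputable def zS : ℤ_[p]⟦X⟧ := 36 * (X * (1 - X) ^ 2 * (1 - X ^ 3)) * QS p ^ 6
variable (p) in
noncomputable def WS : ℤ_[p]⟦X⟧ := 9 * ∑ k ∈ Finset.range p, C (AA p k) * (QS p ^ 2 * zS p ^ k)

lemma C_18' : C (R := ℤ_[p]) 18 = 18 := map_ofNat _ 18
lemma C_9' : C (R := ℤ_[p]) 9 = 9 := map_ofNat _ 9
lemma C_36' : C (R := ℤ_[p]) 36 = 36 := map_ofNat _ 36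
lemma ne18 : (18 : ℤ_[p]⟦X⟧) ≠ 0 := by
  rw [← C_18', Ne, map_eq_zero_iff _ C_injective]; norm_num

lemma MM_WS (hp : 3 < p) : MM (D1 ℤ_[p]) (X ^ 3) (WS p) = (p : ℤ_[p]⟦X⟧) ^ 3 * (X ^ p *
    (-(9 * ((2 * (1 - X) ^ 3 - (1 + 2 * X) ^ 3) * (1 + 2 * X) ^ 3 * QS p ^ 2) * C (AA p p) *
      (36 * ((1 - X) ^ 2 * (1 - X ^ 3)) * QS p ^ 6) ^ p))) := by
  have h := MM_W (D1 ℤ_[p]) X (QS p) (zS p) D1_X hQ rfl (fun k => C (AA p k)) (fun k => D1_C _)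
    (by
      intro k
      have := congrArg (C (R := ℤ_[p])) (AA_rec hp k)
      simpa [C_2, C_3, C_18'] using this) p
  have hD9 : D1 ℤ_[p] (9 : ℤ_[p]⟦X⟧) = 0 := by exact_mod_cast (D1 ℤ_[p]).map_natCast 9
  rw [WS, MM_const _ _ _ _ hD9]
  apply mul_left_cancel₀ ne18
  have hz : zS p ^ p = X ^ p * (36 * ((1 - X) ^ 2 * (1 - X ^ 3)) * QS p ^ 6) ^ p := by
    rw [← mul_pow, zS]; congr 1; ring
  rw [hz] at h
  linear_combination 9 * h

lemma cQS : constantCoeff (QS p) = 1 := by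
  have := congrArg (constantCoeff (R := ℤ_[p])) (hQ (p := p))
  simpa using this

lemma c_9 : constantCoeff (R := ℤ_[p]) 9 = 9 := map_ofNat _ 9
lemma c_2 : constantCoeff (R := ℤ_[p]) 2 = 2 := map_ofNat _ 2
lemma c_3 : constantCoeff (R := ℤ_[p]) 3 = 3 := map_ofNat _ 3
lemma c_6 : constantCoeff (R := ℤ_[p]) 6 = 6 := map_ofNat _ 6
lemma c_8 : constantCoeff (R := ℤ_[p]) 8 = 8 := map_ofNat _ 8
lemma c_4 : constantCoeff (R := ℤ_[p]) 4 = 4 := map_ofNat _ 4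
lemma c_36 : constantCoeff (R := ℤ_[p]) 36 = 36 := map_ofNat _ 36

lemma WS_0 (hp : 3 < p) : constantCoeff (WS p) = 9 := by
  rw [WS, map_mul, map_sum, Finset.sum_eq_single 0]
  · simp [cQS, AA_zero, c_9]
  · intro k _ hk
    simp [zS, hk]
  · intro h; simp at h; omega

lemma WS_p (hp : 3 < p) : coeff p (WS p) = -36 * kap p := by
  have hlow : ∀ n, n < p → n % 3 ≠ 0 → coeff n (WS p) = 0 := by
    intro n
    induction n using Nat.strong_induction_on with
    | _ n ih =>
      intro hn h3
      have hh : Hn n (WS p) := fun m hm hm3 => ih m hm (by omega) (by omega)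
      have h1 := coeff_MM hh
      rw [MM_WS hp, mul_left_comm, coeff_X_pow_mul', if_neg (by omega)] at h1
      have : (n : ℤ_[p]) ≠ 0 := by
        have : n ≠ 0 := by rintro rfl; simp at h3
        exact_mod_cast this
      exact (mul_eq_zero.1 h1.symm).resolve_left (pow_ne_zero _ this)
  have h3 := p_mod3 hp
  have hh : Hn p (WS p) := fun m hm hm3 => hlow m hm (by omega)
  have h1 := coeff_MM hh
  rw [MM_WS hp, mul_left_comm, coeff_X_pow_mul', if_pos le_rfl, Nat.sub_self, coeff_zero_eq_constantCoeff_apply, map_mul, map_pow,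
    map_natCast] at h1
  have h2 := mul_left_cancel₀ (pow_ne_zero 3 pZ_ne) h1
  rw [← h2]
  simp only [map_neg, map_mul, map_sub, map_add, map_pow, map_one, constantCoeff_X, constantCoeff_C, cQS, c_9, c_2, c_36]
  linear_combination 9 * kap4 hp

variable (p) in
noncomputable def tauS : ℤ_[p]⟦X⟧ := C (kap p) * X ^ p
variable (p) in
noncomputable def BrS : ℤ_[p]⟦X⟧ := 9 * ((qhS p * φS p 1 + (p : ℤ_[p]⟦X⟧) * χS p) ^ 2 + 2 * (p : ℤ_[p]⟦X⟧) ^ 2 * χS p ^ 2)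
  + (p : ℤ_[p]⟦X⟧) ^ 2 * eS p * (3 - qhS p) * qhS p

lemma WhS_mul (hp : 3 < p) : WhS p * qhS p ^ 4 = BrS p := by
  have h := hQh hp
  rw [WhS, yS, BrS]
  generalize qhS p = q at *
  generalize QhS p = Q at *
  generalize φS p 1 = φ
  generalize χS p = χ
  generalize eS p = e
  have h2 : q ^ 2 * Q ^ 2 = 1 := by rw [← mul_pow, h, one_pow]
  have h3 : q ^ 3 * Q ^ 3 = 1 := by rw [← mul_pow, h, one_pow]
  have h4 : q ^ 4 * Q ^ 4 = 1 := by rw [← mul_pow, h, one_pow]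
  linear_combination (9 * φ ^ 2 * q ^ 2 - (p : ℤ_[p]⟦X⟧) ^ 2 * q ^ 2 * e) * h2 + (18 * (p : ℤ_[p]⟦X⟧) * φ * χ * q + 3 * (p : ℤ_[p]⟦X⟧) ^ 2 * e * q) * h3
    + (27 * (p : ℤ_[p]⟦X⟧) ^ 2 * χ ^ 2) * h4

lemma BrS_eq (hp : 3 < p) : BrS p = 9 * (6 * (φS p 1 * φS p 1) - 8 * (φS p 1 * φS p 2) + 3 * (φS p 2 * φS p 2)) + 2 * ((p : ℤ_[p]⟦X⟧) ^ 2 * eS p) +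
    X ^ p * (36 * C (kap p) * φS p 1 * (2 * φS p 1 - φS p 2) + 2 * (p : ℤ_[p]⟦X⟧) ^ 2 * C (kap p) * eS p) +
    X ^ (2 * p) * (36 * C (kap p) ^ 2 * φS p 1 ^ 2 - 4 * (p : ℤ_[p]⟦X⟧) ^ 2 * C (kap p) ^ 2 * eS p) := by
  have hs := ch_specS hp
  have e2 : φS p 2 = φS p 1 - (p : ℤ_[p]⟦X⟧) * χS p := by rw [← hs]; ring
  rw [e2, BrS, qhS, two_mul p, pow_add]
  ring

lemma coeff_mul3 {K : Type*} [CommRing K] (f g : K⟦X⟧) (hf : ∀ n, n % 3 ≠ 0 → coeff n f = 0) (hg : ∀ n, n % 3 ≠ 0 → coeff n g = 0)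
    (n : ℕ) (hn : n % 3 ≠ 0) : coeff n (f * g) = 0 := by
  rw [coeff_mul]
  apply Finset.sum_eq_zero
  rintro ⟨i, j⟩ hij
  rw [Finset.HasAntidiagonal.mem_antidiagonal] at hij
  simp only at hij ⊢
  by_cases h : i % 3 = 0
  · rw [hg j (by omega), mul_zero]
  · rw [hf i h, zero_mul]

lemma φS_3 (j n : ℕ) (hn : n % 3 ≠ 0) : coeff n (φS p j) = 0 := by
  rw [Polynomial.coeff_coe, coeff_ph, if_neg (by omega)]

lemma φS_0 (hp : 3 < p) (j : ℕ) : constantCoeff (φS p j) = 1 := by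
  rw [← coeff_zero_eq_constantCoeff_apply, Polynomial.coeff_coe, coeff_ph, if_pos (by simp; omega)]
  simp [cc]

lemma eS_0 (hp : 3 < p) : constantCoeff (eS p) = 0 := by
  rw [← coeff_zero_eq_constantCoeff_apply, Polynomial.coeff_coe, (eh_spec hp).2.1]

lemma coeff_natmul (f : ℤ_[p]⟦X⟧) (a n : ℕ) : coeff n ((a : ℤ_[p]⟦X⟧) * f) = a * coeff n f := by
  have : (a : ℤ_[p]⟦X⟧) = C (a : ℤ_[p]) := by simp
  rw [this, coeff_C_mul]

lemma BrS_0 (hp : 3 < p) : constantCoeff (BrS p) = 9 := by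
  have : p ≠ 0 := by omega
  rw [BrS_eq hp]
  simp only [map_neg, map_mul, map_sub, map_add, map_pow, map_one, constantCoeff_X, constantCoeff_C, φS_0 hp, eS_0 hp, c_2, c_3, c_6, c_8, c_9, c_36]
  rw [zero_pow this, zero_pow (by omega)]
  ring

lemma BrS_p (hp : 3 < p) : coeff p (BrS p) = 36 * kap p := by
  have h3 := p_mod3 hp
  have h3' : p % 3 ≠ 0 := by omega
  have H := fun i j => coeff_mul3 (φS p i) (φS p j) (φS_3 i) (φS_3 j) p h3'
  have n9 := coeff_natmul (p := p) (a := 9)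
  have n8 := coeff_natmul (p := p) (a := 8)
  have n6 := coeff_natmul (p := p) (a := 6)
  have n3 := coeff_natmul (p := p) (a := 3)
  have n2 := coeff_natmul (p := p) (a := 2)
  push_cast at n9 n8 n6 n3 n2
  have he : coeff p (eS p) = 0 := by
    rw [Polynomial.coeff_coe]; exact Polynomial.coeff_eq_zero_of_natDegree_lt (by have := (eh_spec hp).1; omega)
  rw [BrS_eq hp, map_add, map_add, map_add, n9, map_add, map_sub, n6, n8, n3, H, H, H, n2, pow_two (p : ℤ_[p]⟦X⟧), mul_assoc, coeff_natmul,
    coeff_natmul, he, coeff_X_pow_mul', if_pos le_rfl, coeff_X_pow_mul', if_neg (by omega), Nat.sub_self, coeff_zero_eq_constantCoeff_apply]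
  simp only [map_neg, map_mul, map_sub, map_add, map_pow, map_one, constantCoeff_X, constantCoeff_C, φS_0 hp, eS_0 hp, c_2, c_3, c_6, c_8, c_9, c_36]
  ring

variable (p) in
noncomputable def Om : ℤ_[p]⟦X⟧ := WS p - WhS p

lemma MM_Om (hp : 3 < p) : (p : ℤ_[p]⟦X⟧) ^ 3 ∣ MM (D1 ℤ_[p]) (X ^ 3) (Om p) := by
  rw [Om, MM_sub, MM_WS hp]
  exact dvd_sub (dvd_mul_right _ _) (MM_WhS_dvd hp)

lemma Om_0 (hp : 3 < p) : coeff 0 (Om p) = 0 := by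
  have h := congrArg (constantCoeff (R := ℤ_[p])) (WhS_mul hp)
  have : p ≠ 0 := by omega
  rw [map_mul, map_pow, BrS_0 hp] at h
  have hq : constantCoeff (qhS p) = 1 := by simp [qhS, this]
  rw [hq] at h
  rw [coeff_zero_eq_constantCoeff_apply, Om, map_sub, WS_0 hp]
  linear_combination -h

lemma Om_p (hp : 3 < p) : coeff p (Om p) = 0 := by
  have h : Om p * qhS p ^ 4 = WS p * qhS p ^ 4 - BrS p := by rw [← WhS_mul hp, Om]; ring
  have e : ∀ f : ℤ_[p]⟦X⟧, coeff p (f * qhS p ^ 4) = coeff p f + 8 * kap p * constantCoeff f := by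
    intro f
    have : f * qhS p ^ 4 = f + X ^ p * (8 * C (kap p) * f) + X ^ (2 * p) * ((24 * C (kap p) ^ 2 + 32 * C (kap p) ^ 3 * X ^ p + 16 * C (kap p) ^ 4 * X ^ p * X ^ p) * f) := by
      rw [qhS, two_mul p, pow_add]; ring
    rw [this, map_add, map_add, coeff_X_pow_mul', if_pos le_rfl, coeff_X_pow_mul', if_neg (by omega), Nat.sub_self, coeff_zero_eq_constantCoeff_apply]
    simp only [map_mul, constantCoeff_C, c_8]; ring
  have h1 := congrArg (coeff p) h
  rw [map_sub, e, e, BrS_p hp, WS_0 hp, WS_p hp, ← coeff_zero_eq_constantCoeff_apply, Om_0 hp] at h1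
  linear_combination h1

end om
end S8

namespace S8
open PowerSeries
section stage
variable {p : ℕ} [Fact p.Prime]

lemma coe_p (r : ℕ) : (((p : Polynomial ℤ_[p]) ^ r : Polynomial ℤ_[p]) : ℤ_[p]⟦X⟧) = (p : ℤ_[p]⟦X⟧) ^ r := by
  have : Polynomial.coeToPowerSeries.ringHom (R := ℤ_[p]) ((p : Polynomial ℤ_[p]) ^ r) = (p : ℤ_[p]⟦X⟧) ^ r := by
    rw [map_pow, map_natCast]
  exact this

lemma coeff_ppow_mul (g : Polynomial ℤ_[p]) (r n : ℕ) :
    ((p : Polynomial ℤ_[p]) ^ r * g).coeff n = (p : ℤ_[p]) ^ r * g.coeff n := by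
  rw [← Polynomial.C_eq_natCast, ← Polynomial.C_pow, Polynomial.coeff_C_mul]

lemma poly_dvd (f : Polynomial ℤ_[p]) (r : ℕ) (h : (p : ℤ_[p]⟦X⟧) ^ r ∣ (f : ℤ_[p]⟦X⟧)) :
    ∃ g : Polynomial ℤ_[p], f = (p : Polynomial ℤ_[p]) ^ r * g ∧ g.natDegree ≤ f.natDegree := by
  have h2 : Polynomial.C ((p : ℤ_[p]) ^ r) ∣ f := by
    rw [Polynomial.C_dvd_iff_dvd_coeff]
    intro n
    have := (dvd_coeff_iff _ _).1 h n
    rwa [Polynomial.coeff_coe] at this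
  obtain ⟨g, hg⟩ := h2
  refine ⟨g, by rw [hg]; simp, ?_⟩
  rw [hg, Polynomial.natDegree_C_mul (pow_ne_zero _ pZ_ne)]

lemma coeff_pow_mul (g : ℤ_[p]⟦X⟧) (r n : ℕ) : coeff n ((p : ℤ_[p]⟦X⟧) ^ r * g) = (p : ℤ_[p]) ^ r * coeff n g := by
  have : (p : ℤ_[p]⟦X⟧) ^ r = C ((p : ℤ_[p]) ^ r) := by simp
  rw [this, coeff_C_mul]

lemma red_q (m : ℕ) : red p (qS p ^ (m * p)) = (1 + 2 * X ^ p) ^ m := by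
  rw [mul_comm, pow_mul, map_pow, map_pow, qS, map_add, map_mul, red_X, red_1, red_2]
  congr 1
  have := congrArg (fun f : Polynomial (ZMod p) => (f : (ZMod p)⟦X⟧)) (add_pow_char (1 : Polynomial (ZMod p)) (2 * Polynomial.X) p)
  simp only [Polynomial.coe_pow, Polynomial.coe_add, Polynomial.coe_mul, Polynomial.coe_one, Polynomial.coe_X, mul_pow, one_pow] at this
  have h2 : (Polynomial.toPowerSeries (2 : Polynomial (ZMod p))) = 2 := map_ofNat (Polynomial.coeToPowerSeries.ringHom (R := ZMod p)) 2
  rw [h2] at this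
  rw [this]
  have h3 : (2 : (ZMod p)⟦X⟧) ^ p = 2 := by
    have : (2 : (ZMod p)⟦X⟧) = C (2 : ZMod p) := (map_ofNat _ 2).symm
    rw [this, ← map_pow, ZMod.pow_card]
  rw [h3]

lemma qQ (n : ℕ) : qS p ^ n * QS p ^ n = 1 := by rw [← mul_pow, qS, hQ, one_pow]

lemma dvd_q (a f : ℤ_[p]⟦X⟧) (n : ℕ) (h : a ∣ qS p ^ n * f) : a ∣ f := by
  have : f = QS p ^ n * (qS p ^ n * f) := by linear_combination (-f) * qQ (p := p) n
  rw [this]; exact h.mul_left _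

lemma stage (hp : 3 < p) (i : ℕ) (hi : i ≤ 2) (m : ℕ) (P : Polynomial ℤ_[p]) (hd : P.natDegree ≤ 4 * p - 2)
    (hO : (p : ℤ_[p]⟦X⟧) ^ i ∣ Om p) (hP : (p : ℤ_[p]⟦X⟧) ^ (i + 1) ∣ (P : ℤ_[p]⟦X⟧) - qS p ^ (m * p) * Om p) :
    ∃ R : Polynomial ℤ_[p], P = (p : Polynomial ℤ_[p]) ^ i * R ∧ R.natDegree ≤ P.natDegree ∧
      (∃ c, R.map PadicInt.toZMod = Polynomial.C c * Polynomial.X ^ (2 * p) * (gp p * gp p)) ∧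
      (R.map PadicInt.toZMod = 0 → (p : ℤ_[p]⟦X⟧) ^ (i + 1) ∣ Om p) := by
  have hpi : (p : ℤ_[p]⟦X⟧) ^ i ≠ 0 := pow_ne_zero _ p_ne_zero_ps
  have hPi : (p : ℤ_[p]⟦X⟧) ^ i ∣ (P : ℤ_[p]⟦X⟧) := by
    have := dvd_add ((pow_dvd_pow _ (Nat.le_succ i)).trans hP) (hO.mul_left (qS p ^ (m * p)))
    simpa using this
  obtain ⟨R, hR, hRd⟩ := poly_dvd P i hPi
  obtain ⟨O, hO'⟩ := hO
  have hRO : (p : ℤ_[p]⟦X⟧) ∣ (R : ℤ_[p]⟦X⟧) - qS p ^ (m * p) * O := by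
    rw [hO', hR, Polynomial.coe_mul, coe_p, mul_left_comm, ← mul_sub, pow_succ] at hP
    exact (mul_dvd_mul_iff_left hpi).1 hP
  have hred : ((R.map PadicInt.toZMod : Polynomial (ZMod p)) : (ZMod p)⟦X⟧) = (1 + 2 * X ^ p) ^ m * red p O := by
    rw [← red_q, ← map_mul, ← red_coe, ← sub_eq_zero, ← map_sub, red_eq_zero]; exact hRO
  have hMO : MM (D1 (ZMod p)) (X ^ 3) (red p O) = 0 := by
    rw [← red_MM, red_eq_zero]
    have := MM_Om hp
    have e3 : (p : ℤ_[p]⟦X⟧) ^ 3 = (p : ℤ_[p]⟦X⟧) ^ i * (p : ℤ_[p]⟦X⟧) ^ (3 - i) := by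
      rw [← pow_add]; congr 1; omega
    rw [hO', MM_const _ _ _ _ (D1_p i), e3] at this
    have h2 := (mul_dvd_mul_iff_left hpi).1 this
    exact (dvd_pow_self _ (by omega)).trans h2
  have hD : D1 (ZMod p) ((1 + 2 * X ^ p) ^ m) = 0 := by
    rw [← red_q, map_pow]; exact D1_pow_char p _ _ (dvd_mul_left _ _)
  have hO0 : coeff 0 O = 0 := by
    have := Om_0 hp
    rw [hO', coeff_pow_mul] at this
    exact (mul_eq_zero.1 this).resolve_left (pow_ne_zero _ pZ_ne)
  have hOp : coeff p O = 0 := by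
    have := Om_p hp
    rw [hO', coeff_pow_mul] at this
    exact (mul_eq_zero.1 this).resolve_left (pow_ne_zero _ pZ_ne)
  have hrO0 : coeff 0 (red p O) = 0 := by rw [red, coeff_map, hO0, map_zero]
  have hrOp : coeff p (red p O) = 0 := by rw [red, coeff_map, hOp, map_zero]
  have key : ∀ m : ℕ, coeff 0 ((1 + 2 * X ^ p) ^ m * red p O) = 0 ∧ coeff p ((1 + 2 * X ^ p) ^ m * red p O) = 0 := by
    intro m
    induction m with
    | zero => simp only [pow_zero, one_mul]; exact ⟨hrO0, hrOp⟩
    | succ m ih =>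
      have e : ((1 + 2 * X ^ p) ^ (m + 1) * red p O) = (1 + 2 * X ^ p) ^ m * red p O + X ^ p * (C 2 * ((1 + 2 * X ^ p) ^ m * red p O)) := by
        rw [show C (2 : ZMod p) = 2 from map_ofNat _ 2]; ring
      rw [e, map_add, map_add, coeff_X_pow_mul', if_neg (by omega), coeff_X_pow_mul', if_pos le_rfl, Nat.sub_self, coeff_C_mul, ih.1, ih.2]
      simp
  refine ⟨R, hR, hRd, ?_, ?_⟩
  · apply lemmaS hp
    · exact Polynomial.natDegree_map_le.trans (hRd.trans hd)
    · rw [hred, MM_const _ _ _ _ hD, hMO, mul_zero]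
    · rw [← Polynomial.coeff_coe, hred]; exact (key m).1
    · rw [← Polynomial.coeff_coe, hred]; exact (key m).2
  · intro h0
    have h1 : (p : ℤ_[p]⟦X⟧) ∣ (R : ℤ_[p]⟦X⟧) := by
      rw [← red_eq_zero, red_coe, h0]; simp
    have h2 : (p : ℤ_[p]⟦X⟧) ∣ O := by
      apply dvd_q _ _ (m * p)
      have := dvd_sub h1 hRO
      simpa using this
    rw [hO', pow_succ]
    exact mul_dvd_mul_left _ h2

lemma stage_small (hp : 3 < p) (i : ℕ) (hi : i ≤ 2) (m : ℕ) (P : Polynomial ℤ_[p]) (hd : P.natDegree ≤ 3 * p - 2)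
    (hO : (p : ℤ_[p]⟦X⟧) ^ i ∣ Om p) (hP : (p : ℤ_[p]⟦X⟧) ^ (i + 1) ∣ (P : ℤ_[p]⟦X⟧) - qS p ^ (m * p) * Om p) :
    (p : ℤ_[p]⟦X⟧) ^ (i + 1) ∣ Om p := by
  obtain ⟨R, -, hRd, ⟨c, hc⟩, h0⟩ := stage hp i hi m P (by omega) hO hP
  apply h0
  by_cases hc0 : c = 0
  · rw [hc, hc0]; simp
  · exfalso
    have h1 := congrArg Polynomial.natDegree hc
    rw [Polynomial.natDegree_mul, Polynomial.natDegree_C_mul_X_pow _ _ hc0, Polynomial.natDegree_mul (gp_ne hp) (gp_ne hp), natDegree_gp hp] at h1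
    · have h2 : (R.map PadicInt.toZMod).natDegree ≤ R.natDegree := Polynomial.natDegree_map_le
      omega
    · exact mul_ne_zero (by simpa using hc0) (pow_ne_zero _ Polynomial.X_ne_zero)
    · exact mul_ne_zero (gp_ne hp) (gp_ne hp)

end stage
end S8

namespace S8
open PowerSeries
section stages
variable {p : ℕ} [Fact p.Prime]

variable (p) in
noncomputable def qP : Polynomial ℤ_[p] := 1 + 2 * Polynomial.X
variable (p) in
noncomputable def qhP : Polynomial ℤ_[p] := 1 + 2 * (Polynomial.C (kap p) * Polynomial.X ^ p)
variable (p) in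
noncomputable def moP (k : ℕ) : Polynomial ℤ_[p] := Polynomial.X ^ k * (1 - Polynomial.X) ^ (2 * k) * (1 - Polynomial.X ^ 3) ^ k
variable (p) in
noncomputable def NP (B E : ℕ) : Polynomial ℤ_[p] :=
  ∑ k ∈ Finset.range B, Polynomial.C (36 ^ k * AA p k) * (moP p k * qP p ^ (E - 2 - 6 * k))

lemma coe_2 : (Polynomial.toPowerSeries (2 : Polynomial ℤ_[p])) = 2 := map_ofNat (Polynomial.coeToPowerSeries.ringHom (R := ℤ_[p])) 2
lemma coe_9 : (Polynomial.toPowerSeries (9 : Polynomial ℤ_[p])) = 9 := map_ofNat (Polynomial.coeToPowerSeries.ringHom (R := ℤ_[p])) 9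
lemma coe_qP : (qP p : ℤ_[p]⟦X⟧) = qS p := by
  simp only [qP, qS, Polynomial.coe_add, Polynomial.coe_mul, Polynomial.coe_one, Polynomial.coe_X, coe_2]
lemma coe_qhP : (qhP p : ℤ_[p]⟦X⟧) = qhS p := by
  simp only [qhP, qhS, Polynomial.coe_add, Polynomial.coe_mul, Polynomial.coe_one, Polynomial.coe_X, Polynomial.coe_pow, Polynomial.coe_C, coe_2]
lemma coe_moP (k : ℕ) : (moP p k : ℤ_[p]⟦X⟧) = (X * (1 - X) ^ 2 * (1 - X ^ 3)) ^ k := by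
  simp only [moP, Polynomial.coe_mul, Polynomial.coe_one, Polynomial.coe_X, Polynomial.coe_pow, Polynomial.coe_sub]
  rw [mul_pow, mul_pow, ← pow_mul]

lemma coe_NP (B E : ℕ) : (NP p B E : ℤ_[p]⟦X⟧) = ∑ k ∈ Finset.range B, C (36 ^ k * AA p k) * ((X * (1 - X) ^ 2 * (1 - X ^ 3)) ^ k * qS p ^ (E - 2 - 6 * k)) := by
  have : (NP p B E : ℤ_[p]⟦X⟧) = Polynomial.coeToPowerSeries.ringHom (NP p B E) := rfl
  rw [this, NP, map_sum]
  apply Finset.sum_congr rfl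
  intro k _
  change Polynomial.toPowerSeries (Polynomial.C (36 ^ k * AA p k) * (moP p k * qP p ^ (E - 2 - 6 * k))) = _
  rw [Polynomial.coe_mul, Polynomial.coe_C, Polynomial.coe_mul, coe_moP, Polynomial.coe_pow, coe_qP]

lemma natDegree_qP_pow (n : ℕ) : (qP p ^ n).natDegree ≤ n := by
  refine (Polynomial.natDegree_pow_le).trans ?_
  have : (qP p).natDegree ≤ 1 := by
    rw [qP]; compute_degree
  exact (Nat.mul_le_mul_left n this).trans (by simp)

lemma natDegree_moP (k : ℕ) : (moP p k).natDegree ≤ 6 * k := by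
  rw [moP]
  have h1 : (1 - Polynomial.X : Polynomial ℤ_[p]).natDegree ≤ 1 := by compute_degree
  have h2 : (1 - Polynomial.X ^ 3 : Polynomial ℤ_[p]).natDegree ≤ 3 := by compute_degree
  refine (Polynomial.natDegree_mul_le_of_le (Polynomial.natDegree_mul_le_of_le (Polynomial.natDegree_X_pow_le k)
    (Polynomial.natDegree_pow_le_of_le (2 * k) h1)) (Polynomial.natDegree_pow_le_of_le k h2)).trans ?_
  omega

lemma natDegree_NP (B E : ℕ) (hB : 6 * B ≤ E + 4) (hE : 2 ≤ E) : (NP p B E).natDegree ≤ E - 2 := by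
  rw [NP]
  apply Polynomial.natDegree_sum_le_of_forall_le
  intro k hk
  rw [Finset.mem_range] at hk
  refine (Polynomial.natDegree_C_mul_le _ _).trans ?_
  refine (Polynomial.natDegree_mul_le_of_le (natDegree_moP k) (natDegree_qP_pow _)).trans ?_
  omega

lemma NP_spec (B E r : ℕ) (hB : B ≤ p) (hE : 6 * B ≤ E + 4) (_ : 2 ≤ E) (h : ∀ k, B ≤ k → k < p → (p : ℤ_[p]) ^ r ∣ AA p k) :
    (p : ℤ_[p]⟦X⟧) ^ r ∣ 9 * (NP p B E : ℤ_[p]⟦X⟧) - qS p ^ E * WS p := by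
  have e : (NP p B E : ℤ_[p]⟦X⟧) = qS p ^ E * ∑ k ∈ Finset.range B, C (AA p k) * (QS p ^ 2 * zS p ^ k) := by
    rw [coe_NP, Finset.mul_sum]
    apply Finset.sum_congr rfl
    intro k hk
    rw [Finset.mem_range] at hk
    have e1 : qS p ^ E = qS p ^ (E - 2 - 6 * k) * qS p ^ (2 + 6 * k) := by
      rw [← pow_add]; congr 1; omega
    have ez : zS p ^ k = 36 ^ k * (X * (1 - X) ^ 2 * (1 - X ^ 3)) ^ k * QS p ^ (6 * k) := by
      rw [zS, mul_pow, mul_pow, ← pow_mul]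
    rw [e1, ez, map_mul, map_pow, C_36']
    have := qQ (p := p) (2 + 6 * k)
    rw [pow_add (QS p)] at this
    generalize (X * (1 - X) ^ 2 * (1 - X ^ 3) : ℤ_[p]⟦X⟧) ^ k = M
    linear_combination -(C (AA p k) * 36 ^ k * M * qS p ^ (E - 2 - 6 * k)) * this
  rw [e, WS, ← Finset.sum_range_add_sum_Ico _ hB]
  have : 9 * (qS p ^ E * ∑ k ∈ Finset.range B, C (AA p k) * (QS p ^ 2 * zS p ^ k)) -
      qS p ^ E * (9 * (∑ k ∈ Finset.range B, C (AA p k) * (QS p ^ 2 * zS p ^ k) + ∑ k ∈ Finset.Ico B p, C (AA p k) * (QS p ^ 2 * zS p ^ k))) =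
    -(qS p ^ E * 9) * ∑ k ∈ Finset.Ico B p, C (AA p k) * (QS p ^ 2 * zS p ^ k) := by ring
  rw [this]
  apply Dvd.dvd.mul_left
  apply Finset.dvd_sum
  intro k hk
  rw [Finset.mem_Ico] at hk
  apply Dvd.dvd.mul_right
  have := map_dvd (C (R := ℤ_[p])) (h k hk.1 hk.2)
  simpa using this

lemma red_qh (hp : 3 < p) : red p (qhS p) = 1 + 2 * X ^ p := by
  rw [qhS, map_add, map_mul, map_mul, red_C, kap_mod hp, map_pow, red_X, red_1, red_2, map_one, one_mul]

lemma exists_s (hp : 3 < p) : ∃ g : Polynomial ℤ_[p], qhP p - qP p ^ p = (p : Polynomial ℤ_[p]) * g ∧ g.natDegree ≤ p := by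
  obtain ⟨g, hg, hd⟩ := poly_dvd (qhP p - qP p ^ p) 1 (by
    rw [pow_one, ← red_eq_zero, Polynomial.coe_sub, Polynomial.coe_pow, coe_qP, coe_qhP, map_sub, red_qh hp]
    have := red_q (p := p) 1
    rw [one_mul] at this
    rw [this]; ring)
  refine ⟨g, by rw [hg, pow_one], hd.trans ?_⟩
  apply (Polynomial.natDegree_sub_le _ _).trans
  apply max_le
  · rw [qhP]; compute_degree
  · exact natDegree_qP_pow p

variable (p) in
open Classical in
noncomputable def sP : Polynomial ℤ_[p] := if h : 3 < p then (exists_s h).choose else 0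
lemma sP_spec (hp : 3 < p) : qhP p - qP p ^ p = (p : Polynomial ℤ_[p]) * sP p ∧ (sP p).natDegree ≤ p := by
  rw [sP, dif_pos hp]; exact (exists_s hp).choose_spec

variable (p) in
noncomputable def siP : Polynomial ℤ_[p] := ch p - sP p * ph p 1

lemma siP_deg (hp : 3 < p) : (siP p).natDegree ≤ 2 * p - 1 := by
  have h1 := natDegree_ph hp 1 (by norm_num) (by norm_num)
  have h2 := ch_deg hp
  have h3 := (sP_spec hp).2
  have h4 := p_mod3 hp
  apply (Polynomial.natDegree_sub_le _ _).trans
  apply max_le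
  · omega
  · refine (Polynomial.natDegree_mul_le_of_le h3 h1).trans ?_
    omega

variable (p) in
noncomputable def Bst : Polynomial ℤ_[p] := 9 * ((qP p ^ p * ph p 1 + (p : Polynomial ℤ_[p]) * siP p) ^ 2 + 2 * (p : Polynomial ℤ_[p]) ^ 2 * siP p ^ 2)
  + 2 * (p : Polynomial ℤ_[p]) ^ 2 * (eh p * (1 - Polynomial.X ^ p) * qP p ^ p)

lemma coe_p1 : ((p : Polynomial ℤ_[p]) : ℤ_[p]⟦X⟧) = (p : ℤ_[p]⟦X⟧) := by
  have := coe_p (p := p) 1; rwa [pow_one, pow_one] at this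

variable (p) in
noncomputable abbrev siS : ℤ_[p]⟦X⟧ := (siP p : ℤ_[p]⟦X⟧)

lemma coe_Bst : (Bst p : ℤ_[p]⟦X⟧) = 9 * ((qS p ^ p * φS p 1 + (p : ℤ_[p]⟦X⟧) * siS p) ^ 2 + 2 * (p : ℤ_[p]⟦X⟧) ^ 2 * siS p ^ 2)
  + 2 * (p : ℤ_[p]⟦X⟧) ^ 2 * (eS p * (1 - X ^ p) * qS p ^ p) := by
  simp only [Bst, Polynomial.coe_add, Polynomial.coe_mul, Polynomial.coe_one, Polynomial.coe_X, Polynomial.coe_pow, Polynomial.coe_sub, coe_2, coe_9, coe_p1, coe_qP]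

lemma coe_si : siS p = χS p - (sP p : ℤ_[p]⟦X⟧) * φS p 1 := by
  change Polynomial.toPowerSeries (siP p) = _
  rw [siP, Polynomial.coe_sub, Polynomial.coe_mul]

lemma natDegree_ofNat_mul (a : ℕ) [a.AtLeastTwo] (f : Polynomial ℤ_[p]) : (OfNat.ofNat a * f : Polynomial ℤ_[p]).natDegree ≤ f.natDegree := by
  have : (OfNat.ofNat a : Polynomial ℤ_[p]) = Polynomial.C (OfNat.ofNat a) := (map_ofNat _ a).symm
  rw [this]; exact Polynomial.natDegree_C_mul_le _ _
lemma natDegree_p_mul (f : Polynomial ℤ_[p]) : ((p : Polynomial ℤ_[p]) * f).natDegree ≤ f.natDegree := by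
  rw [← Polynomial.C_eq_natCast]; exact Polynomial.natDegree_C_mul_le _ _

lemma Bst_deg (hp : 3 < p) : (Bst p).natDegree ≤ 4 * p - 2 := by
  have h1 := natDegree_ph hp 1 (by norm_num) (by norm_num)
  have h2 := siP_deg hp
  have h4 := p_mod3 hp
  have h5 := (eh_spec hp).1
  rw [Bst]
  have a1 : (qP p ^ p * ph p 1 + (p : Polynomial ℤ_[p]) * siP p).natDegree ≤ 2 * p - 1 := by
    apply Polynomial.natDegree_add_le_of_degree_le
    · refine (Polynomial.natDegree_mul_le_of_le (natDegree_qP_pow p) h1).trans (by omega)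
    · exact (natDegree_p_mul _).trans h2
  apply Polynomial.natDegree_add_le_of_degree_le
  · refine (natDegree_ofNat_mul 9 _).trans ?_
    apply Polynomial.natDegree_add_le_of_degree_le
    · exact (Polynomial.natDegree_pow_le_of_le 2 a1).trans (by omega)
    · rw [pow_two (p : Polynomial ℤ_[p]), mul_assoc, mul_assoc]
      refine (natDegree_ofNat_mul 2 _).trans ((natDegree_p_mul _).trans ((natDegree_p_mul _).trans ?_))
      exact (Polynomial.natDegree_pow_le_of_le 2 h2).trans (by omega)
  · rw [pow_two (p : Polynomial ℤ_[p]), mul_assoc, mul_assoc]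
    refine (natDegree_ofNat_mul 2 _).trans ((natDegree_p_mul _).trans ((natDegree_p_mul _).trans ?_))
    have a2 : (1 - Polynomial.X ^ p : Polynomial ℤ_[p]).natDegree ≤ p := by compute_degree
    refine (Polynomial.natDegree_mul_le_of_le (Polynomial.natDegree_mul_le_of_le h5 a2) (natDegree_qP_pow p)).trans (by omega)

lemma WhS_Bst (hp : 3 < p) : (p : ℤ_[p]⟦X⟧) ^ 3 ∣ qS p ^ (4 * p) * WhS p - (Bst p : ℤ_[p]⟦X⟧) := by
  have hv : qhS p = qS p ^ p + (p : ℤ_[p]⟦X⟧) * (sP p : ℤ_[p]⟦X⟧) := by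
    have := congrArg (fun f : Polynomial ℤ_[p] => (f : ℤ_[p]⟦X⟧)) (sP_spec hp).1
    simp only [Polynomial.coe_sub, Polynomial.coe_mul, coe_p1, Polynomial.coe_pow, coe_qP, coe_qhP] at this
    rw [← this]; ring
  have hW := WhS_mul hp
  have hq := hQh hp
  suffices h : (p : ℤ_[p]⟦X⟧) ^ 3 ∣ qhS p ^ 4 * (qS p ^ (4 * p) * WhS p - (Bst p : ℤ_[p]⟦X⟧)) by
    have e : qS p ^ (4 * p) * WhS p - (Bst p : ℤ_[p]⟦X⟧) = QhS p ^ 4 * (qhS p ^ 4 * (qS p ^ (4 * p) * WhS p - (Bst p : ℤ_[p]⟦X⟧))) := by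
      have h4 : QhS p ^ 4 * qhS p ^ 4 = 1 := by rw [← mul_pow, mul_comm, hq, one_pow]
      linear_combination -(qS p ^ (4 * p) * WhS p - (Bst p : ℤ_[p]⟦X⟧)) * h4
    rw [e]; exact h.mul_left _
  have hr1 : red p (qhS p) = red p (qS p ^ p) := by rw [hv, map_add, map_mul, red_p]; ring
  have hr2 := red_qh hp
  have hsi := coe_si (p := p)
  have e1 : qhS p ^ 4 * (qS p ^ (4 * p) * WhS p - (Bst p : ℤ_[p]⟦X⟧)) = (p : ℤ_[p]⟦X⟧) ^ 2 *
    (9 * ((sP p : ℤ_[p]⟦X⟧) * ((sP p : ℤ_[p]⟦X⟧) * φS p 1 * qhS p - χS p * (qS p ^ p + qhS p))) * ((qS p ^ p) ^ 2 * (qhS p * φS p 1 + (p : ℤ_[p]⟦X⟧) * χS p) + qhS p ^ 2 * (qS p ^ p * φS p 1 + (p : ℤ_[p]⟦X⟧) * siS p))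
      + 18 * ((qS p ^ p) ^ 4 * χS p ^ 2 - qhS p ^ 4 * siS p ^ 2) + eS p * ((qS p ^ p) ^ 4 * (3 - qhS p) * qhS p - 2 * qhS p ^ 4 * (1 - X ^ p) * qS p ^ p)) := by
    rw [BrS] at hW
    rw [coe_Bst, mul_comm 4 p, pow_mul, hsi]
    rw [hv] at hW ⊢
    linear_combination (qS p ^ p) ^ 4 * hW
  rw [e1, pow_succ]
  apply mul_dvd_mul_left
  rw [← red_eq_zero]
  have hr3 : red p (3 - qhS p) = 2 * (1 - X ^ p) := by rw [map_sub, hr2, red_3]; ring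
  have hr4 : red p (siS p) = red p (χS p) - red p (sP p : ℤ_[p]⟦X⟧) * red p (φS p 1) := by rw [hsi, map_sub, map_mul]
  have r9 : red p 9 = 9 := map_ofNat _ 9
  have r18 : red p 18 = 18 := map_ofNat _ 18
  rw [map_add, map_add, map_mul _ (eS p), map_sub _ (_ * _ * _), map_mul _ (_ * (3 - qhS p)), map_mul _ _ (3 - qhS p), hr3]
  simp only [map_add, map_mul, map_sub, map_pow _ _ 4, map_pow _ _ 2, hr1, hr4, red_p, red_2, red_1, r9, r18, map_pow _ X p, red_X]
  ring

end stages
end S8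

namespace S8
open PowerSeries
section stages2
variable {p : ℕ} [Fact p.Prime]

lemma qpow_split (a b : ℕ) : qS p ^ ((a + b) * p) = qS p ^ (a * p) * qS p ^ (b * p) := by rw [add_mul, pow_add]

variable (p) in
noncomputable def P0 : Polynomial ℤ_[p] := 9 * NP p ((p + 2) / 3) (2 * p) - 9 * (ph p 1 * ph p 1)
variable (p) in
noncomputable def P1 : Polynomial ℤ_[p] := 9 * NP p ((p + 1) / 2) (3 * p) - 9 * (qP p ^ p * ph p 1 * ph p 1) - 18 * ((p : Polynomial ℤ_[p]) * (ph p 1 * siP p))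
variable (p) in
noncomputable def P2 : Polynomial ℤ_[p] := 9 * NP p ((2 * p + 2) / 3) (4 * p) - Bst p

lemma coe_18 : (Polynomial.toPowerSeries (18 : Polynomial ℤ_[p])) = 18 := map_ofNat (Polynomial.coeToPowerSeries.ringHom (R := ℤ_[p])) 18

lemma P0_spec (hp : 3 < p) : (p : ℤ_[p]⟦X⟧) ^ 1 ∣ (P0 p : ℤ_[p]⟦X⟧) - qS p ^ (2 * p) * Om p := by
  have h1 := NP_spec (p := p) ((p + 2) / 3) (2 * p) 1 (by omega) (by omega) (by omega) (by
    intro k hk hkp; rw [pow_one]; exact AA_dvd1 hp hkp (by omega))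
  have h2 : (p : ℤ_[p]⟦X⟧) ^ 1 ∣ qS p ^ (2 * p) * WhS p - 9 * (φS p 1 * φS p 1) := by
    apply dvd_q _ _ (2 * p)
    obtain ⟨g, hg⟩ := WhS_Bst hp
    rw [coe_Bst, show 4 * p = (2 + 2) * p by ring, qpow_split, show 2 * p = p + p by ring, pow_add] at hg
    rw [show 2 * p = p + p by ring, pow_add, pow_one]
    refine ⟨(p : ℤ_[p]⟦X⟧) ^ 2 * g + 18 * qS p ^ p * φS p 1 * siS p + 27 * (p : ℤ_[p]⟦X⟧) * siS p ^ 2 + 2 * (p : ℤ_[p]⟦X⟧) * (eS p * (1 - X ^ p) * qS p ^ p), ?_⟩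
    linear_combination hg
  have e : (P0 p : ℤ_[p]⟦X⟧) - qS p ^ (2 * p) * Om p = (9 * (NP p ((p + 2) / 3) (2 * p) : ℤ_[p]⟦X⟧) - qS p ^ (2 * p) * WS p) +
      (qS p ^ (2 * p) * WhS p - 9 * (φS p 1 * φS p 1)) := by
    rw [P0, Polynomial.coe_sub, Polynomial.coe_mul, Polynomial.coe_mul, Polynomial.coe_mul, coe_9, Om]; ring
  rw [e]; exact dvd_add h1 h2

lemma P1_spec (hp : 3 < p) : (p : ℤ_[p]⟦X⟧) ^ 2 ∣ (P1 p : ℤ_[p]⟦X⟧) - qS p ^ (3 * p) * Om p := by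
  have ho := p_odd hp
  have h1 := NP_spec (p := p) ((p + 1) / 2) (3 * p) 2 (by omega) (by omega) (by omega) (by
    intro k hk hkp; exact AA_dvd2 hp hkp (by omega))
  have h2 : (p : ℤ_[p]⟦X⟧) ^ 2 ∣ qS p ^ (3 * p) * WhS p - 9 * (qS p ^ p * φS p 1 * φS p 1) - 18 * ((p : ℤ_[p]⟦X⟧) * (φS p 1 * siS p)) := by
    apply dvd_q _ _ p
    obtain ⟨g, hg⟩ := WhS_Bst hp
    rw [coe_Bst, show 4 * p = (1 + 3) * p by ring, qpow_split, one_mul] at hg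
    refine ⟨(p : ℤ_[p]⟦X⟧) * g + 27 * siS p ^ 2 + 2 * (eS p * (1 - X ^ p) * qS p ^ p), ?_⟩
    linear_combination hg
  have e : (P1 p : ℤ_[p]⟦X⟧) - qS p ^ (3 * p) * Om p = (9 * (NP p ((p + 1) / 2) (3 * p) : ℤ_[p]⟦X⟧) - qS p ^ (3 * p) * WS p) +
      (qS p ^ (3 * p) * WhS p - 9 * (qS p ^ p * φS p 1 * φS p 1) - 18 * ((p : ℤ_[p]⟦X⟧) * (φS p 1 * siS p))) := by
    rw [P1]
    simp only [Polynomial.coe_sub, Polynomial.coe_mul, Polynomial.coe_pow, coe_9, coe_18, coe_p1, coe_qP, Om]; ring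
  rw [e]; exact dvd_add h1 h2

lemma P2_spec (hp : 3 < p) : (p : ℤ_[p]⟦X⟧) ^ 3 ∣ (P2 p : ℤ_[p]⟦X⟧) - qS p ^ (4 * p) * Om p := by
  have h1 := NP_spec (p := p) ((2 * p + 2) / 3) (4 * p) 3 (by omega) (by omega) (by omega) (by
    intro k hk hkp; exact AA_dvd3 hp hkp (by omega))
  have e : (P2 p : ℤ_[p]⟦X⟧) - qS p ^ (4 * p) * Om p = (9 * (NP p ((2 * p + 2) / 3) (4 * p) : ℤ_[p]⟦X⟧) - qS p ^ (4 * p) * WS p) +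
      (qS p ^ (4 * p) * WhS p - (Bst p : ℤ_[p]⟦X⟧)) := by
    rw [P2, Polynomial.coe_sub, Polynomial.coe_mul, coe_9, Om]; ring
  rw [e]; exact dvd_add h1 (WhS_Bst hp)

lemma P0_deg (hp : 3 < p) : (P0 p).natDegree ≤ 3 * p - 2 := by
  have h1 := natDegree_ph hp 1 (by norm_num) (by norm_num)
  apply (Polynomial.natDegree_sub_le _ _).trans
  apply max_le
  · exact (natDegree_ofNat_mul 9 _).trans ((natDegree_NP _ _ (by omega) (by omega)).trans (by omega))
  · exact (natDegree_ofNat_mul 9 _).trans ((Polynomial.natDegree_mul_le_of_le h1 h1).trans (by omega))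

lemma P1_deg (hp : 3 < p) : (P1 p).natDegree ≤ 3 * p - 2 := by
  have h1 := natDegree_ph hp 1 (by norm_num) (by norm_num)
  have h4 := p_mod3 hp
  have ho := p_odd hp
  apply (Polynomial.natDegree_sub_le _ _).trans
  apply max_le
  · apply (Polynomial.natDegree_sub_le _ _).trans
    apply max_le
    · exact (natDegree_ofNat_mul 9 _).trans ((natDegree_NP _ _ (by omega) (by omega)).trans (by omega))
    · exact (natDegree_ofNat_mul 9 _).trans ((Polynomial.natDegree_mul_le_of_le (Polynomial.natDegree_mul_le_of_le (natDegree_qP_pow p) h1) h1).trans (by omega))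
  · exact (natDegree_ofNat_mul 18 _).trans ((natDegree_p_mul _).trans ((Polynomial.natDegree_mul_le_of_le h1 (siP_deg hp)).trans (by omega)))

lemma P2_deg (hp : 3 < p) : (P2 p).natDegree ≤ 4 * p - 2 := by
  apply (Polynomial.natDegree_sub_le _ _).trans
  apply max_le
  · exact (natDegree_ofNat_mul 9 _).trans ((natDegree_NP _ _ (by omega) (by omega)).trans (by omega))
  · exact Bst_deg hp

lemma Om_dvd1 (hp : 3 < p) : (p : ℤ_[p]⟦X⟧) ^ 1 ∣ Om p :=
  stage_small hp 0 (by norm_num) 2 (P0 p) (P0_deg hp) (by simp) (P0_spec hp)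
lemma Om_dvd2 (hp : 3 < p) : (p : ℤ_[p]⟦X⟧) ^ 2 ∣ Om p :=
  stage_small hp 1 (by norm_num) 3 (P1 p) (P1_deg hp) (Om_dvd1 hp) (P1_spec hp)

lemma P0_dvd (hp : 3 < p) : ∃ R, P0 p = (p : Polynomial ℤ_[p]) ^ 1 * R := by
  obtain ⟨R, h, -⟩ := poly_dvd (P0 p) 1 (by
    have := dvd_add (P0_spec hp) ((Om_dvd1 hp).mul_left (qS p ^ (2 * p))); simpa using this)
  exact ⟨R, h⟩
lemma P1_dvd (hp : 3 < p) : ∃ R, P1 p = (p : Polynomial ℤ_[p]) ^ 2 * R := by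
  obtain ⟨R, h, -⟩ := poly_dvd (P1 p) 2 (by
    have := dvd_add (P1_spec hp) ((Om_dvd2 hp).mul_left (qS p ^ (3 * p))); simpa using this)
  exact ⟨R, h⟩

variable (p) in
noncomputable def x0 : ℤ_[p] := -Ring.inverse 2
lemma x0_2 (hp : 3 < p) : 1 + 2 * x0 p = 0 := by
  rw [x0]; linear_combination -Ring.mul_inverse_cancel _ (isUnit_two hp)

lemma ev_qP (hp : 3 < p) : (qP p).eval (x0 p) = 0 := by
  rw [qP]; simpa using x0_2 hp

lemma NP_ev_zero (hp : 3 < p) (B E : ℕ) (h : 6 * B < E + 4) : (NP p B E).eval (x0 p) = 0 := by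
  rw [NP, Polynomial.eval_finsetSum]
  apply Finset.sum_eq_zero
  intro k hk
  rw [Finset.mem_range] at hk
  rw [Polynomial.eval_mul, Polynomial.eval_mul, Polynomial.eval_pow, ev_qP hp, zero_pow (by omega)]
  simp

lemma NP_ev_unit (hp : 3 < p) (h1 : p % 3 = 1) : PadicInt.toZMod ((NP p ((p + 2) / 3) (2 * p)).eval (x0 p)) ≠ 0 := by
  have hB : (p + 2) / 3 = (p - 1) / 3 + 1 := by omega
  have hx := congrArg (PadicInt.toZMod (p := p)) (x0_2 hp)
  simp only [map_add, map_mul, map_one, map_zero, z_2] at hx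
  rw [NP, Polynomial.eval_finsetSum, hB, Finset.sum_range_succ, Finset.sum_eq_zero, zero_add]
  · rw [show 2 * p - 2 - 6 * ((p - 1) / 3) = 0 by omega, pow_zero, moP, Polynomial.eval_mul, Polynomial.eval_C, AA]
    generalize hm : (p - 1) / 3 = m
    have hm' : 3 * m + 1 = p := by omega
    simp only [Polynomial.eval_mul, Polynomial.eval_C, Polynomial.eval_pow, Polynomial.eval_sub, Polynomial.eval_one, Polynomial.eval_X, map_mul, map_pow,
      map_sub, map_one, mul_one, map_natCast, z_36]
    have hch : ∀ n k : ℕ, n < p → k ≤ n → ((n.choose k : ℕ) : ZMod p) ≠ 0 := by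
      intro n k hn hk h0
      rw [ZMod.natCast_eq_zero_iff] at h0
      have h2 : p ∣ n.factorial := by
        rw [← Nat.choose_mul_factorial_mul_factorial hk, mul_assoc]; exact h0.mul_right _
      exact absurd (((Fact.out : p.Prime).dvd_factorial).1 h2) (by omega)
    have h2 := two_ne_zmod hp
    have h3 := three_ne_zmod hp
    have h108 := congrArg (PadicInt.toZMod (p := p)) (Ring.mul_inverse_cancel _ (isUnit_108 hp))
    rw [map_mul, map_one] at h108
    have hx0 : PadicInt.toZMod (x0 p) ≠ 0 := by
      intro h; rw [h] at hx; simp at hx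
    have hx1 : 1 - PadicInt.toZMod (x0 p) ≠ 0 := by
      intro h; apply h3; linear_combination hx + 2 * h
    have hx3 : 1 - PadicInt.toZMod (x0 p) ^ 3 ≠ 0 := by
      intro h
      have : (3 : ZMod p) ^ 2 = 0 := by
        generalize PadicInt.toZMod (x0 p) = x at *
        linear_combination 8 * h + (1 - 2 * x + 4 * x ^ 2) * hx
      exact h3 (by simpa using this)
    have h36 : (36 : ZMod p) ≠ 0 := by
      have : (36 : ZMod p) = (2 * 3) ^ 2 := by norm_num
      rw [this]; exact pow_ne_zero _ (mul_ne_zero h2 h3)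
    refine mul_ne_zero (mul_ne_zero (pow_ne_zero _ h36) (mul_ne_zero (mul_ne_zero (pow_ne_zero _ (hch _ _ (by omega) (by omega))) (hch _ _ (by omega) (by omega)))
      (pow_ne_zero _ (right_ne_zero_of_mul_eq_one h108))))
      (mul_ne_zero (mul_ne_zero (pow_ne_zero _ hx0) (pow_ne_zero _ hx1)) (pow_ne_zero _ hx3))
  · intro k hk
    rw [Finset.mem_range] at hk
    rw [Polynomial.eval_mul, Polynomial.eval_mul, Polynomial.eval_pow, ev_qP hp, zero_pow (by omega)]
    simp

lemma ev_9 : Polynomial.eval (x0 p) (9 : Polynomial ℤ_[p]) = 9 := Polynomial.eval_ofNat 9 _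
lemma ev_18 : Polynomial.eval (x0 p) (18 : Polynomial ℤ_[p]) = 18 := Polynomial.eval_ofNat 18 _
lemma ev_2 : Polynomial.eval (x0 p) (2 : Polynomial ℤ_[p]) = 2 := Polynomial.eval_ofNat 2 _
lemma ev_p : Polynomial.eval (x0 p) (p : Polynomial ℤ_[p]) = p := Polynomial.eval_natCast
lemma zz_p : PadicInt.toZMod (p := p) (p : ℤ_[p]) = 0 := by simp

lemma Om_dvd3 (hp : 3 < p) (h1 : p % 3 = 1) : (p : ℤ_[p]⟦X⟧) ^ 3 ∣ Om p := by
  obtain ⟨R, hR, -, ⟨c, hc⟩, h0⟩ := stage hp 2 le_rfl 4 (P2 p) (P2_deg hp) (Om_dvd2 hp) (P2_spec hp)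
  apply h0
  have h9 : (9 : ZMod p) ≠ 0 := by
    have : (9 : ZMod p) = 3 ^ 2 := by norm_num
    rw [this]; exact pow_ne_zero _ (three_ne_zmod hp)
  have ho := p_odd hp
  have hpe : p ≠ 0 := by omega
  -- stage 0
  have hφ : PadicInt.toZMod ((ph p 1).eval (x0 p)) ≠ 0 := by
    intro h
    obtain ⟨S, hS⟩ := P0_dvd hp
    have e := congrArg (fun f => PadicInt.toZMod (Polynomial.eval (x0 p) f)) hS
    rw [P0] at e
    simp only [Polynomial.eval_mul, Polynomial.eval_sub, Polynomial.eval_pow, ev_9, ev_p, map_mul, map_sub, h, zz_p, map_pow, zero_pow one_ne_zero] at e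
    have n9 : PadicInt.toZMod (p := p) 9 = 9 := map_ofNat _ 9
    rw [n9] at e
    have e2 : (9 : ZMod p) * PadicInt.toZMod ((NP p ((p + 2) / 3) (2 * p)).eval (x0 p)) = 0 := by linear_combination e
    exact NP_ev_unit hp h1 ((mul_eq_zero.1 e2).resolve_left h9)
  have hσ : PadicInt.toZMod ((siP p).eval (x0 p)) = 0 := by
    obtain ⟨S, hS⟩ := P1_dvd hp
    have e := congrArg (fun f => (Polynomial.eval (x0 p) f)) hS
    rw [P1] at e
    simp only [Polynomial.eval_mul, Polynomial.eval_sub, Polynomial.eval_pow, ev_9, ev_18, ev_p, ev_qP hp, NP_ev_zero hp ((p + 1) / 2) (3 * p) (by omega), zero_pow hpe] at e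
    have e2 : (p : ℤ_[p]) * (-18 * (Polynomial.eval (x0 p) (ph p 1) * Polynomial.eval (x0 p) (siP p))) = p * (p * Polynomial.eval (x0 p) S) := by linear_combination e
    have e3 := congrArg (PadicInt.toZMod (p := p)) (mul_left_cancel₀ pZ_ne e2)
    have n18 : PadicInt.toZMod (p := p) 18 = 18 := map_ofNat _ 18
    simp only [map_mul, map_neg, zz_p, n18] at e3
    have e4 : (2 * 9 : ZMod p) * (PadicInt.toZMod (Polynomial.eval (x0 p) (ph p 1)) * PadicInt.toZMod (Polynomial.eval (x0 p) (siP p))) = 0 := by linear_combination -e3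
    have e5 := (mul_eq_zero.1 e4).resolve_left (mul_ne_zero (two_ne_zmod hp) h9)
    exact (mul_eq_zero.1 e5).resolve_left hφ
  have hR0 : PadicInt.toZMod (R.eval (x0 p)) = 0 := by
    have e := congrArg (fun f => (Polynomial.eval (x0 p) f)) hR
    rw [P2, Bst] at e
    simp only [Polynomial.eval_mul, Polynomial.eval_sub, Polynomial.eval_add, Polynomial.eval_pow, ev_9, ev_2, ev_p, ev_qP hp, NP_ev_zero hp ((2 * p + 2) / 3) (4 * p) (by omega), zero_pow hpe] at e
    have e2 : (p : ℤ_[p]) ^ 2 * (-27 * Polynomial.eval (x0 p) (siP p) ^ 2) = p ^ 2 * Polynomial.eval (x0 p) R := by linear_combination e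
    rw [← mul_left_cancel₀ (pow_ne_zero 2 pZ_ne) e2, map_mul, map_pow, hσ]; simp
  have e6 := congrArg (Polynomial.eval (PadicInt.toZMod (x0 p))) hc
  rw [Polynomial.eval_map_apply, hR0, Polynomial.eval_mul, Polynomial.eval_mul, Polynomial.eval_C, Polynomial.eval_pow, Polynomial.eval_X, Polynomial.eval_mul, gp, Polynomial.eval_map_apply] at e6
  have hx := congrArg (PadicInt.toZMod (p := p)) (x0_2 hp)
  simp only [map_add, map_mul, map_one, map_zero, z_2] at hx
  have hx0 : PadicInt.toZMod (x0 p) ≠ 0 := by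
    intro h; rw [h] at hx; simp at hx
  have hc0 : c = 0 := by
    rcases mul_eq_zero.1 e6.symm with h | h
    · exact (mul_eq_zero.1 h).resolve_right (pow_ne_zero _ hx0)
    · exact absurd h (mul_ne_zero hφ hφ)
  rw [hc, hc0]; simp

end stages2
end S8

namespace S8
open Polynomial
section read
variable {p : ℕ} [Fact p.Prime]
lemma reflect_pow' (f : Polynomial ℤ_[p]) (d n : ℕ) (h : f.natDegree ≤ d) : reflect (n * d) (f ^ n) = (reflect d f) ^ n := by
  induction n with
  | zero => rw [zero_mul, pow_zero, pow_zero, reflect_one, pow_zero]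
  | succ n ih =>
    rw [pow_succ, pow_succ, add_mul, one_mul, reflect_mul _ _ (natDegree_pow_le_of_le n h) h, ih]

lemma refl_qP : reflect 1 (qP p) = 2 + X := by
  have : qP p = C 1 * X ^ 0 + C 2 * X ^ 1 := by rw [qP, show C (2 : ℤ_[p]) = 2 from map_ofNat _ 2]; simp
  rw [this, reflect_add, reflect_C_mul_X_pow, reflect_C_mul_X_pow, revAt_le (by norm_num), revAt_le (by norm_num), show C (2 : ℤ_[p]) = 2 from map_ofNat _ 2]
  simp; ring

lemma refl_qhP : reflect p (qhP p) = C (2 * kap p) + X ^ p := by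
  have : qhP p = C 1 * X ^ 0 + C (2 * kap p) * X ^ p := by rw [qhP, C_mul, show C (2 : ℤ_[p]) = 2 from map_ofNat _ 2]; simp; ring
  rw [this, reflect_add, reflect_C_mul_X_pow, reflect_C_mul_X_pow, revAt_le (by omega), revAt_le (by omega)]
  simp; ring

lemma refl_moP (k : ℕ) : reflect (6 * k) (moP p k) = (X - 1) ^ (2 * k) * (X ^ 3 - 1) ^ k := by
  have h1 : (1 - X : Polynomial ℤ_[p]).natDegree ≤ 1 := by compute_degree
  have h2 : (1 - X ^ 3 : Polynomial ℤ_[p]).natDegree ≤ 3 := by compute_degree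
  have e1 : reflect 1 (1 - X : Polynomial ℤ_[p]) = X - 1 := by
    have : (1 - X : Polynomial ℤ_[p]) = C 1 * X ^ 0 + C (-1) * X ^ 1 := by simp; ring
    rw [this, reflect_add, reflect_C_mul_X_pow, reflect_C_mul_X_pow, revAt_le (by omega), revAt_le (by omega)]
    simp; ring
  have e2 : reflect 3 (1 - X ^ 3 : Polynomial ℤ_[p]) = X ^ 3 - 1 := by
    have : (1 - X ^ 3 : Polynomial ℤ_[p]) = C 1 * X ^ 0 + C (-1) * X ^ 3 := by simp; ring
    rw [this, reflect_add, reflect_C_mul_X_pow, reflect_C_mul_X_pow, revAt_le (by omega), revAt_le (by omega)]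
    simp; ring
  rw [moP, show 6 * k = (k + 2 * k * 1) + k * 3 by ring, reflect_mul _ _ _ (natDegree_pow_le_of_le k h2), reflect_mul _ _ (natDegree_X_pow_le k) (natDegree_pow_le_of_le (2 * k) h1),
    reflect_pow' _ _ _ h1, reflect_pow' _ _ _ h2, e1, e2, reflect_monomial, revAt_le le_rfl]
  · simp
  · exact natDegree_mul_le_of_le (natDegree_X_pow_le k) (natDegree_pow_le_of_le (2 * k) h1)

lemma reflect_sum' (N : ℕ) (s : Finset ℕ) (f : ℕ → Polynomial ℤ_[p]) : reflect N (∑ k ∈ s, f k) = ∑ k ∈ s, reflect N (f k) := by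
  ext n; simp [coeff_reflect, Polynomial.finsetSum_coeff]

lemma refl_NP (B E : ℕ) (hB : 6 * B ≤ E + 4) :
    reflect (E - 2) (NP p B E) = ∑ k ∈ Finset.range B, C (36 ^ k * AA p k) * ((X - 1) ^ (2 * k) * (X ^ 3 - 1) ^ k * (2 + X) ^ (E - 2 - 6 * k)) := by
  rw [NP, reflect_sum']
  apply Finset.sum_congr rfl
  intro k hk
  rw [Finset.mem_range] at hk
  rw [reflect_C_mul]
  congr 1
  have h1 : E - 2 = 6 * k + (E - 2 - 6 * k) * 1 := by omega
  have hq : (qP p).natDegree ≤ 1 := by rw [qP]; compute_degree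
  have h2 : reflect (E - 2) (moP p k * qP p ^ (E - 2 - 6 * k)) = reflect (6 * k + (E - 2 - 6 * k) * 1) (moP p k * qP p ^ (E - 2 - 6 * k)) := by rw [← h1]
  rw [h2, reflect_mul _ _ (natDegree_moP k) (natDegree_pow_le_of_le _ hq), refl_moP, reflect_pow' _ _ _ hq, refl_qP]

end read
end S8

namespace S8
open PowerSeries
section read
variable {p : ℕ} [Fact p.Prime]
/-- low order divisibility -/
def Low (r : ℕ) (F : ℤ_[p]⟦X⟧) : Prop := ∀ n, n < 3 → (p : ℤ_[p]) ^ r ∣ coeff n F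
lemma Low.add {r : ℕ} {F G : ℤ_[p]⟦X⟧} (h1 : Low r F) (h2 : Low r G) : Low r (F + G) := fun n hn => by
  rw [map_add]; exact dvd_add (h1 n hn) (h2 n hn)
lemma Low.mul {r : ℕ} {F : ℤ_[p]⟦X⟧} (h1 : Low r F) (G : ℤ_[p]⟦X⟧) : Low r (G * F) := fun n hn => by
  rw [coeff_mul]
  apply Finset.dvd_sum
  rintro ⟨i, j⟩ hij
  rw [Finset.HasAntidiagonal.mem_antidiagonal] at hij
  exact (h1 j (by simp only at hij; omega)).mul_left _
lemma Low.X {r : ℕ} (m : ℕ) (hm : 3 ≤ m) (G : ℤ_[p]⟦X⟧) : Low r (PowerSeries.X ^ m * G) := fun n hn => by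
  rw [coeff_X_pow_mul', if_neg (by omega)]; exact dvd_zero _
lemma Low.cancel {r : ℕ} {F G V : ℤ_[p]⟦X⟧} (hV : V * G = 1) (h : Low r (G * F)) : Low r F := by
  have : F = V * (G * F) := by rw [← mul_assoc, hV, one_mul]
  rw [this]; exact h.mul _
lemma Low.of_dvd {r : ℕ} {F : ℤ_[p]⟦X⟧} (h : (p : ℤ_[p]⟦X⟧) ^ r ∣ F) : Low r F := fun n _ => (dvd_coeff_iff _ _).1 h n

variable (p) in
noncomputable def ak (k : ℕ) : ℤ_[p]⟦X⟧ := 4 - 4 * (5 * (k : ℤ_[p]⟦X⟧) + 1) * X + (50 * (k : ℤ_[p]⟦X⟧) ^ 2 + 19 * (k : ℤ_[p]⟦X⟧) + 3) * X ^ 2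

lemma ak_spec (k : ℕ) : ∃ g : ℤ_[p]⟦X⟧, 4 * (1 - X) ^ (2 * k) * 2 ^ (2 + 6 * k) - (2 + X) ^ (2 + 6 * k) * ak p k = X ^ 3 * g := by
  induction k with
  | zero => exact ⟨-(8 + 3 * X), by simp [ak]; ring⟩
  | succ k ih =>
    obtain ⟨g, hg⟩ := ih
    refine ⟨64 * (1 - X) ^ 2 * g + (2 + X) ^ (2 + 6 * k) * (-(9344 + 21760 * (k : ℤ_[p]⟦X⟧) + 16000 * (k : ℤ_[p]⟦X⟧) ^ 2) - (13488 + 24144 * (k : ℤ_[p]⟦X⟧) + 8800 * (k : ℤ_[p]⟦X⟧) ^ 2) * X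
      - (10128 + 17840 * (k : ℤ_[p]⟦X⟧) + 8000 * (k : ℤ_[p]⟦X⟧) ^ 2) * X ^ 2 - (4036 + 6900 * (k : ℤ_[p]⟦X⟧) + 3000 * (k : ℤ_[p]⟦X⟧) ^ 2) * X ^ 3
      - (840 + 1408 * (k : ℤ_[p]⟦X⟧) + 600 * (k : ℤ_[p]⟦X⟧) ^ 2) * X ^ 4 - (72 + 119 * (k : ℤ_[p]⟦X⟧) + 50 * (k : ℤ_[p]⟦X⟧) ^ 2) * X ^ 5), ?_⟩
    have e1 : (2 + X : ℤ_[p]⟦X⟧) ^ (2 + 6 * (k + 1)) = (2 + X) ^ (2 + 6 * k) * (2 + X) ^ 6 := by rw [← pow_add]; congr 1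
    have e2 : (2 : ℤ_[p]⟦X⟧) ^ (2 + 6 * (k + 1)) = 2 ^ (2 + 6 * k) * 64 := by rw [show (64 : ℤ_[p]⟦X⟧) = 2 ^ 6 by norm_num, ← pow_add]; congr 1
    have e3 : (1 - X : ℤ_[p]⟦X⟧) ^ (2 * (k + 1)) = (1 - X) ^ (2 * k) * (1 - X) ^ 2 := by rw [← pow_add]; congr 1
    rw [e1, e2, e3]
    rw [ak] at hg ⊢
    push_cast
    generalize (2 + X : ℤ_[p]⟦X⟧) ^ (2 + 6 * k) = U at *
    generalize (2 : ℤ_[p]⟦X⟧) ^ (2 + 6 * k) = V at *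
    generalize (1 - X : ℤ_[p]⟦X⟧) ^ (2 * k) = W at *
    linear_combination 64 * (1 - X) ^ 2 * hg
end read
end S8

namespace S8
open PowerSeries
section read2
variable {p : ℕ} [Fact p.Prime]

variable (p) in
noncomputable def c2 (i j n : ℕ) : ℤ_[p] := coeff n (φS p i * φS p j)

lemma BrS_coeff (hp : 3 < p) (n : ℕ) (hn : 3 * p ≤ n) :
    coeff n (BrS p) = 54 * c2 p 1 1 n - 72 * c2 p 1 2 n + 27 * c2 p 2 2 n + (72 * kap p * c2 p 1 1 (n - p) - 36 * kap p * c2 p 1 2 (n - p))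
      + 36 * kap p ^ 2 * c2 p 1 1 (n - 2 * p) := by
  have he : ∀ m, p ≤ m → coeff m (eS p) = 0 := fun m hm => by
    rw [Polynomial.coeff_coe]; exact Polynomial.coeff_eq_zero_of_natDegree_lt (by have := (eh_spec hp).1; omega)
  have e : BrS p = C 54 * (φS p 1 * φS p 1) - C 72 * (φS p 1 * φS p 2) + C 27 * (φS p 2 * φS p 2) + C (2 * (p : ℤ_[p]) ^ 2) * eS p
    + X ^ p * (C (72 * kap p) * (φS p 1 * φS p 1) - C (36 * kap p) * (φS p 1 * φS p 2) + C (2 * (p : ℤ_[p]) ^ 2 * kap p) * eS p)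
    + X ^ (2 * p) * (C (36 * kap p ^ 2) * (φS p 1 * φS p 1) - C (4 * (p : ℤ_[p]) ^ 2 * kap p ^ 2) * eS p) := by
    rw [BrS_eq hp]
    simp only [map_mul, map_pow, map_natCast, show C (R := ℤ_[p]) 54 = 54 from map_ofNat _ 54, show C (R := ℤ_[p]) 72 = 72 from map_ofNat _ 72,
      show C (R := ℤ_[p]) 27 = 27 from map_ofNat _ 27, show C (R := ℤ_[p]) 2 = 2 from map_ofNat _ 2, show C (R := ℤ_[p]) 36 = 36 from map_ofNat _ 36,
      show C (R := ℤ_[p]) 4 = 4 from map_ofNat _ 4]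
    ring
  rw [e]
  simp only [map_add, map_sub, coeff_C_mul, coeff_X_pow_mul']
  rw [if_pos (by omega), if_pos (by omega), he _ (by omega), he _ (by omega), he _ (by omega)]
  simp only [c2, map_add, map_sub, coeff_C_mul]
  ring

lemma c2_3 (i j n : ℕ) (hn : n % 3 ≠ 0) : c2 p i j n = 0 := coeff_mul3 (φS p i) (φS p j) (φS_3 i) (φS_3 j) n hn

lemma c2_poly (i j n : ℕ) : c2 p i j n = (ph p i * ph p j).coeff n := by
  rw [c2, ← Polynomial.coeff_coe, Polynomial.coe_mul]

lemma c2_gt (hp : 3 < p) (i j n : ℕ) (hi : 0 < i) (hi' : i < 3) (hj : 0 < j) (hj' : j < 3) (hn : 3 * (i * p / 3) + 3 * (j * p / 3) < n) : c2 p i j n = 0 := by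
  rw [c2_poly]
  apply Polynomial.coeff_eq_zero_of_natDegree_lt
  exact lt_of_le_of_lt (Polynomial.natDegree_mul_le_of_le (natDegree_ph hp i hi hi') (natDegree_ph hp j hj hj')) hn

variable (p) in
noncomputable def TT (j : ℕ) : ℤ_[p] := cc ((j : ℤ_[p]) * (p : ℤ_[p])) (j * p / 3)

lemma c2_top (hp : 3 < p) (i j n : ℕ) (hi : 0 < i) (hi' : i < 3) (hj : 0 < j) (hj' : j < 3) (hn : n = 3 * (i * p / 3) + 3 * (j * p / 3)) : c2 p i j n = TT p i * TT p j := by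
  have hi2 : i * p ≤ 2 * p := Nat.mul_le_mul_right _ (by omega)
  have hj2 : j * p ≤ 2 * p := Nat.mul_le_mul_right _ (by omega)
  rw [c2_poly, hn, Polynomial.coeff_mul_add_eq_of_natDegree_le (natDegree_ph hp i hi hi') (natDegree_ph hp j hj hj'), coeff_ph, coeff_ph, if_pos (by omega), if_pos (by omega),
    Nat.mul_div_cancel_left _ (by norm_num), Nat.mul_div_cancel_left _ (by norm_num), TT, TT]

lemma Br_gt (hp : 3 < p) (n : ℕ) (hn : 4 * p - 2 < n) : coeff n (BrS p) = 0 := by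
  have h3 := p_mod3 hp
  rw [BrS_coeff hp n (by omega)]
  rw [c2_gt hp 1 1 n, c2_gt hp 1 2 n, c2_gt hp 2 2 n, c2_gt hp 1 1 (n - p), c2_gt hp 1 2 (n - p), c2_gt hp 1 1 (n - 2 * p)] <;> first | omega | ring

lemma Br1_0 (hp : 3 < p) (h1 : p % 3 = 1) : coeff (4 * p - 2) (BrS p) = 36 * kap p ^ 2 * TT p 1 ^ 2 := by
  rw [BrS_coeff hp _ (by omega)]
  rw [c2_gt hp 1 1 (4 * p - 2), c2_gt hp 1 2 (4 * p - 2), c2_gt hp 2 2 (4 * p - 2), c2_gt hp 1 1 (4 * p - 2 - p), c2_gt hp 1 2 (4 * p - 2 - p),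
    c2_top hp 1 1 (4 * p - 2 - 2 * p)] <;> first | omega | ring
lemma Br1_1 (hp : 3 < p) (h1 : p % 3 = 1) : coeff (4 * p - 3) (BrS p) = -(36 * kap p * TT p 1 * TT p 2) := by
  rw [BrS_coeff hp _ (by omega)]
  rw [c2_gt hp 1 1 (4 * p - 3), c2_gt hp 1 2 (4 * p - 3), c2_gt hp 2 2 (4 * p - 3), c2_gt hp 1 1 (4 * p - 3 - p), c2_top hp 1 2 (4 * p - 3 - p),
    c2_3 1 1 (4 * p - 3 - 2 * p)] <;> first | omega | ring
lemma Br1_2 (hp : 3 < p) (h1 : p % 3 = 1) : coeff (4 * p - 4) (BrS p) = 27 * TT p 2 ^ 2 := by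
  rw [BrS_coeff hp _ (by omega)]
  rw [c2_gt hp 1 1 (4 * p - 4), c2_gt hp 1 2 (4 * p - 4), c2_top hp 2 2 (4 * p - 4), c2_gt hp 1 1 (4 * p - 4 - p), c2_3 1 2 (4 * p - 4 - p),
    c2_3 1 1 (4 * p - 4 - 2 * p)] <;> first | omega | ring
lemma Br2_0 (hp : 3 < p) (h1 : p % 3 = 2) : coeff (4 * p - 2) (BrS p) = 27 * TT p 2 ^ 2 := by
  rw [BrS_coeff hp _ (by omega)]
  rw [c2_gt hp 1 1 (4 * p - 2), c2_gt hp 1 2 (4 * p - 2), c2_top hp 2 2 (4 * p - 2), c2_gt hp 1 1 (4 * p - 2 - p), c2_gt hp 1 2 (4 * p - 2 - p),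
    c2_gt hp 1 1 (4 * p - 2 - 2 * p)] <;> first | omega | ring
lemma Br2_1 (hp : 3 < p) (h1 : p % 3 = 2) : coeff (4 * p - 3) (BrS p) = -(36 * kap p * TT p 1 * TT p 2) := by
  rw [BrS_coeff hp _ (by omega)]
  rw [c2_gt hp 1 1 (4 * p - 3), c2_gt hp 1 2 (4 * p - 3), c2_3 2 2 (4 * p - 3), c2_gt hp 1 1 (4 * p - 3 - p), c2_top hp 1 2 (4 * p - 3 - p),
    c2_gt hp 1 1 (4 * p - 3 - 2 * p)] <;> first | omega | ring
lemma Br2_2 (hp : 3 < p) (h1 : p % 3 = 2) : coeff (4 * p - 4) (BrS p) = 36 * kap p ^ 2 * TT p 1 ^ 2 := by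
  rw [BrS_coeff hp _ (by omega)]
  rw [c2_gt hp 1 1 (4 * p - 4), c2_gt hp 1 2 (4 * p - 4), c2_3 2 2 (4 * p - 4), c2_gt hp 1 1 (4 * p - 4 - p), c2_3 1 2 (4 * p - 4 - p),
    c2_top hp 1 1 (4 * p - 4 - 2 * p)] <;> first | omega | ring

variable (p) in
noncomputable def BrP : Polynomial ℤ_[p] := trunc (4 * p - 1) (BrS p)
lemma BrP_coeff (hp : 3 < p) (n : ℕ) : (BrP p).coeff n = coeff n (BrS p) := by
  rw [BrP, coeff_trunc]
  split_ifs with h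
  · rfl
  · rw [Br_gt hp n (by omega)]
lemma coe_BrP (hp : 3 < p) : (BrP p : ℤ_[p]⟦X⟧) = BrS p := by
  ext n; rw [Polynomial.coeff_coe, BrP_coeff hp]
lemma BrP_deg (hp : 3 < p) : (BrP p).natDegree ≤ 4 * p - 2 := by
  rw [Polynomial.natDegree_le_iff_coeff_eq_zero]
  intro n hn
  rw [BrP_coeff hp, Br_gt hp n hn]

variable (p) in
noncomputable def fP : Polynomial ℤ_[p] := NP p ((2 * p + 2) / 3) (4 * p) * qhP p ^ 4

lemma main_dvd (hp : 3 < p) (r : ℕ) (hr : r ≤ 3) (h : (p : ℤ_[p]⟦X⟧) ^ r ∣ Om p) :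
    (p : ℤ_[p]⟦X⟧) ^ r ∣ 9 * (fP p : ℤ_[p]⟦X⟧) - ((qP p ^ (4 * p) * BrP p : Polynomial ℤ_[p]) : ℤ_[p]⟦X⟧) := by
  have h3 := p_mod3 hp
  have h1 := NP_spec (p := p) ((2 * p + 2) / 3) (4 * p) 3 (by omega) (by omega) (by omega) (fun k hk hk' => AA_dvd3 hp hk' (by omega))
  have h1' : (p : ℤ_[p]⟦X⟧) ^ r ∣ _ := (pow_dvd_pow _ hr).trans h1
  rw [fP, Polynomial.coe_mul, Polynomial.coe_mul, Polynomial.coe_pow, Polynomial.coe_pow, coe_qP, coe_qhP, coe_BrP hp, ← WhS_mul hp]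
  have e : 9 * ((NP p ((2 * p + 2) / 3) (4 * p) : ℤ_[p]⟦X⟧) * qhS p ^ 4) - qS p ^ (4 * p) * (WhS p * qhS p ^ 4) =
    (9 * (NP p ((2 * p + 2) / 3) (4 * p) : ℤ_[p]⟦X⟧) - qS p ^ (4 * p) * WS p) * qhS p ^ 4 + Om p * (qS p ^ (4 * p) * qhS p ^ 4) := by
    rw [Om]; ring
  rw [e]
  exact dvd_add (h1'.mul_right _) (h.mul_right _)

variable (p) in
noncomputable def RP : ℤ_[p]⟦X⟧ := (Polynomial.reflect (4 * p - 2) (BrP p) : ℤ_[p]⟦X⟧)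
lemma RP_coeff (hp : 3 < p) (i : ℕ) (hi : i < 3) : coeff i (RP p) = coeff (4 * p - 2 - i) (BrS p) := by
  rw [RP, Polynomial.coeff_coe, Polynomial.coeff_reflect, Polynomial.revAt_le (by omega), BrP_coeff hp]

lemma main_low (hp : 3 < p) (r : ℕ) (hr : r ≤ 3) (h : (p : ℤ_[p]⟦X⟧) ^ r ∣ Om p) :
    Low r (9 * ((Polynomial.reflect (4 * p - 2) (NP p ((2 * p + 2) / 3) (4 * p)) : ℤ_[p]⟦X⟧) * (C (2 * kap p) + X ^ p) ^ 4) - (2 + X) ^ (4 * p) * RP p) := by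
  have h1 := main_dvd hp r hr h
  rw [dvd_coeff_iff] at h1
  have hq : (qP p).natDegree ≤ 1 := by rw [qP]; compute_degree
  have hqh : (qhP p).natDegree ≤ p := by
    rw [qhP]
    refine (Polynomial.natDegree_add_le _ _).trans (max_le (by simp) ?_)
    exact (natDegree_ofNat_mul 2 _).trans (Polynomial.natDegree_C_mul_X_pow_le _ _)
  have e1 : Polynomial.reflect ((4 * p - 2) + 4 * p) (fP p) = Polynomial.reflect (4 * p - 2) (NP p ((2 * p + 2) / 3) (4 * p)) * (Polynomial.C (2 * kap p) + Polynomial.X ^ p) ^ 4 := by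
    rw [fP, Polynomial.reflect_mul _ _ (natDegree_NP _ _ (by omega) (by omega)) (Polynomial.natDegree_pow_le_of_le 4 hqh), reflect_pow' _ _ _ hqh, refl_qhP]
  have e2 : Polynomial.reflect ((4 * p - 2) + 4 * p) (qP p ^ (4 * p) * BrP p) = (2 + Polynomial.X) ^ (4 * p) * Polynomial.reflect (4 * p - 2) (BrP p) := by
    have hh : 4 * p - 2 + 4 * p = 4 * p * 1 + (4 * p - 2) := by omega
    rw [hh, Polynomial.reflect_mul _ _ (Polynomial.natDegree_pow_le_of_le _ hq) (BrP_deg hp), reflect_pow' _ _ _ hq, refl_qP]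
  have e3 := congrArg (Polynomial.toPowerSeries) e1
  have e4 := congrArg (Polynomial.toPowerSeries) e2
  rw [Polynomial.coe_mul, Polynomial.coe_pow, Polynomial.coe_add, Polynomial.coe_pow, Polynomial.coe_X, Polynomial.coe_C] at e3
  rw [Polynomial.coe_mul, Polynomial.coe_pow, Polynomial.coe_add, Polynomial.coe_X, coe_2] at e4
  rw [RP, ← e3, ← e4]
  intro n hn
  have n9 := coeff_natmul (p := p) (a := 9)
  push_cast at n9
  have := h1 ((4 * p - 2) + 4 * p - n)
  rw [map_sub, n9, Polynomial.coeff_coe, Polynomial.coeff_coe] at this ⊢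
  rw [Polynomial.coeff_reflect, Polynomial.coeff_reflect, Polynomial.revAt_le (by omega)]
  exact this
end read2
end S8

namespace S8
open PowerSeries
section read3
variable {p : ℕ} [Fact p.Prime]

variable (p) in
noncomputable def bk (k : ℕ) : ℤ_[p] := (-36) ^ k * AA p k * Ring.inverse 2 ^ (6 * k)

lemma inv2 (hp : 3 < p) : (2 : ℤ_[p]) * Ring.inverse 2 = 1 := Ring.mul_inverse_cancel _ (isUnit_two hp)

lemma term_spec (hp : 3 < p) (k : ℕ) (hk : 6 * k + 2 ≤ 4 * p) : ∃ g : ℤ_[p]⟦X⟧,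
    16 * (C (36 ^ k * AA p k) * ((X - 1) ^ (2 * k) * (X ^ 3 - 1) ^ k * (2 + X) ^ (4 * p - 2 - 6 * k))) =
      (2 + X) ^ (4 * p) * (C (bk p k) * ak p k) + X ^ 3 * g := by
  obtain ⟨g, hg⟩ := ak_spec (p := p) k
  have h1 : ∃ g1 : ℤ_[p]⟦X⟧, (X ^ 3 - 1 : ℤ_[p]⟦X⟧) ^ k = (-1) ^ k + X ^ 3 * g1 := by
    have := sub_dvd_pow_sub_pow (X ^ 3 - 1 : ℤ_[p]⟦X⟧) (-1) k
    obtain ⟨c, hc⟩ := this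
    exact ⟨c, by linear_combination hc⟩
  obtain ⟨g1, hg1⟩ := h1
  have h2 : (2 : ℤ_[p]⟦X⟧) ^ (2 + 6 * k) * C (Ring.inverse 2 ^ (2 + 6 * k)) = 1 := by
    rw [← C_2, ← map_pow, ← map_mul, ← mul_pow, inv2 hp, one_pow, map_one]
  have h4 : (4 : ℤ_[p]) * Ring.inverse 2 ^ 2 = 1 := by linear_combination (2 * Ring.inverse 2 + 1) * inv2 hp
  have h5 : 4 * (1 - X : ℤ_[p]⟦X⟧) ^ (2 * k) = C (Ring.inverse 2 ^ (2 + 6 * k)) * ((2 + X) ^ (2 + 6 * k) * ak p k + X ^ 3 * g) := by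
    rw [← hg]
    linear_combination -(4 * (1 - X : ℤ_[p]⟦X⟧) ^ (2 * k)) * h2
  have h6 : (X - 1 : ℤ_[p]⟦X⟧) ^ (2 * k) = (1 - X) ^ (2 * k) := by
    rw [pow_mul, pow_mul]; congr 1; ring
  have h7 : (2 + X : ℤ_[p]⟦X⟧) ^ (4 * p) = (2 + X) ^ (2 + 6 * k) * (2 + X) ^ (4 * p - 2 - 6 * k) := by
    rw [← pow_add]; congr 1; omega
  have h8 : C (bk p k) = 4 * (C (36 ^ k * AA p k) * (-1) ^ k * C (Ring.inverse 2 ^ (2 + 6 * k))) := by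
    have : bk p k = 4 * (36 ^ k * AA p k * (-1) ^ k * Ring.inverse 2 ^ (2 + 6 * k)) := by
      rw [bk, pow_add, show (-36 : ℤ_[p]) = -1 * 36 by norm_num, mul_pow]
      linear_combination (-((-1) ^ k * 36 ^ k * AA p k * Ring.inverse 2 ^ (6 * k))) * h4
    rw [this, map_mul, map_mul, map_mul, map_pow C (-1 : ℤ_[p]) k, map_neg, map_one, show C (R := ℤ_[p]) 4 = 4 from map_ofNat _ 4]
  rw [h6, hg1, h7, h8]
  generalize C (36 ^ k * AA p k) = A at *
  generalize C (Ring.inverse (2 : ℤ_[p]) ^ (2 + 6 * k)) = H at *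
  generalize (2 + X : ℤ_[p]⟦X⟧) ^ (2 + 6 * k) = U at *
  generalize (2 + X : ℤ_[p]⟦X⟧) ^ (4 * p - 2 - 6 * k) = V at *
  generalize (1 - X : ℤ_[p]⟦X⟧) ^ (2 * k) = W at *
  generalize (-1 : ℤ_[p]⟦X⟧) ^ k = s at *
  refine ⟨4 * A * (4 * W) * g1 * V + 4 * A * s * V * H * g, ?_⟩
  linear_combination 4 * A * s * V * h5

lemma sum_spec (hp : 3 < p) : ∃ g : ℤ_[p]⟦X⟧,
    16 * (Polynomial.reflect (4 * p - 2) (NP p ((2 * p + 2) / 3) (4 * p)) : ℤ_[p]⟦X⟧) =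
      (2 + X) ^ (4 * p) * ∑ k ∈ Finset.range ((2 * p + 2) / 3), (C (bk p k) * ak p k) + X ^ 3 * g := by
  have e : (Polynomial.reflect (4 * p - 2) (NP p ((2 * p + 2) / 3) (4 * p)) : ℤ_[p]⟦X⟧) =
      ∑ k ∈ Finset.range ((2 * p + 2) / 3), (C (36 ^ k * AA p k) * ((X - 1) ^ (2 * k) * (X ^ 3 - 1) ^ k * (2 + X) ^ (4 * p - 2 - 6 * k))) := by
    rw [refl_NP _ _ (by omega)]
    rw [← Polynomial.coeToPowerSeries.ringHom_apply, map_sum]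
    apply Finset.sum_congr rfl
    intro k _
    simp only [map_mul, map_pow, map_sub, map_add, map_one, Polynomial.coeToPowerSeries.ringHom_apply, Polynomial.coe_C, Polynomial.coe_X, coe_2]
  have h : (X : ℤ_[p]⟦X⟧) ^ 3 ∣ 16 * (Polynomial.reflect (4 * p - 2) (NP p ((2 * p + 2) / 3) (4 * p)) : ℤ_[p]⟦X⟧) -
      (2 + X) ^ (4 * p) * ∑ k ∈ Finset.range ((2 * p + 2) / 3), (C (bk p k) * ak p k) := by
    rw [e, Finset.mul_sum, Finset.mul_sum, ← Finset.sum_sub_distrib]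
    apply Finset.dvd_sum
    intro k hk
    rw [Finset.mem_range] at hk
    obtain ⟨g, hg⟩ := term_spec hp k (by omega)
    exact ⟨g, by rw [hg]; ring⟩
  obtain ⟨g, hg⟩ := h
  exact ⟨g, by rw [← hg]; ring⟩

lemma bk_dvd3 (hp : 3 < p) {k : ℕ} (hk : k < p) (h : 2 * p ≤ 3 * k) : (p : ℤ_[p]) ^ 3 ∣ bk p k :=
  ((AA_dvd3 hp hk h).mul_left _).mul_right _

lemma inv_2X (hp : 3 < p) (n : ℕ) : ∃ V : ℤ_[p]⟦X⟧, V * (2 + X) ^ n = 1 := by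
  have h : IsUnit (2 + X : ℤ_[p]⟦X⟧) := by
    rw [isUnit_iff_constantCoeff, map_add, constantCoeff_X, add_zero, c_2]; exact isUnit_two hp
  obtain ⟨V, hV⟩ := (h.pow n).exists_left_inv
  exact ⟨V, hV⟩

lemma read_low (hp : 3 < p) (r : ℕ) (hr : r ≤ 3) (h : (p : ℤ_[p]⟦X⟧) ^ r ∣ Om p) :
    Low r (9 * C (kap p ^ 4) * ∑ k ∈ Finset.range p, (C (bk p k) * ak p k) - RP p) := by
  have h3 := p_mod3 hp
  have h1 := (main_low hp r hr h).mul 16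
  obtain ⟨g, hg⟩ := sum_spec hp
  obtain ⟨V, hV⟩ := inv_2X hp (4 * p)
  have e1 : ∃ g2 : ℤ_[p]⟦X⟧, (C (2 * kap p) + X ^ p : ℤ_[p]⟦X⟧) ^ 4 = 16 * C (kap p ^ 4) + X ^ 3 * g2 := by
    have := sub_dvd_pow_sub_pow (C (2 * kap p) + X ^ p : ℤ_[p]⟦X⟧) (C (2 * kap p)) 4
    obtain ⟨c, hc⟩ := this
    refine ⟨X ^ (p - 3) * c, ?_⟩
    have hX : (X : ℤ_[p]⟦X⟧) ^ p = X ^ 3 * X ^ (p - 3) := by rw [← pow_add]; congr 1; omega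
    have h16 : C (2 * kap p) ^ 4 = (16 * C (kap p ^ 4) : ℤ_[p]⟦X⟧) := by
      rw [map_mul, mul_pow, C_2, map_pow]; norm_num
    rw [h16] at hc
    rw [eq_add_of_sub_eq hc, hX]; ring
  obtain ⟨g2, hg2⟩ := e1
  rw [hg2] at h1
  set N := (Polynomial.reflect (4 * p - 2) (NP p ((2 * p + 2) / 3) (4 * p)) : ℤ_[p]⟦X⟧) with hN
  set S := ∑ k ∈ Finset.range ((2 * p + 2) / 3), (C (bk p k) * ak p k) with hS
  have h2 : Low r ((2 + X) ^ (4 * p) * (16 * (9 * C (kap p ^ 4) * S - RP p))) := by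
    have e : (2 + X) ^ (4 * p) * (16 * (9 * C (kap p ^ 4) * S - RP p)) = 16 * (9 * (N * (16 * C (kap p ^ 4) + X ^ 3 * g2)) - (2 + X) ^ (4 * p) * RP p)
       + X ^ 3 * (- (16 * 9 * N * g2) - 9 * g * (16 * C (kap p ^ 4))) := by
      linear_combination (-(9 * (16 * C (kap p ^ 4)))) * hg
    rw [e]; exact h1.add (Low.X 3 le_rfl _)
  have h4 := h2.cancel hV
  have hu : ∃ v : ℤ_[p]⟦X⟧, v * 16 = 1 := by
    have : IsUnit (16 : ℤ_[p]⟦X⟧) := by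
      rw [isUnit_iff_constantCoeff]
      have : (constantCoeff (R := ℤ_[p])) 16 = 2 ^ 4 := by rw [show (constantCoeff (R := ℤ_[p])) 16 = 16 from map_ofNat _ 16]; norm_num
      rw [this]; exact (isUnit_two hp).pow 4
    exact this.exists_left_inv
  obtain ⟨v, hv⟩ := hu
  have h5 := h4.cancel hv
  have h6 : Low r (∑ k ∈ Finset.range p, (C (bk p k) * ak p k) - S) := by
    apply Low.of_dvd
    rw [hS, ← Finset.sum_range_add_sum_Ico _ (show (2 * p + 2) / 3 ≤ p by omega), add_sub_cancel_left]
    apply Finset.dvd_sum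
    intro k hk
    rw [Finset.mem_Ico] at hk
    obtain ⟨c, hc⟩ := (pow_dvd_pow _ hr).trans (bk_dvd3 hp hk.2 (by omega))
    exact ⟨C c * ak p k, by rw [hc, map_mul, map_pow, map_natCast]; ring⟩
  have := h5.add (h6.mul (9 * C (kap p ^ 4)))
  have e : 9 * C (kap p ^ 4) * S - RP p + 9 * C (kap p ^ 4) * (∑ k ∈ Finset.range p, (C (bk p k) * ak p k) - S) = 9 * C (kap p ^ 4) * ∑ k ∈ Finset.range p, (C (bk p k) * ak p k) - RP p := by ring
  rwa [e] at this

variable (p) in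
noncomputable def SB (i : ℕ) : ℤ_[p] := ∑ k ∈ Finset.range p, (k : ℤ_[p]) ^ i * bk p k

lemma ak_eq (k : ℕ) : ak p k = C 4 + C (-(4 * (5 * (k : ℤ_[p]) + 1))) * X + C (50 * (k : ℤ_[p]) ^ 2 + 19 * (k : ℤ_[p]) + 3) * X ^ 2 := by
  rw [ak]
  simp only [map_mul, map_add, map_neg, map_pow, map_natCast, map_one, C_3, show C (R := ℤ_[p]) 4 = 4 from map_ofNat _ 4, show C (R := ℤ_[p]) 5 = 5 from map_ofNat _ 5,
    show C (R := ℤ_[p]) 50 = 50 from map_ofNat _ 50, show C (R := ℤ_[p]) 19 = 19 from map_ofNat _ 19]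
  ring

lemma sum_coeff0 : coeff 0 (∑ k ∈ Finset.range p, (C (bk p k) * ak p k)) = 4 * SB p 0 := by
  rw [map_sum, SB, Finset.mul_sum]
  apply Finset.sum_congr rfl
  intro k _
  rw [coeff_C_mul, ak_eq]; simp; ring
lemma sum_coeff1 : coeff 1 (∑ k ∈ Finset.range p, (C (bk p k) * ak p k)) = -(4 * (SB p 0 + 5 * SB p 1)) := by
  rw [map_sum, SB, SB, Finset.mul_sum, ← Finset.sum_add_distrib, Finset.mul_sum, ← Finset.sum_neg_distrib]
  apply Finset.sum_congr rfl
  intro k _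
  have hc : ∀ a b c : ℤ_[p], coeff 1 (C a + C b * X + C c * X ^ 2) = b := fun a b c => by
    simp [coeff_C, coeff_X, coeff_X_pow]
  rw [coeff_C_mul, ak_eq, hc]; ring
lemma sum_coeff2 : coeff 2 (∑ k ∈ Finset.range p, (C (bk p k) * ak p k)) = 50 * SB p 2 + 19 * SB p 1 + 3 * SB p 0 := by
  rw [map_sum, SB, SB, SB, Finset.mul_sum, Finset.mul_sum, Finset.mul_sum, ← Finset.sum_add_distrib, ← Finset.sum_add_distrib]
  apply Finset.sum_congr rfl
  intro k _
  have hc : ∀ a b c : ℤ_[p], coeff 2 (C a + C b * X + C c * X ^ 2) = c := fun a b c => by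
    simp [coeff_C, coeff_X, coeff_X_pow]
  rw [coeff_C_mul, ak_eq, hc]; ring

lemma read_coeff (hp : 3 < p) (r : ℕ) (hr : r ≤ 3) (h : (p : ℤ_[p]⟦X⟧) ^ r ∣ Om p) (i : ℕ) (hi : i < 3) :
    (p : ℤ_[p]) ^ r ∣ 9 * kap p ^ 4 * coeff i (∑ k ∈ Finset.range p, (C (bk p k) * ak p k)) - coeff (4 * p - 2 - i) (BrS p) := by
  have := read_low hp r hr h i hi
  rw [map_sub, ← C_9', ← map_mul, coeff_C_mul, RP_coeff hp i hi] at this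
  exact this

lemma isUnit_kap (hp : 3 < p) : IsUnit (kap p) := by
  rw [isUnit_iff_toZMod, kap_mod hp]; exact one_ne_zero
lemma isUnit_nine (hp : 3 < p) : IsUnit (9 : ℤ_[p]) := by
  have := (isUnit_three hp).mul (isUnit_three hp); norm_num at this; exact this

lemma dvd_unit_mul {a u b : ℤ_[p]} (hu : IsUnit u) (h : a ∣ u * b) : a ∣ b := by
  rwa [hu.dvd_mul_left] at h

lemma res1 (hp : 3 < p) (h1 : p % 3 = 1) :
    (p : ℤ_[p]) ^ 3 ∣ kap p ^ 2 * SB p 0 - TT p 1 ^ 2 ∧ (p : ℤ_[p]) ^ 3 ∣ kap p ^ 3 * (SB p 0 + 5 * SB p 1) - TT p 1 * TT p 2 ∧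
    (p : ℤ_[p]) ^ 3 ∣ kap p ^ 4 * (50 * SB p 2 + 19 * SB p 1 + 3 * SB p 0) - 3 * TT p 2 ^ 2 := by
  have H := Om_dvd3 hp h1
  have a0 := read_coeff hp 3 le_rfl H 0 (by norm_num)
  have a1 := read_coeff hp 3 le_rfl H 1 (by norm_num)
  have a2 := read_coeff hp 3 le_rfl H 2 (by norm_num)
  rw [sum_coeff0, Nat.sub_zero, Br1_0 hp h1] at a0
  rw [sum_coeff1, show 4 * p - 2 - 1 = 4 * p - 3 by omega, Br1_1 hp h1] at a1
  rw [sum_coeff2, show 4 * p - 2 - 2 = 4 * p - 4 by omega, Br1_2 hp h1] at a2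
  have u9 := isUnit_nine hp
  have u4 := isUnit_four hp
  have uk := isUnit_kap hp
  refine ⟨dvd_unit_mul ((u9.mul u4).mul (uk.pow 2)) ?_, dvd_unit_mul (((u9.mul u4).mul uk)) ?_, dvd_unit_mul u9 ?_⟩
  · convert a0 using 1; ring
  · rw [← dvd_neg]; convert a1 using 1; ring
  · convert a2 using 1; ring

lemma res2 (hp : 3 < p) (h1 : p % 3 = 2) :
    (p : ℤ_[p]) ^ 2 ∣ 4 * kap p ^ 4 * SB p 0 - 3 * TT p 2 ^ 2 ∧ (p : ℤ_[p]) ^ 2 ∣ kap p ^ 3 * (SB p 0 + 5 * SB p 1) - TT p 1 * TT p 2 ∧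
    (p : ℤ_[p]) ^ 2 ∣ kap p ^ 2 * (50 * SB p 2 + 19 * SB p 1 + 3 * SB p 0) - 4 * TT p 1 ^ 2 := by
  have H := Om_dvd2 hp
  have a0 := read_coeff hp 2 (by norm_num) H 0 (by norm_num)
  have a1 := read_coeff hp 2 (by norm_num) H 1 (by norm_num)
  have a2 := read_coeff hp 2 (by norm_num) H 2 (by norm_num)
  rw [sum_coeff0, Nat.sub_zero, Br2_0 hp h1] at a0
  rw [sum_coeff1, show 4 * p - 2 - 1 = 4 * p - 3 by omega, Br2_1 hp h1] at a1
  rw [sum_coeff2, show 4 * p - 2 - 2 = 4 * p - 4 by omega, Br2_2 hp h1] at a2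
  have u9 := isUnit_nine hp
  have u4 := isUnit_four hp
  have uk := isUnit_kap hp
  refine ⟨dvd_unit_mul u9 ?_, dvd_unit_mul (((u9.mul u4).mul uk)) ?_, dvd_unit_mul (u9.mul (uk.pow 2)) ?_⟩
  · convert a0 using 1; ring
  · rw [← dvd_neg]; convert a1 using 1; ring
  · convert a2 using 1; ring
end read3
end S8

namespace S8
section gam
variable {p : ℕ} [Fact p.Prime]
open scoped Nat

lemma cc_prod (hp : 3 < p) {w : ℤ_[p]} (hw : (p : ℤ_[p]) ∣ w) (n : ℕ) (hn : n < p) :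
    cc w n * (∏ l ∈ Finset.range n, (3 * (l : ℤ_[p]) + 3 - w)) ^ 3 = ∏ i ∈ Finset.range (3 * n), ((i : ℤ_[p]) + 1 - w) := by
  induction n with
  | zero => simp [cc]
  | succ n ih =>
    have h := cc_rec hp hw hn
    have ih := ih (by omega)
    rw [Finset.prod_range_succ, show 3 * (n + 1) = 3 * n + 1 + 1 + 1 by ring, Finset.prod_range_succ, Finset.prod_range_succ, Finset.prod_range_succ, ← ih]
    push_cast
    set P := ∏ l ∈ Finset.range n, (3 * (l : ℤ_[p]) + 3 - w)
    linear_combination P ^ 3 * (3 * (n : ℤ_[p]) + 3 - w) * h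

variable (p) in
noncomputable def Q (x : ℤ_[p]) (n : ℕ) : ℤ_[p] := ∏ l ∈ Finset.range n, (1 + (p : ℤ_[p]) * (x * iv p (l + 1)))

lemma inv3 (hp : 3 < p) : (3 : ℤ_[p]) * Ring.inverse 3 = 1 := Ring.mul_inverse_cancel _ (isUnit_three hp)

lemma den_prod (hp : 3 < p) (j : ℤ_[p]) (n : ℕ) (hn : n < p) :
    ∏ l ∈ Finset.range n, (3 * (l : ℤ_[p]) + 3 - j * p) = 3 ^ n * (n ! : ℤ_[p]) * Q p (-(j * Ring.inverse 3)) n := by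
  induction n with
  | zero => simp [Q]
  | succ n ih =>
    rw [Finset.prod_range_succ, ih (by omega), Q, Q, Finset.prod_range_succ, Nat.factorial_succ, pow_succ]
    have h1 := iv_mul (p := p) (j := n + 1) (by omega) hn
    have h2 := inv3 hp
    push_cast at h1 ⊢
    set P := ∏ l ∈ Finset.range n, (1 + (p : ℤ_[p]) * (-(j * Ring.inverse 3) * iv p (l + 1)))
    linear_combination (3 ^ n * (n ! : ℤ_[p]) * P * j * p) * (3 * Ring.inverse 3 * h1 + h2)

lemma num_prod (N n : ℕ) (h : N ≤ n) : ∏ i ∈ Finset.range N, ((i : ℤ_[p]) + 1 - ((n + 1 : ℕ) : ℤ_[p])) = (-1) ^ N * (n.descFactorial N : ℤ_[p]) := by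
  rw [Nat.descFactorial_eq_prod_range, Nat.cast_prod]
  have : (-1 : ℤ_[p]) ^ N = ∏ i ∈ Finset.range N, (-1 : ℤ_[p]) := by simp
  rw [this, ← Finset.prod_mul_distrib]
  apply Finset.prod_congr rfl
  intro i hi
  rw [Finset.mem_range] at hi
  rw [Nat.cast_sub (by omega)]; push_cast; ring

lemma TT_eq (hp : 3 < p) (j : ℕ) (hj : 0 < j) (hj' : j < 3) :
    TT p j * (3 ^ (j * p / 3) * ((j * p / 3)! : ℤ_[p]) * Q p (-(j * Ring.inverse 3)) (j * p / 3)) ^ 3 = (-1) ^ (j * p / 3) * ((j * p - 1)! : ℤ_[p]) := by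
  have h3 := p_mod3 hp
  have hj2 : j * p ≤ 2 * p := Nat.mul_le_mul_right _ (by omega)
  have hj1 : 1 * p ≤ j * p := Nat.mul_le_mul_right _ (by omega)
  have hjm : (j * p) % 3 ≠ 0 := by interval_cases j <;> omega
  rw [TT, ← den_prod hp _ _ (by omega), cc_prod hp (Dvd.intro_left _ rfl) _ (by omega)]
  have e : ((j : ℤ_[p]) * (p : ℤ_[p])) = ((j * p - 1 + 1 : ℕ) : ℤ_[p]) := by
    rw [Nat.sub_add_cancel (by omega)]; push_cast; rfl
  rw [e, num_prod _ _ (by omega)]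
  have h4 := Nat.factorial_mul_descFactorial (show 3 * (j * p / 3) ≤ j * p - 1 by omega)
  have h5 : (j * p - 1 - 3 * (j * p / 3))! = 1 := by
    have : j * p - 1 - 3 * (j * p / 3) = 0 ∨ j * p - 1 - 3 * (j * p / 3) = 1 := by omega
    rcases this with h | h <;> rw [h] <;> rfl
  rw [h5, one_mul] at h4
  rw [h4, pow_mul]; norm_num

lemma choose_Q (k : ℕ) (hk : k < p) : ((p - 1).choose k : ℤ_[p]) = (-1) ^ k * Q p (-1) k := by
  have hf : ∀ k, k < p → (k ! : ℤ_[p]) * Q p (-1) k = ∏ i ∈ Finset.range k, ((i : ℤ_[p]) + 1 - ((p - 1 + 1 : ℕ) : ℤ_[p])) := by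
    intro k hk
    rw [Nat.sub_add_cancel (by omega)]
    induction k with
    | zero => simp [Q]
    | succ k ih =>
      rw [Finset.prod_range_succ, ← ih (by omega), Q, Q, Finset.prod_range_succ, Nat.factorial_succ]
      have h1 := iv_mul (p := p) (j := k + 1) (by omega) hk
      push_cast at h1 ⊢
      set P := ∏ l ∈ Finset.range k, (1 + (p : ℤ_[p]) * (-1 * iv p (l + 1)))
      linear_combination (-(p : ℤ_[p]) * (k ! : ℤ_[p]) * P) * h1
  have h1 := hf k hk
  rw [num_prod _ _ (by omega), Nat.descFactorial_eq_factorial_mul_choose] at h1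
  have h0 : (k ! : ℤ_[p]) ≠ 0 := by exact_mod_cast Nat.factorial_ne_zero k
  have h2 : ((-1 : ℤ_[p]) ^ k) * (-1) ^ k = 1 := by rw [← mul_pow]; norm_num
  push_cast at h1
  apply mul_left_cancel₀ h0
  linear_combination (-((-1) ^ k)) * h1 - (k ! : ℤ_[p]) * ((p - 1).choose k : ℤ_[p]) * h2

lemma kap_3 (hp : 3 < p) : (p : ℤ_[p]) ^ 3 ∣ kap p * 3 ^ (p - 1) - 1 := by
  have h := kap4 hp
  have h108 := Ring.mul_inverse_cancel _ (isUnit_108 hp)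
  obtain ⟨a, ha⟩ := wolst2 hp
  obtain ⟨b, hb⟩ := wolst3 hp
  rw [AA] at h
  have h5 : (3 : ℤ_[p]) ^ p * (36 ^ p * Ring.inverse 108 ^ p) = 1 := by
    rw [← mul_assoc, ← mul_pow, ← mul_pow]; norm_num [h108]
  have h6 : (3 : ℤ_[p]) ^ p = 3 ^ (p - 1) * 3 := by rw [← pow_succ]; congr 1; omega
  have u : IsUnit (12 : ℤ_[p]) := by
    have := (isUnit_four hp).mul (isUnit_three hp); norm_num at this; exact this
  apply dvd_unit_mul u
  set c := ((2 * p).choose p : ℤ_[p])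
  set d := ((3 * p).choose p : ℤ_[p])
  have e : 12 * (kap p * 3 ^ (p - 1) - 1) = c ^ 2 * d - 12 := by
    linear_combination (3 : ℤ_[p]) ^ p * h + c ^ 2 * d * h5 - 4 * kap p * h6
  rw [e]
  exact ⟨(c + 2) * a * d + 4 * b, by linear_combination (c + 2) * d * ha + 4 * hb⟩

lemma Q_expand (x : ℤ_[p]) (n : ℕ) : (p : ℤ_[p]) ^ 3 ∣ 2 * Q p x n - (2 + 2 * p * (x * Hs p 1 n) + p ^ 2 * (x ^ 2 * (Hs p 1 n ^ 2 - Hs p 2 n))) := by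
  have := prod_expand (Finset.range n) (p : ℤ_[p]) (fun l => x * iv p (l + 1))
  rw [Q]
  simp only [mul_pow, ← Finset.mul_sum] at this
  have e1 : Hs p 1 n = ∑ i ∈ Finset.range n, iv p (i + 1) := by simp [Hs]
  have e2 : Hs p 2 n = ∑ i ∈ Finset.range n, iv p (i + 1) ^ 2 := rfl
  rw [e1, e2]
  convert this using 2
  ring

lemma Q_expand2 (hp : 3 < p) (x : ℤ_[p]) (n : ℕ) : (p : ℤ_[p]) ^ 2 ∣ Q p x n - (1 + p * (x * Hs p 1 n)) := by
  obtain ⟨a, ha⟩ := Q_expand x n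
  apply dvd_unit_mul (isUnit_two hp)
  exact ⟨p * a + x ^ 2 * (Hs p 1 n ^ 2 - Hs p 2 n), by linear_combination ha⟩

lemma Q_unit (x : ℤ_[p]) (n : ℕ) : IsUnit (Q p x n) := by
  rw [isUnit_iff_toZMod, Q, map_prod]
  apply Finset.prod_ne_zero_iff.2
  intro i _
  simp

lemma pow_par (hp : 3 < p) : (-1 : ℤ_[p]) ^ (p - 1) = 1 := by
  have : Odd p := (Fact.out : p.Prime).odd_of_ne_two (by omega)
  obtain ⟨k, hk⟩ := this
  rw [show p - 1 = 2 * k by omega, pow_mul]; norm_num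

lemma T12 (hp : 3 < p) : (p : ℤ_[p]) ^ 3 ∣ TT p 1 * TT p 2 - kap p ^ 3 * ((-1) ^ (p / 3) * p) := by
  have h3 := p_mod3 hp
  have t1 := TT_eq hp 1 (by norm_num) (by norm_num)
  have t2 := TT_eq hp 2 (by norm_num) (by norm_num)
  rw [one_mul] at t1
  push_cast at t1 t2
  rw [one_mul] at t1
  set n1 := p / 3 with hn1
  set n2 := 2 * p / 3 with hn2
  have hn : n1 + n2 = p - 1 := by omega
  have hc : (p - 1).choose n1 * n1 ! * n2 ! = (p - 1)! := by
    have := Nat.choose_mul_factorial_mul_factorial (show n1 ≤ p - 1 by omega)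
    rwa [show p - 1 - n1 = n2 by omega] at this
  have hd : (p + (p - 1)).choose (p - 1) * (p - 1)! * p ! = (2 * p - 1)! := by
    have := Nat.choose_mul_factorial_mul_factorial (show p - 1 ≤ p + (p - 1) by omega)
    rw [Nat.add_sub_cancel] at this
    rw [this]; congr 1; omega
  have hpf : p ! = p * (p - 1)! := (Nat.mul_factorial_pred (by omega)).symm
  have w := wolst_prod hp 1
  rw [one_mul] at w
  have hc' : ((p - 1).choose n1 : ℤ_[p]) * (n1 ! : ℤ_[p]) * (n2 ! : ℤ_[p]) = ((p - 1)! : ℤ_[p]) := by exact_mod_cast hc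
  have hd' : ((p + (p - 1)).choose (p - 1) : ℤ_[p]) * ((p - 1)! : ℤ_[p]) * (p * ((p - 1)! : ℤ_[p])) = ((2 * p - 1)! : ℤ_[p]) := by
    rw [hpf] at hd; exact_mod_cast hd
  set W := ((p + (p - 1)).choose (p - 1) : ℤ_[p])
  have hs : (-1 : ℤ_[p]) ^ n1 * (-1) ^ n2 = 1 := by rw [← pow_add, hn, pow_par hp]
  have hs1 : (-1 : ℤ_[p]) ^ n1 * (-1) ^ n1 = 1 := by rw [← mul_pow]; norm_num
  have h33 : (3 : ℤ_[p]) ^ n1 * 3 ^ n2 = 3 ^ (p - 1) := by rw [← pow_add, hn]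
  have hch := choose_Q (p := p) n1 (by omega)
  set Q1 := Q p (-Ring.inverse 3) n1 with hQ1
  set Q2 := Q p (-(2 * Ring.inverse 3)) n2 with hQ2
  set Q3 := Q p (-1) n1 with hQ3
  set f1 := (n1 ! : ℤ_[p]) with hf1
  set f2 := (n2 ! : ℤ_[p])
  have f0 : (f1 * f2) ^ 3 ≠ 0 := by
    apply pow_ne_zero; apply mul_ne_zero
    · exact Nat.cast_ne_zero.2 (Nat.factorial_ne_zero n1)
    · exact Nat.cast_ne_zero.2 (Nat.factorial_ne_zero n2)
  set s := (-1 : ℤ_[p]) ^ n1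
  set s2 := (-1 : ℤ_[p]) ^ n2
  -- key identity
  have key : TT p 1 * TT p 2 * ((3 ^ (p - 1)) * (Q1 * Q2)) ^ 3 = p * W * (s * Q3) ^ 3 := by
    apply mul_left_cancel₀ f0
    rw [← hc'] at t1 hd'
    rw [← hd'] at t2
    rw [hch] at t1 t2
    have e : f1 ^ 3 * f2 ^ 3 * (TT p 1 * TT p 2 * ((3 ^ n1 * 3 ^ n2) * (Q1 * Q2)) ^ 3) = (TT p 1 * (3 ^ n1 * f1 * Q1) ^ 3) * (TT p 2 * (3 ^ n2 * f2 * Q2) ^ 3) := by ring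
    rw [mul_pow f1, ← h33, e, t1, t2]
    linear_combination (W * p * (s * Q3 * f1 * f2) ^ 3) * hs
  obtain ⟨a, ha⟩ := Q_expand2 hp (-Ring.inverse 3) n1
  obtain ⟨b, hb⟩ := Q_expand2 hp (-(2 * Ring.inverse 3)) n2
  obtain ⟨c, hc3⟩ := Q_expand2 hp (-1) n1
  obtain ⟨d, hd3⟩ := H1_refl hp (m := n1) (by omega)
  rw [show p - 1 - n1 = n2 by omega] at hd3
  obtain ⟨wv, hw⟩ := w
  rw [← hQ1] at ha
  rw [← hQ2] at hb
  rw [← hQ3] at hc3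
  have i3 := inv3 hp
  -- Q1 Q2 ≡ Q3 mod p^2
  have hq : (p : ℤ_[p]) ^ 2 ∣ Q1 * Q2 - Q3 := by
    set H := Hs p 1 n1
    set H2 := Hs p 1 n2
    set v := Ring.inverse (3 : ℤ_[p])
    set G := Hs p 2 n1
    refine ⟨a * Q2 + (1 + p * (-v * H)) * b + 2 * v ^ 2 * H * H2 - 2 * v * (G + p * d) - c, ?_⟩
    linear_combination Q2 * ha + (1 + p * (-v * H)) * hb - hc3 - 2 * v * p * hd3 - p * H * i3
  obtain ⟨t, ht⟩ := hq
  have k3 := kap_3 hp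
  obtain ⟨k, hk⟩ := k3
  have u : IsUnit ((3 ^ (p - 1)) * (Q1 * Q2)) := ((isUnit_three hp).pow _).mul ((Q_unit _ _).mul (Q_unit _ _))
  apply dvd_unit_mul (u.pow 3)
  set E := (3 : ℤ_[p]) ^ (p - 1)
  set q := Q1 * Q2
  have e : (E * q) ^ 3 * (TT p 1 * TT p 2 - kap p ^ 3 * (s * p)) = p * W * (s * Q3) ^ 3 - (kap p * E) ^ 3 * q ^ 3 * s * p := by
    linear_combination key
  rw [e]
  have hk' : kap p * E = 1 + p ^ 3 * k := by linear_combination hk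
  have hw' : W = 1 + p ^ 3 * wv := by linear_combination hw
  have hq3 : Q3 = q - p ^ 2 * t := by linear_combination -ht
  rw [hk', hw', hq3]
  refine ⟨wv * (p * s * (q - p ^ 2 * t) ^ 3) + s * (-3 * q ^ 2 * t + 3 * q * p ^ 2 * t ^ 2 - p ^ 4 * t ^ 3) - (3 * k + 3 * k ^ 2 * p ^ 3 + k ^ 3 * p ^ 6) * q ^ 3 * s * p, ?_⟩
  linear_combination (p * (1 + p ^ 3 * wv) * s * (q - p ^ 2 * t) ^ 3) * hs1

/-- the value for `p = 3 m + 1` -/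
lemma T1_one (hp : 3 < p) (h1 : p % 3 = 1) : (p : ℤ_[p]) ^ 3 ∣ 3 * (TT p 1 * 3 ^ (p - 1)) - ((2 * (p / 3)).choose (p / 3) : ℤ_[p]) * (3 - p ^ 2 * Hs p 2 (p / 3)) := by
  have t1 := TT_eq hp 1 (by norm_num) (by norm_num)
  rw [one_mul] at t1
  push_cast at t1
  rw [one_mul] at t1
  set m := p / 3 with hm
  have hc : (p - 1).choose m * m ! * (2 * m)! = (p - 1)! := by
    have := Nat.choose_mul_factorial_mul_factorial (show m ≤ p - 1 by omega)
    rwa [show p - 1 - m = 2 * m by omega] at this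
  have hd : (2 * m).choose m * m ! * m ! = (2 * m)! := by
    have := Nat.choose_mul_factorial_mul_factorial (show m ≤ 2 * m by omega)
    rwa [show 2 * m - m = m by omega] at this
  have hc' : ((p - 1).choose m : ℤ_[p]) * (m ! : ℤ_[p]) * (((2 * m).choose m : ℤ_[p]) * (m ! : ℤ_[p]) * (m ! : ℤ_[p])) = ((p - 1)! : ℤ_[p]) := by
    rw [← hd] at hc; exact_mod_cast hc
  rw [choose_Q m (by omega)] at hc'
  rw [← hc'] at t1
  have hs1 : (-1 : ℤ_[p]) ^ m * (-1) ^ m = 1 := by rw [← mul_pow]; norm_num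
  set U := ((2 * m).choose m : ℤ_[p])
  have f0 : (m ! : ℤ_[p]) ^ 3 ≠ 0 := pow_ne_zero _ (Nat.cast_ne_zero.2 (Nat.factorial_ne_zero m))
  have h33 : (3 : ℤ_[p]) ^ (p - 1) = (3 ^ m) ^ 3 := by rw [← pow_mul]; congr 1; omega
  obtain ⟨a, ha⟩ := Q_expand (p := p) (-Ring.inverse 3) m
  obtain ⟨c, hc3⟩ := Q_expand (p := p) (-1) m
  set Q1 := Q p (-Ring.inverse 3) m with hQ1
  set Q3 := Q p (-1) m with hQ3
  have key : TT p 1 * 3 ^ (p - 1) * Q1 ^ 3 = Q3 * U := by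
    apply mul_left_cancel₀ f0
    rw [h33]
    linear_combination t1 + (m ! : ℤ_[p]) ^ 3 * Q3 * U * hs1
  have i3 := inv3 hp
  set v := Ring.inverse (3 : ℤ_[p])
  set H := Hs p 1 m
  set G := Hs p 2 m
  have hq : (p : ℤ_[p]) ^ 3 ∣ 3 * Q3 - (3 - p ^ 2 * G) * Q1 ^ 3 := by
    have u8 : IsUnit (8 : ℤ_[p]) := by
      have := (isUnit_two hp).pow 3; norm_num at this; exact this
    apply dvd_unit_mul u8
    have e1 : 2 * Q1 = (2 + 2 * p * (-v * H) + p ^ 2 * ((-v) ^ 2 * (H ^ 2 - G))) + p ^ 3 * a := by linear_combination ha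
    have e3 : 2 * Q3 = (2 + 2 * p * (-1 * H) + p ^ 2 * ((-1) ^ 2 * (H ^ 2 - G))) + p ^ 3 * c := by linear_combination hc3
    have e : 8 * (3 * Q3 - (3 - p ^ 2 * G) * Q1 ^ 3) = 12 * (2 * Q3) - (3 - p ^ 2 * G) * (2 * Q1) ^ 3 := by ring
    rw [e, e1, e3]
    have e9 : (p : ℤ_[p]) ^ 3 ∣ 12 * (2 + 2 * p * (-1 * H) + p ^ 2 * ((-1) ^ 2 * (H ^ 2 - G))) - (3 - p ^ 2 * G) * (2 + 2 * p * (-v * H) + p ^ 2 * ((-v) ^ 2 * (H ^ 2 - G))) ^ 3 := by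
      set K := H ^ 2 - G with hK
      refine ⟨-3 * (-24 * v ^ 3 * H * K - 8 * v ^ 3 * H ^ 3 + p * (6 * v ^ 4 * K ^ 2 + 12 * v ^ 4 * H ^ 2 * K) - p ^ 2 * (6 * v ^ 5 * H * K ^ 2) + p ^ 3 * v ^ 6 * K ^ 3) + G * (-24 * v * H + 
         p * (12 * v ^ 2 * K + 24 * v ^ 2 * H ^ 2) + p ^ 2 * (-24 * v ^ 3 * H * K - 8 * v ^ 3 * H ^ 3) + p ^ 3 * (6 * v ^ 4 * K ^ 2 + 12 * v ^ 4 * H ^ 2 * K) - p ^ 4 * (6 * v ^ 5 * H * K ^ 2) + p ^ 5 * v ^ 6 * K ^ 3), ?_⟩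
      linear_combination (24 * p * H - p ^ 2 * (3 * v + 1) * (12 * H ^ 2 - 4 * G)) * i3 
    set A := (2 + 2 * p * (-v * H) + p ^ 2 * ((-v) ^ 2 * (H ^ 2 - G)))
    have e10 : 12 * (2 + 2 * p * (-1 * H) + p ^ 2 * ((-1) ^ 2 * (H ^ 2 - G)) + p ^ 3 * c) - (3 - p ^ 2 * G) * (A + p ^ 3 * a) ^ 3 =
      (12 * (2 + 2 * p * (-1 * H) + p ^ 2 * ((-1) ^ 2 * (H ^ 2 - G))) - (3 - p ^ 2 * G) * A ^ 3) + p ^ 3 * (12 * c - (3 - p ^ 2 * G) * (3 * A ^ 2 * a + 3 * A * p ^ 3 * a ^ 2 + p ^ 6 * a ^ 3)) := by ring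
    rw [e10]
    exact dvd_add e9 (Dvd.intro _ rfl)
  apply dvd_unit_mul ((Q_unit (-Ring.inverse 3) m).pow 3)
  rw [← hQ1]
  have e : Q1 ^ 3 * (3 * (TT p 1 * 3 ^ (p - 1)) - U * (3 - p ^ 2 * G)) = U * (3 * Q3 - (3 - p ^ 2 * G) * Q1 ^ 3) := by
    linear_combination 3 * key
  rw [e]; exact hq.mul_left _

/-- the value for `p = 3 n + 2` -/
lemma T1_two (hp : 3 < p) (h1 : p % 3 = 2) : (p : ℤ_[p]) ^ 2 ∣ TT p 1 * 3 ^ (p - 1) - (p + 1) * ((2 * p / 3).choose (p / 3) : ℤ_[p]) := by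
  have t1 := TT_eq hp 1 (by norm_num) (by norm_num)
  rw [one_mul] at t1
  push_cast at t1
  rw [one_mul] at t1
  set m := p / 3 with hm
  set n2 := 2 * p / 3 with hn2
  have hc : (p - 1).choose m * m ! * n2 ! = (p - 1)! := by
    have := Nat.choose_mul_factorial_mul_factorial (show m ≤ p - 1 by omega)
    rwa [show p - 1 - m = n2 by omega] at this
  have hd : n2.choose m * m ! * ((m + 1) * m !) = n2 ! := by
    have := Nat.choose_mul_factorial_mul_factorial (show m ≤ n2 by omega)
    rwa [show n2 - m = m + 1 by omega, Nat.factorial_succ] at this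
  have hc' : ((p - 1).choose m : ℤ_[p]) * (m ! : ℤ_[p]) * ((n2.choose m : ℤ_[p]) * (m ! : ℤ_[p]) * (((m : ℤ_[p]) + 1) * (m ! : ℤ_[p]))) = ((p - 1)! : ℤ_[p]) := by
    rw [← hd] at hc; exact_mod_cast hc
  rw [choose_Q m (by omega)] at hc'
  rw [← hc'] at t1
  have hs1 : (-1 : ℤ_[p]) ^ m * (-1) ^ m = 1 := by rw [← mul_pow]; norm_num
  set U := (n2.choose m : ℤ_[p])
  have f0 : (m ! : ℤ_[p]) ^ 3 ≠ 0 := pow_ne_zero _ (Nat.cast_ne_zero.2 (Nat.factorial_ne_zero m))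
  have h33 : (3 : ℤ_[p]) ^ (p - 1) = (3 ^ m) ^ 3 * 3 := by rw [← pow_mul, ← pow_succ]; congr 1; omega
  have hpm : (p : ℤ_[p]) + 1 = 3 * ((m : ℤ_[p]) + 1) := by
    have : p + 1 = 3 * (m + 1) := by omega
    exact_mod_cast this
  obtain ⟨a, ha⟩ := Q_expand2 hp (-Ring.inverse 3) m
  obtain ⟨c, hc3⟩ := Q_expand2 hp (-1) m
  set Q1 := Q p (-Ring.inverse 3) m with hQ1
  set Q3 := Q p (-1) m with hQ3
  have key : TT p 1 * 3 ^ (p - 1) * Q1 ^ 3 = Q3 * ((p + 1) * U) := by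
    apply mul_left_cancel₀ f0
    rw [h33, hpm]
    linear_combination 3 * t1 + 3 * (m ! : ℤ_[p]) ^ 3 * Q3 * U * ((m : ℤ_[p]) + 1) * hs1
  have i3 := inv3 hp
  set v := Ring.inverse (3 : ℤ_[p])
  set H := Hs p 1 m
  have hq : (p : ℤ_[p]) ^ 2 ∣ Q3 - Q1 ^ 3 := by
    have e1 : Q1 = 1 + p * (-v * H) + p ^ 2 * a := by linear_combination ha
    have e3 : Q3 = 1 + p * (-1 * H) + p ^ 2 * c := by linear_combination hc3
    rw [e1, e3]
    set A := 1 + p * (-v * H)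
    refine ⟨c - (3 * A ^ 2 * a + 3 * A * p ^ 2 * a ^ 2 + p ^ 4 * a ^ 3) - (3 * v ^ 2 * H ^ 2 - p * v ^ 3 * H ^ 3), ?_⟩
    linear_combination p * H * i3
  apply dvd_unit_mul ((Q_unit (-Ring.inverse 3) m).pow 3)
  rw [← hQ1]
  have e : Q1 ^ 3 * (TT p 1 * 3 ^ (p - 1) - (p + 1) * U) = (p + 1) * U * (Q3 - Q1 ^ 3) := by
    linear_combination key
  rw [e]; exact hq.mul_left _
end gam
end S8

namespace S8
section tei
variable {p : ℕ} [Fact p.Prime]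

lemma hom_zmod (f : ℤ_[p] →+* ZMod p) (x : ℤ_[p]) : f x = PadicInt.toZMod x := by
  have : f = PadicInt.toZMod := by
    refine RingHom.ext fun x => ?_
    have h := PadicInt.toZMod_spec (p := p) x
    have h2 : (p : ℤ_[p]) ∣ x - ((ZMod.val (PadicInt.toZMod x) : ℕ) : ℤ_[p]) := by
      have := (toZMod_eq_zero (p := p) (x - ((ZMod.val (PadicInt.toZMod x) : ℕ) : ℤ_[p]))).1 (by rw [map_sub, map_natCast, ZMod.natCast_zmod_val, sub_self])
      exact this
    obtain ⟨c, hc⟩ := h2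
    have e : x = (p : ℤ_[p]) * c + ((ZMod.val (PadicInt.toZMod x) : ℕ) : ℤ_[p]) := by linear_combination hc
    calc f x = f ((p : ℤ_[p]) * c + ((ZMod.val (PadicInt.toZMod x) : ℕ) : ℤ_[p])) := by rw [← e]
      _ = _ := by rw [map_add, map_mul, map_natCast, map_natCast, ZMod.natCast_zmod_val, ZMod.natCast_self, zero_mul, zero_add]
  rw [this]

variable (p) in
noncomputable def te : MulChar (ZMod p) ℤ_[p] where
  toMonoidHom := ((WittVector.equiv p : WittVector p (ZMod p) →+* ℤ_[p]) : WittVector p (ZMod p) →* ℤ_[p]).comp (WittVector.teichmuller p)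
  map_nonunit' a ha := by
    have : a = 0 := by simpa using ha
    subst this
    simp [WittVector.teichmuller_zero]

lemma te_mod (a : ZMod p) : PadicInt.toZMod (te p a) = a := by
  have h := hom_zmod ((WittVector.constantCoeff : WittVector p (ZMod p) →+* ZMod p).comp ((WittVector.equiv p).symm : ℤ_[p] →+* WittVector p (ZMod p))) (te p a)
  rw [← h]
  change WittVector.constantCoeff ((WittVector.equiv p).symm ((WittVector.equiv p) (WittVector.teichmuller p a))) = a
  rw [RingEquiv.symm_apply_apply]
  exact WittVector.teichmuller_coeff_zero p a

lemma te_pow_p (a : ZMod p) (k : ℕ) : te p a ^ p ^ k = te p a := by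
  rw [← map_pow, ZMod.pow_card_pow]

lemma te_unit {a : ZMod p} (h : a ≠ 0) : te p a ^ (p - 1) = 1 := by
  rw [← map_pow, ZMod.pow_card_sub_one_eq_one h, map_one]

lemma te_sub (a : ZMod p) : (p : ℤ_[p]) ^ 3 ∣ te p (1 - a) - (1 - te p a) ^ p ^ 2 := by
  have h : (p : ℤ_[p]) ∣ te p (1 - a) - (1 - te p a) := by
    apply (toZMod_eq_zero _).1
    simp [te_mod]
  have := dvd_sub_pow_of_dvd_sub h 2
  rwa [te_pow_p] at this

lemma te_sum (k : ℕ) (hk : 0 < k) : ∑ a : ZMod p, te p a ^ k = if p - 1 ∣ k then (p : ℤ_[p]) - 1 else 0 := by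
  split_ifs with h
  · obtain ⟨c, rfl⟩ := h
    rw [← Finset.add_sum_erase _ _ (Finset.mem_univ (0 : ZMod p))]
    rw [MulChar.map_zero, zero_pow hk.ne', zero_add]
    rw [Finset.sum_congr rfl (g := fun _ => (1 : ℤ_[p]))]
    · simp [Finset.card_erase_of_mem, ZMod.card, Nat.cast_sub (Fact.out : p.Prime).one_lt.le]
    · intro a ha
      rw [pow_mul, te_unit (Finset.ne_of_mem_erase ha), one_pow]
  · have hne : te p ^ k ≠ 1 := by
      intro h1
      apply h
      obtain ⟨g, hg⟩ := IsCyclic.exists_generator (α := (ZMod p)ˣ)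
      have hg1 : g ^ k = 1 := by
        have := congrArg (fun c : MulChar (ZMod p) ℤ_[p] => PadicInt.toZMod (c (g : ZMod p))) h1
        simp only [MulChar.pow_apply' _ hk.ne', MulChar.one_apply_coe, map_pow, te_mod, map_one] at this
        ext
        simpa using this
      have h2 := orderOf_dvd_of_pow_eq_one hg1
      rwa [orderOf_eq_card_of_forall_mem_zpowers hg, Nat.card_eq_fintype_card, ZMod.card_units] at h2
    have := MulChar.sum_eq_zero_of_ne_one hne
    rw [← this]
    apply Finset.sum_congr rfl
    intro a _
    rw [MulChar.pow_apply' _ hk.ne']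


lemma ysq {Y : ℤ_[p]} (hp : 3 < p) (hY : (p : ℤ_[p]) ∣ Y - 1) (e : ℕ) (he : 3 * e + 2 = 2 * p ^ 2) :
    (p : ℤ_[p]) ^ 3 ∣ 9 * Y ^ e - (20 - 16 * Y + 5 * Y ^ 2) := by
  obtain ⟨z, hz⟩ := hY
  obtain rfl : Y = 1 + p * z := by linear_combination hz
  have h := prod_expand (Finset.range e) (p : ℤ_[p]) (fun _ => z)
  simp only [Finset.prod_const, Finset.sum_const, Finset.card_range, nsmul_eq_mul] at h
  have he' : 3 * (e : ℤ_[p]) + 2 = 2 * p ^ 2 := by exact_mod_cast congrArg (fun n : ℕ => (n : ℤ_[p])) he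
  apply dvd_unit_mul (isUnit_two hp)
  obtain ⟨c, hc⟩ := h
  generalize (1 + p * z) ^ e = W at *
  refine ⟨9 * c + 12 * z + (4 * p ^ 3 - 14 * p) * z ^ 2, ?_⟩
  linear_combination 9 * hc + (6 * p * z + p ^ 2 * z ^ 2 * (3 * e - 5 + 2 * p ^ 2)) * he'

lemma te_term (hp : 3 < p) (h1 : p % 3 = 1) (a : ZMod p) :
    (p : ℤ_[p]) ^ 3 ∣ 9 * (te p a ^ (2 * (p / 3)) * te p (1 - a) ^ (2 * (p / 3))) -
      te p a ^ (2 * (p / 3)) * (20 * (1 - te p a) ^ (2 * (p / 3)) - 16 * (1 - te p a) ^ (5 * (p / 3)) + 5 * (1 - te p a) ^ (8 * (p / 3))) := by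
  have hm : 0 < p / 3 := by omega
  by_cases ha : a = 1
  · subst ha
    simp [map_one, hm.ne', MulChar.map_zero]
  · obtain ⟨c, hc⟩ := te_sub (p := p) a
    have h2 : (p : ℤ_[p]) ^ 3 ∣ te p (1 - a) ^ (2 * (p / 3)) - ((1 - te p a) ^ p ^ 2) ^ (2 * (p / 3)) :=
      (Dvd.intro _ hc.symm).trans (sub_dvd_pow_sub_pow _ _ _)
    set m := p / 3 with hmdef
    have hpm : p = 3 * m + 1 := by omega
    have hY : (p : ℤ_[p]) ∣ (1 - te p a) ^ (p - 1) - 1 := by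
      apply (toZMod_eq_zero _).1
      rw [map_sub, map_pow, map_sub, map_one, te_mod, ZMod.pow_card_sub_one_eq_one (sub_ne_zero.2 (Ne.symm ha)), sub_self]
    have h3 := ysq hp hY (2 * m * (p + 1)) (by rw [hpm]; ring)
    have e1 : ((1 - te p a) ^ p ^ 2) ^ (2 * m) = (1 - te p a) ^ (2 * m) * ((1 - te p a) ^ (p - 1)) ^ (2 * m * (p + 1)) := by
      rw [← pow_mul, ← pow_mul, ← pow_add]
      congr 1
      obtain ⟨q, hq⟩ : ∃ q, p = q + 1 := ⟨p - 1, by omega⟩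
      rw [show p - 1 = q by omega]
      have : p ^ 2 = q * (p + 1) + 1 := by rw [hq]; ring
      rw [this]; ring
    have e2 : (1 - te p a) ^ (5 * m) = (1 - te p a) ^ (2 * m) * (1 - te p a) ^ (p - 1) := by
      rw [← pow_add]; congr 1; omega
    have e3 : (1 - te p a) ^ (8 * m) = (1 - te p a) ^ (2 * m) * ((1 - te p a) ^ (p - 1)) ^ 2 := by
      rw [← pow_mul, ← pow_add]; congr 1; omega
    rw [e1] at h2
    rw [e2, e3]
    generalize ((1 - te p a) ^ (p - 1)) ^ (2 * m * (p + 1)) = W at *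
    obtain ⟨c1, h2⟩ := h2
    obtain ⟨c2, h3⟩ := h3
    refine ⟨9 * te p a ^ (2 * m) * c1 + te p a ^ (2 * m) * (1 - te p a) ^ (2 * m) * c2, ?_⟩
    linear_combination 9 * te p a ^ (2 * m) * h2 + te p a ^ (2 * m) * (1 - te p a) ^ (2 * m) * h3

lemma m_even (hp : 3 < p) (h1 : p % 3 = 1) : Even (p / 3) := by
  have := p_odd hp
  rw [Nat.even_iff]; omega

lemma te_binom (hp : 3 < p) (h1 : p % 3 = 1) (n : ℕ) :
    ∑ a : ZMod p, te p a ^ (2 * (p / 3)) * (1 - te p a) ^ ((3 * n + 2) * (p / 3)) =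
      ((p : ℤ_[p]) - 1) * ∑ i ∈ Finset.range (n + 1), (((3 * n + 2) * (p / 3)).choose ((3 * i + 1) * (p / 3)) : ℤ_[p]) := by
  have hm : 0 < p / 3 := by omega
  have hev := m_even hp h1
  set m := p / 3 with hmdef
  have hpm : p - 1 = 3 * m := by omega
  have e1 : ∀ a : ZMod p, te p a ^ (2 * m) * (1 - te p a) ^ ((3 * n + 2) * m) =
      ∑ j ∈ Finset.range ((3 * n + 2) * m + 1), te p a ^ (2 * m + j) * ((-1) ^ j * (((3 * n + 2) * m).choose j : ℤ_[p])) := by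
    intro a
    rw [sub_eq_neg_add, add_pow, Finset.mul_sum]
    apply Finset.sum_congr rfl
    intro j _
    rw [one_pow, neg_pow, pow_add]; ring
  simp_rw [e1]
  rw [Finset.sum_comm]
  simp_rw [← Finset.sum_mul]
  have e2 : ∀ j, ∑ a : ZMod p, te p a ^ (2 * m + j) = if p - 1 ∣ 2 * m + j then (p : ℤ_[p]) - 1 else 0 :=
    fun j => te_sum _ (by omega)
  simp_rw [e2, ite_mul, zero_mul]
  rw [← Finset.sum_filter, Finset.mul_sum]
  symm
  apply Finset.sum_bij (fun i _ => (3 * i + 1) * m)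
  · intro i hi
    rw [Finset.mem_range] at hi
    rw [Finset.mem_filter, Finset.mem_range, hpm]
    refine ⟨Nat.lt_succ_of_le (Nat.mul_le_mul_right _ (by omega)), ⟨i + 1, by ring⟩⟩
  · intro i _ j _ h
    have := Nat.eq_of_mul_eq_mul_right hm h
    omega
  · intro j hj
    rw [Finset.mem_filter, Finset.mem_range, hpm] at hj
    obtain ⟨hj, c, hc⟩ := hj
    have hc0 : 0 < c := by
      rcases Nat.eq_zero_or_pos c with rfl | h
      · simp at hc; omega
      · exact h
    obtain ⟨i, rfl⟩ : ∃ i, c = i + 1 := ⟨c - 1, by omega⟩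
    have hj2 : j = (3 * i + 1) * m := by nlinarith
    refine ⟨i, ?_, hj2.symm⟩
    rw [Finset.mem_range]
    by_contra hcon
    have : (3 * (n + 1) + 1) * m ≤ j := by rw [hj2]; exact Nat.mul_le_mul_right _ (by omega)
    nlinarith
  · intro i _
    rw [(hev.mul_left (3 * i + 1)).neg_one_pow, one_mul]

variable (p) in
noncomputable def cubc : MulChar (ZMod p) ℤ_[p] := te p ^ (2 * (p / 3))

lemma cubc_apply (hp : 3 < p) (a : ZMod p) : cubc p a = te p a ^ (2 * (p / 3)) :=
  MulChar.pow_apply' _ (by omega) _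

lemma jac_expand (hp : 3 < p) (h1 : p % 3 = 1) :
    (p : ℤ_[p]) ^ 3 ∣ 9 * jacobiSum (cubc p) (cubc p) - ((p : ℤ_[p]) - 1) *
      (20 * ((2 * (p / 3)).choose (p / 3) : ℤ_[p]) - 32 * ((5 * (p / 3)).choose (p / 3) : ℤ_[p])
        + 5 * (2 * ((8 * (p / 3)).choose (p / 3) : ℤ_[p]) + ((8 * (p / 3)).choose (4 * (p / 3)) : ℤ_[p]))) := by
  have h := Finset.dvd_sum (s := Finset.univ) (fun a _ => te_term hp h1 a)
  rw [Finset.sum_sub_distrib, ← Finset.mul_sum] at h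
  have e0 := te_binom hp h1 0
  have e1 := te_binom hp h1 1
  have e2 := te_binom hp h1 2
  simp only [Finset.sum_range_succ, Finset.sum_range_zero] at e0 e1 e2
  norm_num only at e0 e1 e2
  rw [show (5 * (p / 3)).choose (4 * (p / 3)) = (5 * (p / 3)).choose (p / 3) by
    rw [← Nat.choose_symm (show p / 3 ≤ 5 * (p / 3) by omega)]; congr 1; omega] at e1
  rw [show (8 * (p / 3)).choose (7 * (p / 3)) = (8 * (p / 3)).choose (p / 3) by
    rw [← Nat.choose_symm (show p / 3 ≤ 8 * (p / 3) by omega)]; congr 1; omega] at e2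
  have e : ∑ a : ZMod p, te p a ^ (2 * (p / 3)) * (20 * (1 - te p a) ^ (2 * (p / 3)) - 16 * (1 - te p a) ^ (5 * (p / 3)) + 5 * (1 - te p a) ^ (8 * (p / 3))) =
     20 * (∑ a : ZMod p, te p a ^ (2 * (p / 3)) * (1 - te p a) ^ (2 * (p / 3))) - 16 * (∑ a : ZMod p, te p a ^ (2 * (p / 3)) * (1 - te p a) ^ (5 * (p / 3)))
      + 5 * ∑ a : ZMod p, te p a ^ (2 * (p / 3)) * (1 - te p a) ^ (8 * (p / 3)) := by
    rw [Finset.mul_sum, Finset.mul_sum, Finset.mul_sum, ← Finset.sum_sub_distrib, ← Finset.sum_add_distrib]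
    apply Finset.sum_congr rfl
    intro a _
    ring
  rw [e, e0, e1, e2] at h
  rw [one_mul] at h
  have ej : jacobiSum (cubc p) (cubc p) = ∑ a : ZMod p, te p a ^ (2 * (p / 3)) * te p (1 - a) ^ (2 * (p / 3)) := by
    rw [jacobiSum]
    simp_rw [cubc_apply hp]
  rw [ej]
  convert h using 2
  ring

end tei
end S8

namespace S8
section bin
variable {p : ℕ} [Fact p.Prime]
open scoped Nat

lemma fac_Q (a r : ℕ) (hr : r < p) : ((a * p + r)! : ℤ_[p]) = ((a * p)! : ℤ_[p]) * (r ! : ℤ_[p]) * Q p a r := by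
  induction r with
  | zero => simp [Q]
  | succ r ih =>
    rw [← add_assoc, Nat.factorial_succ, Nat.factorial_succ, Nat.cast_mul, ih (by omega), Q, Q, Finset.prod_range_succ]
    have h1 := iv_mul (p := p) (j := r + 1) (by omega) hr
    push_cast at h1 ⊢
    set P := ∏ l ∈ Finset.range r, (1 + (p : ℤ_[p]) * ((a : ℤ_[p]) * iv p (l + 1)))
    linear_combination (-((a * p)! : ℤ_[p]) * (r ! : ℤ_[p]) * P * p * a) * h1

variable (p) in
noncomputable def RR (x : ℤ_[p]) (m : ℕ) : ℤ_[p] := ∏ i ∈ Finset.range m, (1 + (p : ℤ_[p]) * (x * iv p (m + i)))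

lemma Q_RR (x : ℤ_[p]) (m : ℕ) (hm : 0 < m) : Q p x (2 * m - 1) = Q p x (m - 1) * RR p x m := by
  rw [Q, Q, RR, show 2 * m - 1 = (m - 1) + m by omega, Finset.prod_range_add]
  congr 1
  apply Finset.prod_congr rfl
  intro i _
  rw [show m - 1 + i + 1 = m + i by omega]

lemma c2_fac (m : ℕ) (hm : 0 < m) : ((2 * m).choose m : ℤ_[p]) * ((m - 1)! : ℤ_[p]) * (m ! : ℤ_[p]) = 2 * ((2 * m - 1)! : ℤ_[p]) := by
  have h := Nat.choose_mul_factorial_mul_factorial (show m ≤ 2 * m by omega)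
  rw [show 2 * m - m = m by omega] at h
  have e1 : (2 * m)! = 2 * m * (2 * m - 1)! := by rw [← Nat.mul_factorial_pred (by omega)]
  have e2 : m ! = m * (m - 1)! := by rw [← Nat.mul_factorial_pred (by omega)]
  have h2 : m * ((2 * m).choose m * (m - 1)! * m !) = m * (2 * (2 * m - 1)!) := by
    nth_rewrite 1 [e2] at h
    rw [e1] at h
    linarith
  exact_mod_cast Nat.eq_of_mul_eq_mul_left hm h2

lemma fac_ne (n : ℕ) : (n ! : ℤ_[p]) ≠ 0 := Nat.cast_ne_zero.2 (Nat.factorial_ne_zero n)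

lemma C5_eq (hp : 3 < p) (h1 : p % 3 = 1) : 2 * ((5 * (p / 3)).choose (p / 3) : ℤ_[p]) = ((2 * (p / 3)).choose (p / 3) : ℤ_[p]) * RR p 1 (p / 3) := by
  have hm : 0 < p / 3 := by omega
  have h := Nat.choose_mul_factorial_mul_factorial (show p / 3 ≤ 5 * (p / 3) by omega)
  set m := p / 3 with hmdef
  rw [show 5 * m - m = 1 * p + (m - 1) by omega] at h
  have h' : ((5 * m).choose m : ℤ_[p]) * (m ! : ℤ_[p]) * ((1 * p + (m - 1))! : ℤ_[p]) = ((1 * p + (2 * m - 1))! : ℤ_[p]) := by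
    rw [show 1 * p + (2 * m - 1) = 5 * m by omega]
    exact_mod_cast h
  rw [fac_Q _ _ (by omega), fac_Q _ _ (by omega), Nat.cast_one, Q_RR _ _ hm] at h'
  have hc := c2_fac (p := p) m hm
  have u := (Q_unit (p := p) 1 (m - 1)).ne_zero
  apply mul_left_cancel₀ (mul_ne_zero (mul_ne_zero (mul_ne_zero (fac_ne (p := p) m) (fac_ne (p := p) (1 * p))) (fac_ne (p := p) (m - 1))) u)
  linear_combination 2 * h' - ((1 * p)! : ℤ_[p]) * Q p 1 (m - 1) * RR p 1 m * hc

lemma C8_eq (hp : 3 < p) (h1 : p % 3 = 1) : 2 * (8 * p - 5) * ((8 * (p / 3)).choose (p / 3) : ℤ_[p]) = (7 * p - 4) * ((2 * (p / 3)).choose (p / 3) : ℤ_[p]) * RR p 2 (p / 3) := by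
  have hm : 0 < p / 3 := by omega
  have h := Nat.choose_mul_factorial_mul_factorial (show p / 3 ≤ 8 * (p / 3) by omega)
  set m := p / 3 with hmdef
  have hpm : (p : ℤ_[p]) = 3 * m + 1 := by exact_mod_cast congrArg (fun n : ℕ => (n : ℤ_[p])) (show p = 3 * m + 1 by omega)
  have h2 : (8 * m).choose m * m ! * (7 * m + 1)! * (8 * m + 1) = (8 * m + 1)! * (7 * m + 1) := by
    rw [Nat.factorial_succ, Nat.factorial_succ (8 * m), ← h, show 8 * m - m = 7 * m by omega]; ring
  rw [show 7 * m + 1 = 2 * p + (m - 1) by omega] at h2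
  have h' : ((8 * m).choose m : ℤ_[p]) * (m ! : ℤ_[p]) * ((2 * p + (m - 1))! : ℤ_[p]) * (8 * m + 1) = ((2 * p + (2 * m - 1))! : ℤ_[p]) * (7 * m + 1) := by
    rw [show 2 * p + (2 * m - 1) = 8 * m + 1 by omega]
    have h3 : 2 * p + (m - 1) = 7 * m + 1 := by omega
    rw [h3] at h2 ⊢
    exact_mod_cast h2
  rw [fac_Q _ _ (by omega), fac_Q _ _ (by omega), Nat.cast_ofNat, Q_RR _ _ hm] at h'
  have hc := c2_fac (p := p) m hm
  have u := (Q_unit (p := p) 2 (m - 1)).ne_zero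
  rw [show (8 * (p : ℤ_[p]) - 5) = 3 * (8 * m + 1) by linear_combination 8 * hpm, show (7 * (p : ℤ_[p]) - 4) = 3 * (7 * m + 1) by linear_combination 7 * hpm]
  apply mul_left_cancel₀ (mul_ne_zero (mul_ne_zero (mul_ne_zero (fac_ne (p := p) m) (fac_ne (p := p) (2 * p))) (fac_ne (p := p) (m - 1))) u)
  linear_combination 6 * h' - 3 * (7 * m + 1) * ((2 * p)! : ℤ_[p]) * Q p 2 (m - 1) * RR p 2 m * hc

lemma C84_eq (hp : 3 < p) (h1 : p % 3 = 1) : 2 * (8 * p - 5) * ((8 * (p / 3)).choose (4 * (p / 3)) : ℤ_[p]) * Q p 1 (p / 3 - 1) ^ 2 =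
    ((2 * p).choose p : ℤ_[p]) * (p - 1) * ((2 * (p / 3)).choose (p / 3) : ℤ_[p]) * Q p 2 (p / 3 - 1) * RR p 2 (p / 3) := by
  have hm : 0 < p / 3 := by omega
  have h := Nat.choose_mul_factorial_mul_factorial (show 4 * (p / 3) ≤ 8 * (p / 3) by omega)
  have h0 := Nat.choose_mul_factorial_mul_factorial (show p ≤ 2 * p by omega)
  rw [show 2 * p - p = 1 * p by omega] at h0
  nth_rewrite 3 [← one_mul p] at h0
  set m := p / 3 with hmdef
  have hpm : (p : ℤ_[p]) = 3 * m + 1 := by exact_mod_cast congrArg (fun n : ℕ => (n : ℤ_[p])) (show p = 3 * m + 1 by omega)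
  have h2 : (8 * m).choose (4 * m) * (4 * m)! * (4 * m)! * (8 * m + 1) = (8 * m + 1)! := by
    rw [Nat.factorial_succ (8 * m), ← h, show 8 * m - 4 * m = 4 * m by omega]; ring
  have h' : ((8 * m).choose (4 * m) : ℤ_[p]) * ((1 * p + (m - 1))! : ℤ_[p]) ^ 2 * (8 * m + 1) = ((2 * p + (2 * m - 1))! : ℤ_[p]) := by
    rw [show 2 * p + (2 * m - 1) = 8 * m + 1 by omega, show 1 * p + (m - 1) = 4 * m by omega, pow_two, ← mul_assoc]
    exact_mod_cast h2
  have h0' : ((2 * p).choose p : ℤ_[p]) * ((1 * p)! : ℤ_[p]) * ((1 * p)! : ℤ_[p]) = ((2 * p)! : ℤ_[p]) := by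
    exact_mod_cast h0
  rw [fac_Q _ _ (by omega), fac_Q _ _ (by omega), Nat.cast_one, Nat.cast_ofNat, Q_RR _ _ hm, ← h0'] at h'
  have hc := c2_fac (p := p) m hm
  have e2 : (m ! : ℤ_[p]) = m * ((m - 1)! : ℤ_[p]) := by
    rw [← Nat.mul_factorial_pred hm.ne']; push_cast; ring
  rw [e2] at hc
  rw [show (8 * (p : ℤ_[p]) - 5) = 3 * (8 * m + 1) by linear_combination 8 * hpm, show ((p : ℤ_[p]) - 1) = 3 * m by linear_combination hpm]
  apply mul_left_cancel₀ (mul_ne_zero (pow_ne_zero 2 (fac_ne (p := p) (1 * p))) (pow_ne_zero 2 (fac_ne (p := p) (m - 1))))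
  generalize ((2 * p).choose p : ℤ_[p]) = CP at *
  linear_combination 6 * h' - 3 * CP * ((1 * p)! : ℤ_[p]) ^ 2 * Q p 2 (m - 1) * RR p 2 m * hc


lemma iv_m (hp : 3 < p) (h1 : p % 3 = 1) : iv p (p / 3) = p * iv p (p / 3) - 3 ∧ 2 * iv p (2 * (p / 3)) = iv p (p / 3) := by
  have hm : 0 < p / 3 := by omega
  set m := p / 3 with hmdef
  have hpm : (p : ℤ_[p]) = 3 * m + 1 := by exact_mod_cast congrArg (fun n : ℕ => (n : ℤ_[p])) (show p = 3 * m + 1 by omega)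
  have i1 := iv_mul (p := p) (j := m) hm (by omega)
  have i2 := iv_mul (p := p) (j := 2 * m) (by omega) (by omega)
  push_cast at i2
  constructor
  · linear_combination (-iv p m) * hpm - 3 * i1
  · linear_combination (-2 * iv p (2 * m)) * i1 + iv p m * i2

lemma Hs_pred (e n : ℕ) (hn : 0 < n) : Hs p e n = Hs p e (n - 1) + iv p n ^ e := by
  obtain ⟨k, rfl⟩ : ∃ k, n = k + 1 := ⟨n - 1, by omega⟩
  rw [Hs, Finset.sum_range_succ]; rfl

lemma RR_exp (hp : 3 < p) (h1 : p % 3 = 1) (x : ℤ_[p]) :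
    (p : ℤ_[p]) ^ 3 ∣ 4 * RR p x (p / 3) - (4 - 6 * x * p - 6 * x * p ^ 2 + 4 * x * p ^ 2 * Hs p 2 (p / 3) + x ^ 2 * p ^ 2 * (4 * Hs p 2 (p / 3) - 9)) := by
  have hm : 0 < p / 3 := by omega
  have r1 := H1_refl hp (show p / 3 ≤ p - 1 by omega)
  have r2 := H2_refl hp (show p / 3 ≤ p - 1 by omega)
  rw [show p - 1 - p / 3 = 2 * (p / 3) by omega] at r1 r2
  obtain ⟨i1, i2⟩ := iv_m hp h1
  have key : ∀ e, ∑ i ∈ Finset.range (p / 3), iv p (p / 3 + i) ^ e = Hs p e (2 * (p / 3) - 1) - Hs p e (p / 3 - 1) := by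
    intro e
    rw [Hs, Hs, show 2 * (p / 3) - 1 = (p / 3 - 1) + p / 3 by omega, Finset.sum_range_add, add_sub_cancel_left]
    apply Finset.sum_congr rfl
    intro i _
    rw [show p / 3 - 1 + i + 1 = p / 3 + i by omega]
  have k1 := key 1
  have k2 := key 2
  simp only [pow_one] at k1
  have e := prod_expand (Finset.range (p / 3)) (p : ℤ_[p]) (fun i => x * iv p (p / 3 + i))
  simp only [mul_pow, ← Finset.mul_sum] at e
  change (p : ℤ_[p]) ^ 3 ∣ 2 * RR p x (p / 3) - _ at e
  rw [k1, k2] at e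
  have a1 := Hs_pred (p := p) 1 (2 * (p / 3)) (by omega)
  have a2 := Hs_pred (p := p) 2 (2 * (p / 3)) (by omega)
  have a3 := Hs_pred (p := p) 1 (p / 3) (by omega)
  have a4 := Hs_pred (p := p) 2 (p / 3) (by omega)
  rw [pow_one] at a1 a3
  obtain ⟨c, r1⟩ := r1
  obtain ⟨c', r2⟩ := r2
  obtain ⟨c0, e⟩ := e
  set u := iv p (p / 3)
  set g := Hs p 2 (p / 3)
  generalize hS1 : Hs p 1 (2 * (p / 3) - 1) - Hs p 1 (p / 3 - 1) = S1 at *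
  generalize hS2 : Hs p 2 (2 * (p / 3) - 1) - Hs p 2 (p / 3 - 1) = S2 at *
  have b1 : 2 * S1 = -3 - 3 * p + 2 * p * g + p ^ 2 * (u + 2 * c) := by
    linear_combination 2 * r1 - 2 * hS1 - 2 * a1 + 2 * a3 - i2 + (1 + p) * i1
  have b2 : 4 * S2 = -8 * g + 27 + p * (3 * (-6 * u + p * u ^ 2) + 4 * c') := by
    linear_combination 4 * r2 - 4 * hS2 - 4 * a2 + 4 * a4 - (2 * iv p (2 * (p / 3)) + u) * i2 + 3 * (u + p * u - 3) * i1
  apply dvd_unit_mul (isUnit_two hp)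
  refine ⟨4 * x * (u + 2 * c) + x ^ 2 * ((-6 * (-3 + 2 * g + p * (u + 2 * c)) + p * (-3 + 2 * g + p * (u + 2 * c)) ^ 2) - (3 * (-6 * u + p * u ^ 2) + 4 * c')) + 4 * c0, ?_⟩
  linear_combination 4 * e + 4 * p * x * b1 + p ^ 2 * x ^ 2 * (2 * S1 + (-3 - 3 * p + 2 * p * g + p ^ 2 * (u + 2 * c))) * b1 - p ^ 2 * x ^ 2 * b2

lemma Q12 (hp : 3 < p) (h1 : p % 3 = 1) :
    (p : ℤ_[p]) ^ 3 ∣ Q p 2 (p / 3 - 1) - Q p 1 (p / 3 - 1) ^ 2 + p ^ 2 * (Hs p 2 (p / 3) - 9) := by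
  obtain ⟨i1, i2⟩ := iv_m hp h1
  have a4 := Hs_pred (p := p) 2 (p / 3) (by omega)
  obtain ⟨c1, q1⟩ := Q_expand (p := p) 1 (p / 3 - 1)
  obtain ⟨c2, q2⟩ := Q_expand (p := p) 2 (p / 3 - 1)
  set u := iv p (p / 3)
  set g := Hs p 2 (p / 3)
  generalize Hs p 1 (p / 3 - 1) = A at *
  generalize Hs p 2 (p / 3 - 1) = A2 at *
  generalize Q p 1 (p / 3 - 1) = Q1 at *
  generalize Q p 2 (p / 3 - 1) = Q2 at *
  apply dvd_unit_mul (isUnit_four hp)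
  have hA2 : A2 = g - 9 - p * (-6 * u + p * u ^ 2) := by
    linear_combination -a4 - (u + p * u - 3) * i1
  have hQ1 : 2 * Q1 = 2 + 2 * p * A + p ^ 2 * (A ^ 2 - A2) + p ^ 3 * c1 := by linear_combination q1
  refine ⟨2 * c2 - (4 * A * (A ^ 2 - A2) + p * (A ^ 2 - A2) ^ 2) - c1 * (2 * Q1 + (2 + 2 * p * A + p ^ 2 * (A ^ 2 - A2))) + 4 * (-6 * u + p * u ^ 2), ?_⟩
  linear_combination 2 * q2 - (2 * Q1 + (2 + 2 * p * A + p ^ 2 * (A ^ 2 - A2))) * hQ1 - 4 * p ^ 2 * hA2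


lemma Q1_one (n : ℕ) : (p : ℤ_[p]) ∣ Q p 1 n - 1 := by
  rw [Q]
  induction n with
  | zero => simp
  | succ n ih =>
    rw [Finset.prod_range_succ]
    obtain ⟨c, hc⟩ := ih
    refine ⟨c + (∏ l ∈ Finset.range n, (1 + (p : ℤ_[p]) * (1 * iv p (l + 1)))) * iv p (n + 1), ?_⟩
    linear_combination hc

lemma C84_exp (hp : 3 < p) (h1 : p % 3 = 1) :
    (p : ℤ_[p]) ^ 3 ∣ (8 * p - 5) * ((8 * (p / 3)).choose (4 * (p / 3)) : ℤ_[p]) -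
      (p - 1) * ((2 * (p / 3)).choose (p / 3) : ℤ_[p]) * (1 - 3 * p + p ^ 2 * (5 * Hs p 2 (p / 3) - 3)) := by
  have h := C84_eq hp h1
  obtain ⟨a, ha⟩ := wolst2 hp
  obtain ⟨b, hb⟩ := Q12 hp h1
  obtain ⟨q, hq⟩ := Q1_one (p := p) (p / 3 - 1)
  obtain ⟨r, hr⟩ := RR_exp hp h1 2
  have hu := ((isUnit_two hp).mul (isUnit_four hp)).mul ((Q_unit (p := p) 1 (p / 3 - 1)).pow 2)
  apply dvd_unit_mul hu
  set g := Hs p 2 (p / 3)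
  generalize ((8 * (p / 3)).choose (4 * (p / 3)) : ℤ_[p]) = X at *
  generalize ((2 * (p / 3)).choose (p / 3) : ℤ_[p]) = K at *
  generalize ((2 * p).choose p : ℤ_[p]) = CP at *
  generalize Q p 1 (p / 3 - 1) = Q1 at *
  generalize Q p 2 (p / 3 - 1) = Q2 at *
  generalize RR p 2 (p / 3) = R at *
  have hr' : 4 * R = 4 * (1 - 3 * p + p ^ 2 * (6 * g - 12)) + p ^ 3 * r := by linear_combination hr
  have hQ2 : Q2 = Q1 ^ 2 - p ^ 2 * (g - 9) + p ^ 3 * b := by linear_combination hb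
  have hQ1 : Q1 = 1 + p * q := by linear_combination hq
  have hCP : CP = 2 + p ^ 3 * a := by linear_combination ha
  have step : 4 * (2 * (8 * p - 5) * X * Q1 ^ 2) = CP * (p - 1) * K * Q2 * (4 * R) := by linear_combination 4 * h
  refine ⟨(p - 1) * K * (a * Q2 * (4 * R) + 2 * b * (4 * R) + 2 * (Q1 ^ 2 - p ^ 2 * (g - 9)) * r
     + 8 * ((2 * q + p * q ^ 2) * (g - 9) + (g - 9) * (3 - p * (6 * g - 12)))), ?_⟩
  have t1 : Q1 ^ 2 = 1 + p * (2 * q + p * q ^ 2) := by rw [hQ1]; ring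
  linear_combination step + (p - 1) * K * Q2 * (4 * R) * hCP + (p - 1) * K * 2 * (4 * R) * hQ2 + 2 * (p - 1) * K * (Q1 ^ 2 - p ^ 2 * (g - 9)) * hr' + 8 * (p - 1) * K * p ^ 2 * (g - 9) * t1

lemma jac_val (hp : 3 < p) (h1 : p % 3 = 1) :
    (p : ℤ_[p]) ^ 3 ∣ 3 * jacobiSum (cubc p) (cubc p) + ((2 * (p / 3)).choose (p / 3) : ℤ_[p]) * (3 - p ^ 2 * Hs p 2 (p / 3)) := by
  obtain ⟨j, hj⟩ := jac_expand hp h1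
  obtain ⟨x, hx⟩ := C84_exp hp h1
  have h5 := C5_eq hp h1
  have h8 := C8_eq hp h1
  obtain ⟨r1, hr1⟩ := RR_exp hp h1 1
  obtain ⟨r2, hr2⟩ := RR_exp hp h1 2
  have hu : IsUnit (12 * (8 * (p : ℤ_[p]) - 5)) := by
    have h5 : IsUnit ((5 : ℕ) : ℤ_[p]) := isUnit_nat (by
      intro h
      have := Nat.le_of_dvd (by norm_num) h
      interval_cases p <;> omega)
    have hu : IsUnit (8 * (p : ℤ_[p]) - 5) := by
      rw [isUnit_iff_toZMod] at h5 ⊢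
      simpa using h5
    have := ((isUnit_four hp).mul (isUnit_three hp)).mul hu
    norm_num at this
    exact this.1.mul this.2
  apply dvd_unit_mul hu
  set g := Hs p 2 (p / 3)
  generalize jacobiSum (cubc p) (cubc p) = J at *
  generalize ((8 * (p / 3)).choose (4 * (p / 3)) : ℤ_[p]) = X at *
  generalize ((8 * (p / 3)).choose (p / 3) : ℤ_[p]) = C8 at *
  generalize ((5 * (p / 3)).choose (p / 3) : ℤ_[p]) = C5 at *
  generalize ((2 * (p / 3)).choose (p / 3) : ℤ_[p]) = K at *
  generalize RR p 2 (p / 3) = R2 at *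
  generalize RR p 1 (p / 3) = R1 at *
  have hr2' : 4 * R2 = 4 * (1 - 3 * p + p ^ 2 * (6 * g - 12)) + p ^ 3 * r2 := by linear_combination hr2
  have hr1' : 4 * R1 = (4 - 6 * p + p ^ 2 * (8 * g - 15)) + p ^ 3 * r1 := by linear_combination hr1
  refine ⟨4 * (8 * p - 5) * j + 20 * (p - 1) * x + 5 * (p - 1) * (7 * p - 4) * K * r2 - 16 * (p - 1) * (8 * p - 5) * K * r1 + K * (-72 + 48 * g + 180 * p - 84 * p * g), ?_⟩
  linear_combination 4 * (8 * p - 5) * hj + 20 * (p - 1) * hx + 20 * (p - 1) * h8 + 5 * (p - 1) * (7 * p - 4) * K * hr2' - 64 * (p - 1) * (8 * p - 5) * h5 - 16 * (p - 1) * (8 * p - 5) * K * hr1'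

end bin
end S8

namespace S8
section jac
variable {p : ℕ} [Fact p.Prime]

lemma te_pow_ne (k : ℕ) (hk : 0 < k) (h : ¬ p - 1 ∣ k) : te p ^ k ≠ 1 := by
  intro h1
  apply h
  obtain ⟨g, hg⟩ := IsCyclic.exists_generator (α := (ZMod p)ˣ)
  have hg1 : g ^ k = 1 := by
    have := congrArg (fun c : MulChar (ZMod p) ℤ_[p] => PadicInt.toZMod (c (g : ZMod p))) h1
    simp only [MulChar.pow_apply' _ hk.ne', MulChar.one_apply_coe, map_pow, te_mod, map_one] at this
    ext
    simpa using this
  have h2 := orderOf_dvd_of_pow_eq_one hg1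
  rwa [orderOf_eq_card_of_forall_mem_zpowers hg, Nat.card_eq_fintype_card, ZMod.card_units] at h2

lemma cubc_ne (hp : 3 < p) (h1 : p % 3 = 1) : cubc p ≠ 1 := by
  apply te_pow_ne _ (by omega)
  intro h
  have := Nat.le_of_dvd (by omega) h
  omega

lemma cubc_sq_ne (hp : 3 < p) (h1 : p % 3 = 1) : cubc p * cubc p ≠ 1 := by
  rw [cubc, ← pow_add]
  apply te_pow_ne _ (by omega)
  intro h
  rw [show p - 1 = 3 * (p / 3) by omega] at h
  obtain ⟨c, hc⟩ := h
  have : c = 1 ∨ 2 ≤ c ∨ c = 0 := by omega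
  rcases this with rfl | h | rfl
  · omega
  · nlinarith [show 0 < p / 3 by omega]
  · omega

lemma cubc_cube (hp : 3 < p) (h1 : p % 3 = 1) : cubc p ^ 3 = 1 := by
  refine MulChar.ext fun a => ?_
  rw [MulChar.pow_apply' _ (by norm_num), cubc_apply hp, ← pow_mul, show 2 * (p / 3) * 3 = (p - 1) * 2 by omega, pow_mul, te_unit a.ne_zero]
  simp

lemma jac_norm (hp : 3 < p) (h1 : p % 3 = 1) :
    jacobiSum (cubc p) (cubc p) * jacobiSum (cubc p)⁻¹ (cubc p)⁻¹ = p := by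
  let f : ℤ_[p] →+* ℚ_[p] := PadicInt.Coe.ringHom
  have hf : Function.Injective f := Subtype.val_injective
  have hr : ringChar ℚ_[p] ≠ ringChar (ZMod p) := by
    rw [ringChar.eq_zero, ZMod.ringChar_zmod_n]; omega
  have h := jacobiSum_mul_jacobiSum_inv (F := ZMod p) (F' := ℚ_[p]) hr (χ := (cubc p).ringHomComp f) (φ := (cubc p).ringHomComp f)
    ((MulChar.ringHomComp_ne_one_iff hf).2 (cubc_ne hp h1)) ((MulChar.ringHomComp_ne_one_iff hf).2 (cubc_ne hp h1))
    (by rw [← MulChar.ringHomComp_mul]; exact (MulChar.ringHomComp_ne_one_iff hf).2 (cubc_sq_ne hp h1))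
  rw [MulChar.ringHomComp_inv, jacobiSum_ringHomComp, jacobiSum_ringHomComp, ← map_mul, ZMod.card] at h
  apply hf
  rw [h, map_natCast]

lemma indep {w : ℤ_[p]} (hw : w ^ 2 + w + 1 = 0) {a b : ℤ} (h : (a : ℤ_[p]) + b * w = 0) : a = 0 ∧ b = 0 := by
  have h2 : ((a ^ 2 - a * b + b ^ 2 : ℤ) : ℤ_[p]) = 0 := by
    push_cast
    linear_combination (a - b - b * w) * h + b ^ 2 * hw
  have h3 : a ^ 2 - a * b + b ^ 2 = 0 := by exact_mod_cast h2
  have hb : b ^ 2 = 0 := by nlinarith [sq_nonneg (2 * a - b), sq_nonneg b]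
  have hb0 : b = 0 := by simpa using hb
  subst hb0
  exact ⟨by simpa using h3, rfl⟩

lemma jac_struct (hp : 3 < p) (h1 : p % 3 = 1) : ∃ A B : ℤ, 4 * (p : ℤ) = A ^ 2 + 27 * B ^ 2 ∧
    (A : ℤ_[p]) = jacobiSum (cubc p) (cubc p) + jacobiSum (cubc p)⁻¹ (cubc p)⁻¹ := by
  have hne := cubc_ne hp h1
  have hcube : ∀ a : (ZMod p)ˣ, cubc p a ^ 3 = 1 := by
    intro a
    rw [← MulChar.pow_apply' _ (by norm_num), cubc_cube hp h1, MulChar.one_apply_coe]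
  obtain ⟨g, hg⟩ : ∃ g : (ZMod p)ˣ, cubc p g ≠ 1 := by
    by_contra hcon
    push Not at hcon
    exact hne (MulChar.ext fun a => by rw [hcon a, MulChar.one_apply_coe])
  set w := cubc p g with hwdef
  have hw3 : w ^ 3 = 1 := hcube g
  have hw : w ^ 2 + w + 1 = 0 := by
    apply mul_left_cancel₀ (sub_ne_zero.2 hg)
    linear_combination hw3
  have hprim : IsPrimitiveRoot w 3 := by
    have := IsPrimitiveRoot.orderOf w
    rwa [orderOf_eq_prime hw3 hg] at this
  have hval : ∀ b : ZMod p, ∃ n : ℤ × ℤ, cubc p b = n.1 + n.2 * w ∧ (cubc p)⁻¹ b = n.1 + n.2 * w ^ 2 := by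
    intro b
    by_cases hb : IsUnit b
    · obtain ⟨u, rfl⟩ := hb
      have hi : (cubc p)⁻¹ (u : ZMod p) = cubc p u ^ 2 := by
        have : (cubc p)⁻¹ = cubc p ^ 2 := by
          rw [inv_eq_iff_mul_eq_one, ← pow_succ', cubc_cube hp h1]
        rw [this, MulChar.pow_apply' _ (by norm_num)]
      have hc := hcube u
      have hz : (cubc p u - 1) * ((cubc p u - w) * (cubc p u - w ^ 2)) = 0 := by
        linear_combination hc + (cubc p u - cubc p u ^ 2) * hw + (cubc p u - 1) * hw3
      rw [hi]
      rcases mul_eq_zero.1 hz with h | h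
      · refine ⟨(1, 0), ?_⟩
        rw [sub_eq_zero.1 h]; simp
      rcases mul_eq_zero.1 h with h | h
      · refine ⟨(0, 1), ?_⟩
        rw [sub_eq_zero.1 h]; simp
      · refine ⟨(-1, -1), ?_⟩
        rw [sub_eq_zero.1 h]; push_cast
        constructor
        · linear_combination hw
        · linear_combination w * hw3 + hw
    · exact ⟨(0, 0), by simp [MulChar.map_nonunit _ hb]⟩
  choose n hn1 hn2 using hval
  obtain ⟨z, hz, hJ⟩ := exists_jacobiSum_eq_neg_one_add (F := ZMod p) (R := ℤ_[p]) (n := 3) (by norm_num) (cubc_cube hp h1) (cubc_cube hp h1)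
    (by rw [ZMod.card]; omega) hprim
  have hz' : ∃ a b : ℤ, z = a + b * w := by
    clear hJ
    induction hz using Algebra.adjoin_induction with
    | mem x hx => 
      rw [Set.mem_singleton_iff] at hx
      exact ⟨0, 1, by simp [hx]⟩
    | algebraMap r => exact ⟨r, 0, by simp⟩
    | add x y _ _ hx hy =>
      obtain ⟨a, b, rfl⟩ := hx
      obtain ⟨c, d, rfl⟩ := hy
      exact ⟨a + c, b + d, by push_cast; ring⟩
    | mul x y _ _ hx hy =>
      obtain ⟨a, b, rfl⟩ := hx
      obtain ⟨c, d, rfl⟩ := hy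
      exact ⟨a * c - b * d, a * d + b * c - b * d, by push_cast; linear_combination b * d * hw⟩
  obtain ⟨a, b, rfl⟩ := hz'
  have hA : ∃ A B : ℤ, jacobiSum (cubc p) (cubc p) = A + B * w ∧ jacobiSum (cubc p)⁻¹ (cubc p)⁻¹ = A + B * w ^ 2 := by
    refine ⟨∑ x : ZMod p, (n (x * (1 - x))).1, ∑ x : ZMod p, (n (x * (1 - x))).2, ?_, ?_⟩
    · rw [jacobiSum]; push_cast; rw [Finset.sum_mul, ← Finset.sum_add_distrib]
      exact Finset.sum_congr rfl fun x _ => by rw [← map_mul, hn1]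
    · rw [jacobiSum]; push_cast; rw [Finset.sum_mul, ← Finset.sum_add_distrib]
      exact Finset.sum_congr rfl fun x _ => by rw [← map_mul, hn2]
  obtain ⟨A, B, hA1, hA2⟩ := hA
  have hnorm := jac_norm hp h1
  have hB : B = 3 * (b - a) := by
    have := indep hw (a := A - (-1 + 3 * b)) (b := B - 3 * (b - a)) (by
      push_cast
      rw [hA1] at hJ
      linear_combination hJ + ((a + b * w) - 3 * b) * hw)
    linarith [this.2]
  rw [hA1, hA2] at hnorm ⊢
  have hp' : (A : ℤ) ^ 2 - A * B + B ^ 2 = p := by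
    have : ((A ^ 2 - A * B + B ^ 2 : ℤ) : ℤ_[p]) = ((p : ℤ) : ℤ_[p]) := by
      push_cast
      linear_combination hnorm - (A * B) * hw - B ^ 2 * hw3
    exact_mod_cast this
  refine ⟨2 * A - B, b - a, ?_, ?_⟩
  · rw [← hp', hB]; ring
  · push_cast; linear_combination -B * hw

end jac
end S8

namespace S8
section fin
variable {p : ℕ} [Fact p.Prime]

lemma repr_uniq (hp : 3 < p) {x y a b : ℤ} (h1 : 4 * (p : ℤ) = x ^ 2 + 27 * y ^ 2) (h2 : 4 * (p : ℤ) = a ^ 2 + 27 * b ^ 2) : x ^ 2 = a ^ 2 := by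
  have hpp : Prime (p : ℤ) := Nat.prime_iff_prime_int.1 Fact.out
  have hpos : (0 : ℤ) < p := by exact_mod_cast (show 0 < p by omega)
  have main : ∀ y : ℤ, 4 * (p : ℤ) = x ^ 2 + 27 * y ^ 2 → (p : ℤ) ∣ x * b - a * y → x ^ 2 = a ^ 2 := by
    intro y h1 hd
    obtain ⟨k, hk⟩ := hd
    have h3 : 16 * (p : ℤ) ^ 2 = (x * a + 27 * y * b) ^ 2 + 27 * ((p : ℤ) * k) ^ 2 := by
      rw [← hk]; linear_combination 4 * p * h1 + (x ^ 2 + 27 * y ^ 2) * h2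
    have hk0 : k = 0 := by
      by_contra hne
      have : 1 ≤ k ^ 2 := by have := sq_pos_of_ne_zero hne; linarith
      nlinarith [sq_nonneg (x * a + 27 * y * b), mul_pos hpos hpos]
    rw [hk0, mul_zero] at hk
    have h4 : (4 * (p : ℤ)) * (b ^ 2 - y ^ 2) = 0 := by
      linear_combination (x * b + a * y) * hk + b ^ 2 * h1 - y ^ 2 * h2
    have h5 : b ^ 2 - y ^ 2 = 0 := by
      rcases mul_eq_zero.1 h4 with h | h
      · linarith
      · exact h
    linarith
  have h6 : (p : ℤ) ∣ (x * b - a * y) * (x * b + a * y) := ⟨4 * (b ^ 2 - y ^ 2), by linear_combination b ^ 2 * -h1 + y ^ 2 * h2⟩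
  rcases hpp.dvd_or_dvd h6 with h | h
  · exact main y h1 h
  · exact main (-y) (by rw [h1]; ring) (by simpa using h)

lemma x_ndvd (hp : 3 < p) {x y : ℤ} (h1 : 4 * (p : ℤ) = x ^ 2 + 27 * y ^ 2) : ¬ (p : ℤ) ∣ x := by
  intro hd
  have hpp : Prime (p : ℤ) := Nat.prime_iff_prime_int.1 Fact.out
  have hpos : (0 : ℤ) < p := by exact_mod_cast (show 0 < p by omega)
  have hp3 : (3 : ℤ) < p := by exact_mod_cast hp
  obtain ⟨k, rfl⟩ := hd
  have hk0 : k = 0 := by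
    by_contra hne
    have : 1 ≤ k ^ 2 := by have := sq_pos_of_ne_zero hne; linarith
    have hp5 : (5 : ℤ) ≤ p := by
      have := p_odd hp
      exact_mod_cast (show 5 ≤ p by omega)
    nlinarith [sq_nonneg y, mul_pos hpos hpos, mul_nonneg (sq_nonneg (p : ℤ)) (sub_nonneg.2 this)]
  subst hk0
  have h27 : (p : ℤ) ∣ 27 * y ^ 2 := ⟨4, by linarith⟩
  have h3 : ¬ (p : ℤ) ∣ 27 := by
    intro h
    have : (p : ℤ) ∣ 3 ^ 3 := by simpa using h
    have := Int.le_of_dvd (by norm_num) (hpp.dvd_of_dvd_pow this)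
    linarith
  obtain ⟨j, rfl⟩ := hpp.dvd_of_dvd_pow ((hpp.dvd_or_dvd h27).resolve_left h3)
  have hj0 : j = 0 := by
    by_contra hne
    have : 1 ≤ j ^ 2 := by have := sq_pos_of_ne_zero hne; linarith
    nlinarith [mul_pos hpos hpos]
  subst hj0
  linarith

lemma isUnit_int {n : ℤ} (h : ¬ (p : ℤ) ∣ n) : IsUnit (n : ℤ_[p]) := by
  rw [isUnit_iff_toZMod, map_intCast, Ne, ZMod.intCast_zmod_eq_zero_iff_dvd]; exact h

lemma tele3 (hp : 3 < p) : (p : ℤ_[p]) ^ 3 ∣ 50 * SB p 3 + 27 * SB p 2 + 13 * SB p 1 + 2 * SB p 0 := by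
  have hrec : ∀ k : ℕ, 32 * ((k + 1 : ℕ) : ℤ_[p]) ^ 3 * bk p (k + 1) = -((2 * k + 1) * (3 * k + 1) * (3 * k + 2)) * bk p k := by
    intro k
    have h := AA_rec hp k
    have h2 : (64 : ℤ_[p]) * Ring.inverse 2 ^ 6 = 1 := by
      have := congrArg (fun t => t ^ 6) (inv2 (p := p) hp)
      simp only [mul_pow, one_pow] at this
      norm_num at this
      exact this
    rw [bk, bk, show 6 * (k + 1) = 6 * k + 6 by ring, pow_add _ (6 * k) 6, pow_succ (-36 : ℤ_[p]) k]
    push_cast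
    set t := Ring.inverse (2 : ℤ_[p])
    generalize t ^ (6 * k) = tk at *
    generalize (-36 : ℤ_[p]) ^ k = s at *
    apply mul_left_cancel₀ (isUnit_two hp).ne_zero
    linear_combination (-128 * s * tk * t ^ 6) * h - (2 * (2 * k + 1) * (3 * k + 1) * (3 * k + 2) * s * AA p k * tk) * h2
  have e : ∀ n : ℕ, ∑ k ∈ Finset.range n, (50 * (k : ℤ_[p]) ^ 3 + 27 * k ^ 2 + 13 * k + 2) * bk p k = -(32 * (n : ℤ_[p]) ^ 3 * bk p n) := by
    intro n
    induction n with
    | zero => simp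
    | succ n ih =>
      rw [Finset.sum_range_succ, ih, hrec]; ring
  have e2 := e p
  have e3 : 50 * SB p 3 + 27 * SB p 2 + 13 * SB p 1 + 2 * SB p 0 = ∑ k ∈ Finset.range p, (50 * (k : ℤ_[p]) ^ 3 + 27 * k ^ 2 + 13 * k + 2) * bk p k := by
    simp only [SB, Finset.mul_sum, ← Finset.sum_add_distrib]
    exact Finset.sum_congr rfl fun k _ => by ring
  rw [e3, e2]
  exact ⟨-(32 * bk p p), by ring⟩

lemma choose_unit {n k : ℕ} (hk : k ≤ n) (hn : n < p) : IsUnit (n.choose k : ℤ_[p]) := by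
  apply isUnit_nat
  intro h
  have h2 : n.choose k ∣ n.factorial := by
    rw [← Nat.choose_mul_factorial_mul_factorial hk, mul_assoc]; exact dvd_mul_right _ _
  have := (Nat.Prime.dvd_factorial Fact.out).1 (h.trans h2)
  omega

lemma S0_J (hp : 3 < p) (h1 : p % 3 = 1) : (p : ℤ_[p]) ^ 3 ∣ SB p 0 - jacobiSum (cubc p) (cubc p) ^ 2 := by
  have t : (p : ℤ_[p]) ^ 3 ∣ TT p 1 * 3 ^ (p - 1) + jacobiSum (cubc p) (cubc p) := by
    apply dvd_unit_mul (isUnit_three hp)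
    obtain ⟨b, hb⟩ := T1_one hp h1
    obtain ⟨d, hd⟩ := jac_val hp h1
    exact ⟨b + d, by linear_combination hb + hd⟩
  obtain ⟨a, ha⟩ := (res1 hp h1).1
  obtain ⟨c, hc⟩ := kap_3 hp
  obtain ⟨f, hf⟩ := t
  generalize (3 : ℤ_[p]) ^ (p - 1) = E at *
  generalize jacobiSum (cubc p) (cubc p) = J at *
  refine ⟨a * E ^ 2 - c * (kap p * E + 1) * SB p 0 + f * (TT p 1 * E - J), ?_⟩
  linear_combination E ^ 2 * ha - (kap p * E + 1) * SB p 0 * hc + (TT p 1 * E - J) * hf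

lemma J_unit (hp : 3 < p) (h1 : p % 3 = 1) : IsUnit (jacobiSum (cubc p) (cubc p)) := by
  have h := jac_val hp h1
  have hK := choose_unit (p := p) (n := 2 * (p / 3)) (k := p / 3) (by omega) (by omega)
  have h3 := hK.mul (isUnit_three hp)
  rw [isUnit_iff_toZMod] at h3 ⊢
  intro h0
  apply h3
  have := (toZMod_eq_zero _).2 ((dvd_pow_self (p : ℤ_[p]) (by norm_num : 3 ≠ 0)).trans h)
  simpa [h0] using this

lemma one_S1 (hp : 3 < p) (h1 : p % 3 = 1) : (p : ℤ_[p]) ^ 3 ∣ SB p 0 + 5 * SB p 1 - p := by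
  obtain ⟨a, ha⟩ := (res1 hp h1).2.1
  obtain ⟨b, hb⟩ := T12 hp
  rw [(m_even hp h1).neg_one_pow] at hb
  apply dvd_unit_mul ((isUnit_kap hp).pow 3)
  exact ⟨a + b, by linear_combination ha + hb⟩

lemma one_L2 (hp : 3 < p) (h1 : p % 3 = 1) : (p : ℤ_[p]) ^ 3 ∣ (50 * SB p 2 + 19 * SB p 1 + 3 * SB p 0) * SB p 0 - 3 * p ^ 2 := by
  obtain ⟨a0, h0⟩ := (res1 hp h1).1
  obtain ⟨a, ha⟩ := (res1 hp h1).2.2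
  obtain ⟨b, hb⟩ := T12 hp
  rw [(m_even hp h1).neg_one_pow] at hb
  apply dvd_unit_mul ((isUnit_kap hp).pow 6)
  set L := 50 * SB p 2 + 19 * SB p 1 + 3 * SB p 0
  refine ⟨kap p ^ 4 * L * a0 + TT p 1 ^ 2 * a + 3 * b * (TT p 1 * TT p 2 + kap p ^ 3 * p), ?_⟩
  linear_combination kap p ^ 4 * L * h0 + TT p 1 ^ 2 * ha + 3 * (TT p 1 * TT p 2 + kap p ^ 3 * p) * hb

lemma one_final (hp : 3 < p) (h1 : p % 3 = 1) {x y : ℤ} (hx : 4 * (p : ℤ) = x ^ 2 + 27 * y ^ 2) :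
    (p : ℤ_[p]) ^ 3 ∣ 250 * (x : ℤ_[p]) ^ 2 * SB p 2 - (4 * x ^ 4 - 27 * p * x ^ 2 + 11 * p ^ 2) ∧
    (p : ℤ_[p]) ^ 3 ∣ 12500 * (x : ℤ_[p]) ^ 2 * SB p 3 - (42 * x ^ 4 - 221 * p * x ^ 2 - 447 * p ^ 2) := by
  obtain ⟨A, B, hAB, hA⟩ := jac_struct hp h1
  have hxA : (x : ℤ_[p]) ^ 2 = (A : ℤ_[p]) ^ 2 := by exact_mod_cast congrArg (fun n : ℤ => (n : ℤ_[p])) (repr_uniq hp hx hAB)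
  have hn := jac_norm hp h1
  have hJu := J_unit hp h1
  have hux := isUnit_int (x_ndvd hp hx)
  have hJb : (p : ℤ_[p]) ∣ jacobiSum (cubc p)⁻¹ (cubc p)⁻¹ := dvd_unit_mul hJu ⟨1, by rw [hn, mul_one]⟩
  obtain ⟨s, hs⟩ := S0_J hp h1
  obtain ⟨s1, hs1⟩ := one_S1 hp h1
  obtain ⟨l, hl⟩ := one_L2 hp h1
  obtain ⟨t, ht⟩ := tele3 hp
  obtain ⟨j, hj⟩ := hJb
  have hS0 : IsUnit (SB p 0) := by
    rw [show SB p 0 = jacobiSum (cubc p) (cubc p) ^ 2 + (p : ℤ_[p]) ^ 3 * s by linear_combination hs]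
    rw [isUnit_iff_toZMod] at hJu ⊢
    simpa using hJu
  rw [hj] at hA hn
  set X := (x : ℤ_[p])
  set J := jacobiSum (cubc p) (cubc p)
  have hX : X ^ 2 = J ^ 2 + 2 * p + p ^ 2 * j ^ 2 := by
    rw [hxA, hA]; linear_combination 2 * hn
  have hJj : J * j = 1 := by
    apply mul_left_cancel₀ (show (p : ℤ_[p]) ≠ 0 from Nat.cast_ne_zero.2 (by omega))
    linear_combination hn
  have f0 : (p : ℤ_[p]) ^ 3 ∣ X ^ 2 * SB p 0 - (X ^ 4 - 2 * p * X ^ 2 - p ^ 2) := by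
    refine ⟨X ^ 2 * s - (2 * j ^ 2 + p * j ^ 4), ?_⟩
    linear_combination X ^ 2 * hs - (X ^ 2 + p ^ 2 * j ^ 2) * hX - p ^ 2 * (J * j + 1) * hJj
  have fL : (p : ℤ_[p]) ^ 3 ∣ X ^ 2 * (50 * SB p 2 + 19 * SB p 1 + 3 * SB p 0) - 3 * p ^ 2 := by
    have hL : (p : ℤ_[p]) ^ 2 ∣ 50 * SB p 2 + 19 * SB p 1 + 3 * SB p 0 := by
      apply dvd_unit_mul hS0
      exact ⟨3 + p * l, by linear_combination hl⟩
    obtain ⟨q, hq⟩ := hL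
    obtain ⟨f, hf⟩ := f0
    rw [hq] at hl ⊢
    apply dvd_unit_mul (hux.pow 2)
    change _ ∣ X ^ 2 * _
    refine ⟨X ^ 2 * l - p ^ 2 * q * f + q * (2 * X ^ 2 + p), ?_⟩
    linear_combination X ^ 2 * hl - p ^ 2 * q * hf
  obtain ⟨f, hf⟩ := f0
  obtain ⟨g, hg⟩ := fL
  have F2 : 250 * X ^ 2 * SB p 2 - (4 * X ^ 4 - 27 * p * X ^ 2 + 11 * p ^ 2) = (p : ℤ_[p]) ^ 3 * (5 * g - 19 * X ^ 2 * s1 + 4 * f) := by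
    linear_combination 5 * hg - 19 * X ^ 2 * hs1 + 4 * hf
  refine ⟨⟨_, F2⟩, 250 * X ^ 2 * t - 27 * (5 * g - 19 * X ^ 2 * s1 + 4 * f) - 650 * X ^ 2 * s1 + 150 * f, ?_⟩
  linear_combination 250 * X ^ 2 * ht - 27 * F2 - 650 * X ^ 2 * hs1 + 150 * hf

lemma two_final (hp : 3 < p) (h1 : p % 3 = 2) :
    (p : ℤ_[p]) ^ 2 ∣ 250 * SB p 2 - (20 * (2 * p + 1) * ((2 * p / 3).choose (p / 3) : ℤ_[p]) ^ 2 + 19 * p) ∧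
    (p : ℤ_[p]) ^ 2 ∣ 12500 * SB p 3 - (-540 * (2 * p + 1) * ((2 * p / 3).choose (p / 3) : ℤ_[p]) ^ 2 + 137 * p) := by
  obtain ⟨⟨a0, h0⟩, ⟨a1, hs1⟩, ⟨a2, h2⟩⟩ := res2 hp h1
  obtain ⟨b, hb⟩ := T12 hp
  have hodd : Odd (p / 3) := by
    have := p_odd hp
    rw [Nat.odd_iff]; omega
  rw [hodd.neg_one_pow] at hb
  obtain ⟨v, hv⟩ := T1_two hp h1
  obtain ⟨c, hc⟩ := kap_3 hp
  obtain ⟨t, ht⟩ := tele3 hp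
  have hK := choose_unit (p := p) (n := 2 * p / 3) (k := p / 3) (by omega) (by omega)
  have hT1 : IsUnit (TT p 1) := by
    have hu : IsUnit (TT p 1 * 3 ^ (p - 1)) := by
      rw [show TT p 1 * 3 ^ (p - 1) = ((p : ℤ_[p]) + 1) * ((2 * p / 3).choose (p / 3) : ℤ_[p]) + p ^ 2 * v by linear_combination hv]
      rw [isUnit_iff_toZMod] at hK ⊢
      simpa using hK
    exact isUnit_of_mul_isUnit_left hu
  have hT2 : (p : ℤ_[p]) ∣ TT p 2 := dvd_unit_mul hT1 ⟨p ^ 2 * b - kap p ^ 3, by linear_combination hb⟩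
  obtain ⟨w, hw⟩ := hT2
  have g0 : (p : ℤ_[p]) ^ 2 ∣ SB p 0 := by
    apply dvd_unit_mul ((isUnit_four hp).mul ((isUnit_kap hp).pow 4))
    rw [hw] at h0
    exact ⟨a0 + 3 * w ^ 2, by linear_combination h0⟩
  have g1 : (p : ℤ_[p]) ^ 2 ∣ SB p 0 + 5 * SB p 1 + p := by
    apply dvd_unit_mul ((isUnit_kap hp).pow 3)
    exact ⟨a1 + p * b, by linear_combination hs1 + hb⟩
  set K := ((2 * p / 3).choose (p / 3) : ℤ_[p])
  have g2 : (p : ℤ_[p]) ^ 2 ∣ (50 * SB p 2 + 19 * SB p 1 + 3 * SB p 0) - 4 * (2 * p + 1) * K ^ 2 := by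
    set L := 50 * SB p 2 + 19 * SB p 1 + 3 * SB p 0
    generalize (3 : ℤ_[p]) ^ (p - 1) = E at *
    refine ⟨E ^ 2 * a2 - (kap p * E + 1) * L * (p * c) + 4 * (TT p 1 * E + (p + 1) * K) * v + 4 * K ^ 2, ?_⟩
    linear_combination E ^ 2 * h2 - (kap p * E + 1) * L * hc + 4 * (TT p 1 * E + (p + 1) * K) * hv
  obtain ⟨c0, g0⟩ := g0
  obtain ⟨c1, g1⟩ := g1
  obtain ⟨c2, g2⟩ := g2
  have F2 : 250 * SB p 2 - (20 * (2 * p + 1) * K ^ 2 + 19 * p) = (p : ℤ_[p]) ^ 2 * (5 * c2 - 19 * c1 + 4 * c0) := by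
    linear_combination 5 * g2 - 19 * g1 + 4 * g0
  refine ⟨⟨_, F2⟩, 250 * p * t - 27 * (5 * c2 - 19 * c1 + 4 * c0) - 650 * c1 + 150 * c0, ?_⟩
  linear_combination 250 * ht - 27 * F2 - 650 * g1 + 150 * g0

lemma coe_inv {n : ℤ_[p]} (hn : IsUnit n) : ((Ring.inverse n : ℤ_[p]) : ℚ_[p]) = (n : ℚ_[p])⁻¹ := by
  have h := Ring.mul_inverse_cancel _ hn
  have h2 : (n : ℚ_[p]) * ((Ring.inverse n : ℤ_[p]) : ℚ_[p]) = 1 := by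
    rw [← PadicInt.coe_mul, h, PadicInt.coe_one]
  exact eq_inv_of_mul_eq_one_right h2

lemma coe_num (n : ℕ) [n.AtLeastTwo] : ((OfNat.ofNat n : ℤ_[p]) : ℚ_[p]) = OfNat.ofNat n := rfl

lemma SB_coe (hp : 3 < p) (i : ℕ) : ((SB p i : ℤ_[p]) : ℚ_[p]) =
    ((∑ k ∈ Finset.range p, (k : ℚ) ^ i * ((2 * k).choose k : ℚ) ^ 2 * ((3 * k).choose k : ℚ) / (-192) ^ k : ℚ) : ℚ_[p]) := by
  rw [SB, PadicInt.coe_sum, Rat.cast_sum]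
  apply Finset.sum_congr rfl
  intro k _
  have h2 := coe_inv (isUnit_two (p := p) hp)
  have h108 := coe_inv (isUnit_108 (p := p) hp)
  rw [show ((2 : ℤ_[p]) : ℚ_[p]) = 2 from rfl] at h2
  rw [show ((108 : ℤ_[p]) : ℚ_[p]) = 108 from rfl] at h108
  rw [bk, AA]
  simp only [PadicInt.coe_mul, PadicInt.coe_pow, PadicInt.coe_neg, PadicInt.coe_natCast, h2, h108]
  rw [show ((36 : ℤ_[p]) : ℚ_[p]) = 36 from rfl]
  push_cast
  rw [pow_mul, div_eq_mul_inv, ← inv_pow]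
  have e : ((-192 : ℚ_[p])⁻¹) = -36 * 108⁻¹ * (2⁻¹) ^ 6 := by norm_num
  rw [e, mul_pow, mul_pow]
  ring

lemma bridge {r : ℕ} {q : ℚ} {D : ℤ} {w : ℤ_[p]} (hD : ¬ (p : ℤ) ∣ D) (hw : (p : ℤ_[p]) ^ r ∣ w)
    (h : (w : ℚ_[p]) = ((D * q : ℚ) : ℚ_[p])) : (p : ℤ) ^ r ∣ q.num := by
  rw [← PadicInt.pow_p_dvd_int_iff (p := p)]
  apply dvd_unit_mul (isUnit_int hD)
  have e : (D : ℤ_[p]) * (q.num : ℤ_[p]) = w * (q.den : ℤ_[p]) := by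
    apply Subtype.val_injective
    change (((D : ℤ_[p]) * (q.num : ℤ_[p]) : ℤ_[p]) : ℚ_[p]) = ((w * (q.den : ℤ_[p]) : ℤ_[p]) : ℚ_[p])
    rw [PadicInt.coe_mul, PadicInt.coe_mul, h, PadicInt.coe_intCast, PadicInt.coe_intCast, PadicInt.coe_natCast]
    have := Rat.mul_den_eq_num q
    have h2 : (q : ℚ_[p]) * (q.den : ℚ_[p]) = (q.num : ℚ_[p]) := by exact_mod_cast congrArg (fun t : ℚ => (t : ℚ_[p])) this
    push_cast
    rw [← h2]; ring
  rw [e]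
  exact hw.mul_right _

lemma ndvd_250 (hp : 3 < p) (h5 : p ≠ 5) : ¬ (p : ℤ) ∣ 250 ∧ ¬ (p : ℤ) ∣ 12500 := by
  have hpp : p.Prime := Fact.out
  have : ¬ p ∣ 12500 := by
    intro h
    rw [show 12500 = 2 ^ 2 * 5 ^ 5 by norm_num] at h
    rcases (Nat.Prime.dvd_mul hpp).1 h with h | h
    · have := Nat.le_of_dvd (by norm_num) (hpp.dvd_of_dvd_pow h); omega
    · exact h5 ((Nat.prime_dvd_prime_iff_eq hpp (by norm_num)).1 (hpp.dvd_of_dvd_pow h))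
  have h2 : ¬ (p : ℤ) ∣ 12500 := by exact_mod_cast this
  exact ⟨fun h => h2 (h.trans (by norm_num)), h2⟩

end fin
end S8

theorem statement8 (p : ℕ) (hp : p.Prime) (hp3 : 3 < p) :
    (∀ x y : ℤ, p % 3 = 1 → 4*(p : ℤ) = x^2 + 27*y^2 →
      ratCongr p 3
        (∑ k ∈ Finset.range p,
          (k:ℚ)^2 * ((2*k).choose k : ℚ)^2 * ((3*k).choose k : ℚ) / (-192)^k)
        (2/125*(x:ℚ)^2 - 27/250*(p:ℚ) + 11*(p:ℚ)^2/(250*(x:ℚ)^2)) ∧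
      ratCongr p 3
        (∑ k ∈ Finset.range p,
          (k:ℚ)^3 * ((2*k).choose k : ℚ)^2 * ((3*k).choose k : ℚ) / (-192)^k)
        (21/6250*(x:ℚ)^2 - 221/12500*(p:ℚ) - 447*(p:ℚ)^2/(12500*(x:ℚ)^2))) ∧
    (p % 3 = 2 → p ≠ 5 →
      ratCongr p 2
        (∑ k ∈ Finset.range p,
          (k:ℚ)^2 * ((2*k).choose k : ℚ)^2 * ((3*k).choose k : ℚ) / (-192)^k)
        (2/25*(2*(p:ℚ)+1)*((2*p/3).choose (p/3) : ℚ)^2 + 19/250*(p:ℚ)) ∧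
      ratCongr p 2
        (∑ k ∈ Finset.range p,
          (k:ℚ)^3 * ((2*k).choose k : ℚ)^2 * ((3*k).choose k : ℚ) / (-192)^k)
        (-(27/625)*(2*(p:ℚ)+1)*((2*p/3).choose (p/3) : ℚ)^2 + 137/12500*(p:ℚ))) := by
  haveI : Fact p.Prime := ⟨hp⟩
  have s2 := S8.SB_coe (p := p) hp3 2
  have s3 := S8.SB_coe (p := p) hp3 3
  constructor
  · intro x y h1 hx
    obtain ⟨f2, f3⟩ := S8.one_final hp3 h1 hx
    obtain ⟨n2, n3⟩ := S8.ndvd_250 (p := p) hp3 (by omega)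
    have nx := S8.x_ndvd hp3 hx
    have hpp : Prime (p : ℤ) := Nat.prime_iff_prime_int.1 hp
    have nx2 : ¬ (p : ℤ) ∣ x ^ 2 := fun h => nx (hpp.dvd_of_dvd_pow h)
    have x0 : (x : ℚ) ≠ 0 := by
      intro h
      have : x = 0 := by exact_mod_cast h
      exact nx (this ▸ dvd_zero _)
    constructor
    · refine S8.bridge (p := p) (D := 250 * x ^ 2) (fun h => (hpp.dvd_or_dvd h).elim n2 nx2) f2 ?_
      generalize (∑ k ∈ Finset.range p, (k:ℚ)^2 * ((2*k).choose k : ℚ)^2 * ((3*k).choose k : ℚ) / (-192)^k) = S at *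
      have e : (((250 * x ^ 2 : ℤ) : ℚ) * (S - (2/125*(x:ℚ)^2 - 27/250*(p:ℚ) + 11*(p:ℚ)^2/(250*(x:ℚ)^2)))) =
          250 * (x : ℚ) ^ 2 * S - (4 * (x : ℚ) ^ 4 - 27 * p * (x : ℚ) ^ 2 + 11 * (p : ℚ) ^ 2) := by
        push_cast; field_simp; ring
      rw [e]
      simp only [PadicInt.coe_sub, PadicInt.coe_add, PadicInt.coe_mul, PadicInt.coe_pow, PadicInt.coe_neg, PadicInt.coe_natCast, PadicInt.coe_intCast, PadicInt.coe_one]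
      rw [show ((250 : ℤ_[p]) : ℚ_[p]) = 250 from rfl, show ((4 : ℤ_[p]) : ℚ_[p]) = 4 from rfl, show ((27 : ℤ_[p]) : ℚ_[p]) = 27 from rfl, show ((11 : ℤ_[p]) : ℚ_[p]) = 11 from rfl]
      rw [s2]
      push_cast
      ring
    · refine S8.bridge (p := p) (D := 12500 * x ^ 2) (fun h => (hpp.dvd_or_dvd h).elim n3 nx2) f3 ?_
      generalize (∑ k ∈ Finset.range p, (k:ℚ)^3 * ((2*k).choose k : ℚ)^2 * ((3*k).choose k : ℚ) / (-192)^k) = S at *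
      have e : (((12500 * x ^ 2 : ℤ) : ℚ) * (S - (21/6250*(x:ℚ)^2 - 221/12500*(p:ℚ) - 447*(p:ℚ)^2/(12500*(x:ℚ)^2)))) =
          12500 * (x : ℚ) ^ 2 * S - (42 * (x : ℚ) ^ 4 - 221 * p * (x : ℚ) ^ 2 - 447 * (p : ℚ) ^ 2) := by
        push_cast; field_simp; ring
      rw [e]
      simp only [PadicInt.coe_sub, PadicInt.coe_add, PadicInt.coe_mul, PadicInt.coe_pow, PadicInt.coe_neg, PadicInt.coe_natCast, PadicInt.coe_intCast, PadicInt.coe_one]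
      rw [show ((12500 : ℤ_[p]) : ℚ_[p]) = 12500 from rfl, show ((42 : ℤ_[p]) : ℚ_[p]) = 42 from rfl, show ((221 : ℤ_[p]) : ℚ_[p]) = 221 from rfl, show ((447 : ℤ_[p]) : ℚ_[p]) = 447 from rfl]
      rw [s3]
      push_cast
      ring
  · intro h1 h5
    obtain ⟨f2, f3⟩ := S8.two_final hp3 h1
    obtain ⟨n2, n3⟩ := S8.ndvd_250 (p := p) hp3 h5
    constructor
    · refine S8.bridge (p := p) (D := 250) n2 f2 ?_
      generalize (∑ k ∈ Finset.range p, (k:ℚ)^2 * ((2*k).choose k : ℚ)^2 * ((3*k).choose k : ℚ) / (-192)^k) = S at *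
      have e : (((250 : ℤ) : ℚ) * (S - (2/25*(2*(p:ℚ)+1)*((2*p/3).choose (p/3) : ℚ)^2 + 19/250*(p:ℚ)))) =
          250 * S - (20 * (2 * p + 1) * ((2*p/3).choose (p/3) : ℚ) ^ 2 + 19 * p) := by
        push_cast; ring
      rw [e]
      simp only [PadicInt.coe_sub, PadicInt.coe_add, PadicInt.coe_mul, PadicInt.coe_pow, PadicInt.coe_neg, PadicInt.coe_natCast, PadicInt.coe_intCast, PadicInt.coe_one]
      rw [show ((250 : ℤ_[p]) : ℚ_[p]) = 250 from rfl, show ((20 : ℤ_[p]) : ℚ_[p]) = 20 from rfl, show ((2 : ℤ_[p]) : ℚ_[p]) = 2 from rfl, show ((19 : ℤ_[p]) : ℚ_[p]) = 19 from rfl]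
      rw [s2]
      push_cast
      ring
    · refine S8.bridge (p := p) (D := 12500) n3 f3 ?_
      generalize (∑ k ∈ Finset.range p, (k:ℚ)^3 * ((2*k).choose k : ℚ)^2 * ((3*k).choose k : ℚ) / (-192)^k) = S at *
      have e : (((12500 : ℤ) : ℚ) * (S - (-(27/625)*(2*(p:ℚ)+1)*((2*p/3).choose (p/3) : ℚ)^2 + 137/12500*(p:ℚ)))) =
          12500 * S - (-540 * (2 * p + 1) * ((2*p/3).choose (p/3) : ℚ) ^ 2 + 137 * p) := by
        push_cast; ring
      rw [e]
      simp only [PadicInt.coe_sub, PadicInt.coe_add, PadicInt.coe_mul, PadicInt.coe_pow, PadicInt.coe_neg, PadicInt.coe_natCast, PadicInt.coe_intCast, PadicInt.coe_one]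
      rw [show ((12500 : ℤ_[p]) : ℚ_[p]) = 12500 from rfl, show ((540 : ℤ_[p]) : ℚ_[p]) = 540 from rfl, show ((2 : ℤ_[p]) : ℚ_[p]) = 2 from rfl, show ((137 : ℤ_[p]) : ℚ_[p]) = 137 from rfl]
      rw [s3]
      push_cast
      ring
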